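/- Blowup of the velocity gradient for IPM with a smooth source: there exist an initial datum ρ₀ ∈ C_c^∞(ℝ²), a source F : ℝ² × [0,1) → ℝ such that each F(·,t) is C^∞ and supported in the closed unit ball and sup_{t∈[0,1)} ‖F(·,t)‖_{C^k} < ∞ for every k ∈ ℕ, and a smooth solution (ρ,u,P) of the IPM system on ℝ² × [0,1) with ρ(·,0) = ρ₀, each ρ(·,t) compactly supported and each u(·,t) square integrable, such that lim_{t→1⁻} sup_{x∈ℝ²} |∇u(x,t)| = ∞ and moreover lim_{t→1⁻} ∫₀^t sup_{x∈ℝ²} |∇u(x,s)| ds = ∞. -/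

import Mathlib

open MeasureTheory Real Filter

/-- First spatial partial derivative `∂/∂x₁`. -/
noncomputable def pd1 (f : ℝ × ℝ → ℝ) : ℝ × ℝ → ℝ := fun x => fderiv ℝ f x (1, 0)

/-- Second spatial partial derivative `∂/∂x₂`. -/
noncomputable def pd2 (f : ℝ × ℝ → ℝ) : ℝ × ℝ → ℝ := fun x => fderiv ℝ f x (0, 1)

/-- Mixed partial derivative `∂₁^i ∂₂^j f`. -/
noncomputable def pdMix (i j : ℕ) (f : ℝ × ℝ → ℝ) : ℝ × ℝ → ℝ := pd1^[i] (pd2^[j] f)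

/-- The `C^k` norm: supremum of the absolute values of all partial derivatives
of order at most `k`. -/
noncomputable def CkNorm (k : ℕ) (f : ℝ × ℝ → ℝ) : ℝ :=
  sSup {y : ℝ | ∃ i j : ℕ, ∃ x : ℝ × ℝ, i + j ≤ k ∧ y = |pdMix i j f x|}

/-- The space-time domain `ℝ² × [0,1)`. -/
def spaceTime : Set ((ℝ × ℝ) × ℝ) := Set.univ ×ˢ Set.Ico (0 : ℝ) 1

/-- `sup_{x ∈ ℝ²} |∇u(x,t)|`, with `|∇u|` the Euclidean norm of the spatial Jacobian. -/
noncomputable def jacSup (u : (ℝ × ℝ) × ℝ → ℝ × ℝ) (t : ℝ) : ℝ :=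
  sSup {y : ℝ | ∃ x : ℝ × ℝ, y = Real.sqrt
    ((pd1 (fun z => (u (z, t)).1) x) ^ 2 + (pd2 (fun z => (u (z, t)).1) x) ^ 2
      + (pd1 (fun z => (u (z, t)).2) x) ^ 2 + (pd2 (fun z => (u (z, t)).2) x) ^ 2)}

section Calculus

variable {E F H : Type} [NormedAddCommGroup E] [NormedSpace ℝ E] [NormedAddCommGroup F]
  [NormedSpace ℝ F] [NormedAddCommGroup H] [NormedSpace ℝ H]

/-- Smoothness. -/
abbrev Sm (f : E → F) : Prop := ContDiff ℝ (⊤ : ℕ∞) f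

/-- Directional derivative along a fixed vector. -/
noncomputable def dd (v : E) (f : E → ℝ) : E → ℝ := fun x => fderiv ℝ f x v

theorem Sm.diff {f : E → F} (hf : Sm f) : Differentiable ℝ f := hf.differentiable (by simp)

theorem Sm.dd {f : E → ℝ} (hf : Sm f) (v : E) : Sm (dd v f) :=
  (hf.fderiv_right (m := (⊤ : ℕ∞)) (by simp)).clm_apply contDiff_const

theorem dd_eq_of_hasFDerivAt {f : E → ℝ} {L : E →L[ℝ] ℝ} {x : E} (h : HasFDerivAt f L x) (v : E) :
    dd v f x = L v := by rw [dd, h.fderiv]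

theorem dd_const (v : E) (c : ℝ) : dd v (fun _ => c) = fun _ => 0 := by
  funext x; simp [dd]

theorem dd_add {f g : E → ℝ} (v : E) (hf : Sm f) (hg : Sm g) :
    dd v (fun x => f x + g x) = fun x => dd v f x + dd v g x := by
  funext x; simp only [dd]; rw [fderiv_fun_add (hf.diff x) (hg.diff x)]; simp

theorem dd_sub {f g : E → ℝ} (v : E) (hf : Sm f) (hg : Sm g) :
    dd v (fun x => f x - g x) = fun x => dd v f x - dd v g x := by
  funext x; simp only [dd]; rw [fderiv_fun_sub (hf.diff x) (hg.diff x)]; simp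

theorem dd_neg {f : E → ℝ} (v : E) :
    dd v (fun x => - f x) = fun x => - dd v f x := by
  funext x; simp only [dd]; rw [fderiv_fun_neg]; simp

theorem dd_mul {f g : E → ℝ} (v : E) (hf : Sm f) (hg : Sm g) :
    dd v (fun x => f x * g x) = fun x => dd v f x * g x + f x * dd v g x := by
  funext x; simp only [dd]; rw [fderiv_fun_mul (hf.diff x) (hg.diff x)]
  simp; ring

theorem dd_const_mul {f : E → ℝ} (v : E) (c : ℝ) (hf : Sm f) :
    dd v (fun x => c * f x) = fun x => c * dd v f x := by
  funext x; simp only [dd]; rw [fderiv_const_mul (hf.diff x)]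
  simp

theorem dd_comm {f : E → ℝ} (u v : E) (hf : Sm f) : dd u (dd v f) = dd v (dd u f) := by
  funext x
  have h2 : Differentiable ℝ (fderiv ℝ f) :=
    (hf.fderiv_right (m := (⊤ : ℕ∞)) (by simp)).differentiable (by simp)
  have key : ∀ a b : E, dd a (dd b f) x = fderiv ℝ (fderiv ℝ f) x a b := by
    intro a b
    change fderiv ℝ (fun y => fderiv ℝ f y b) x a = _
    rw [fderiv_clm_apply (h2 x) (differentiableAt_const b)]
    simp
  rw [key, key]
  have h := second_derivative_symmetric (f := f) (x := x) (fun y => (hf.diff y).hasFDerivAt)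
    (h2 x).hasFDerivAt u v
  exact h

theorem dd_eventuallyEq {f g : E → ℝ} {x : E} (v : E) (h : f =ᶠ[nhds x] g) :
    dd v f x = dd v g x := by
  simp only [dd, h.fderiv_eq]

theorem dd_eqOn {f g : E → ℝ} {U : Set E} (hU : IsOpen U) (v : E) (h : ∀ x ∈ U, f x = g x) :
    ∀ x ∈ U, dd v f x = dd v g x := fun x hx =>
  dd_eventuallyEq v (Filter.eventuallyEq_of_mem (hU.mem_nhds hx) h)

theorem dd_zero_on {f : E → ℝ} {U : Set E} (hU : IsOpen U) (v : E) (h : ∀ x ∈ U, f x = 0) :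
    ∀ x ∈ U, dd v f x = 0 := fun x hx => by
  rw [dd_eqOn hU v (g := fun _ => 0) h x hx, dd_const]

theorem dd_comp {f : F → ℝ} {L : E → F} (hf : Sm f) (hL : Sm L) (v : E) (x : E) :
    dd v (fun y => f (L y)) x = dd (fderiv ℝ L x v) f (L x) := by
  have := (hf.diff (L x)).hasFDerivAt.comp x (hL.diff x).hasFDerivAt
  exact dd_eq_of_hasFDerivAt this v

theorem dd_vec_add {f : E → ℝ} (u v x : E) : dd (u + v) f x = dd u f x + dd v f x := by
  simp [dd]

theorem dd_vec_smul {f : E → ℝ} (c : ℝ) (v : E) (x : E) : dd (c • v) f x = c * dd v f x := by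
  simp [dd]

theorem hasFDerivAt_param [FiniteDimensional ℝ E] (f : E × ℝ → H) (hf : Sm f) (x : E) :
    HasFDerivAt (fun x => ∫ s in (0:ℝ)..1, f (x, s))
      (∫ s in (0:ℝ)..1, (fderiv ℝ f (x, s)).comp (ContinuousLinearMap.inl ℝ E ℝ)) x := by
  have hc : Continuous (fun q : E × ℝ => (fderiv ℝ f q).comp (ContinuousLinearMap.inl ℝ E ℝ)) :=
    (hf.continuous_fderiv (by simp)).clm_comp continuous_const
  have hK : IsCompact (Metric.closedBall x 1 ×ˢ Set.Icc (0:ℝ) 1) :=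
    (isCompact_closedBall x 1).prod isCompact_Icc
  obtain ⟨C, hC⟩ := hK.exists_bound_of_continuousOn hc.continuousOn
  refine intervalIntegral.hasFDerivAt_integral_of_dominated_of_fderiv_le
    (F := fun x s => f (x, s))
    (F' := fun y s => (fderiv ℝ f (y, s)).comp (ContinuousLinearMap.inl ℝ E ℝ))
    (bound := fun _ => C) (Metric.ball_mem_nhds x one_pos) ?_ ?_ ?_ ?_ ?_ ?_
  · refine Filter.Eventually.of_forall fun y => ?_
    exact (hf.continuous.comp (by fun_prop : Continuous fun s : ℝ => (y, s))).aestronglyMeasurable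
  · exact (hf.continuous.comp (by fun_prop : Continuous fun s : ℝ => (x, s))).intervalIntegrable _ _
  · exact (hc.comp (by fun_prop : Continuous fun s : ℝ => (x, s))).aestronglyMeasurable
  · refine Filter.Eventually.of_forall fun s hs y hy => hC _ ⟨Metric.ball_subset_closedBall hy, ?_⟩
    rw [Set.uIoc_of_le zero_le_one] at hs
    exact ⟨hs.1.le, hs.2⟩
  · exact intervalIntegrable_const
  · refine Filter.Eventually.of_forall fun s hs y hy => ?_
    have h1 : HasFDerivAt (fun y : E => (y, s)) (ContinuousLinearMap.inl ℝ E ℝ) y :=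
      hasFDerivAt_prodMk_left y s
    exact ((hf.diff (y, s)).hasFDerivAt).comp y h1

theorem contDiff_param_nat [FiniteDimensional ℝ E] (n : ℕ) :
    ∀ (H : Type) [NormedAddCommGroup H] [NormedSpace ℝ H] (f : E × ℝ → H), Sm f →
      ContDiff ℝ n (fun x => ∫ s in (0:ℝ)..1, f (x, s)) := by
  induction n with
  | zero =>
    intro H _ _ f hf
    have : Differentiable ℝ (fun x => ∫ s in (0:ℝ)..1, f (x, s)) :=
      fun x => (hasFDerivAt_param f hf x).differentiableAt
    simpa using this.continuous
  | succ n ih =>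
    intro H _ _ f hf
    have h : ((n + 1 : ℕ) : WithTop ℕ∞) = (n : WithTop ℕ∞) + 1 := by norm_cast
    rw [h, contDiff_succ_iff_hasFDerivAt]
    · refine ⟨fun x => ∫ s in (0:ℝ)..1, (fderiv ℝ f (x, s)).comp (ContinuousLinearMap.inl ℝ E ℝ),
        ?_, fun x => hasFDerivAt_param f hf x⟩
      exact ih _ (fun q => (fderiv ℝ f q).comp (ContinuousLinearMap.inl ℝ E ℝ))
        ((hf.fderiv_right (m := (⊤ : ℕ∞)) (by simp)).clm_comp contDiff_const)

theorem sm_param [FiniteDimensional ℝ E] (f : E × ℝ → H) (hf : Sm f) :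
    Sm (fun x => ∫ s in (0:ℝ)..1, f (x, s)) :=
  contDiff_infty.2 fun n => contDiff_param_nat n H f hf

theorem dd_param [FiniteDimensional ℝ E] (f : E × ℝ → ℝ) (hf : Sm f) (v x : E) :
    dd v (fun x => ∫ s in (0:ℝ)..1, f (x, s)) x = ∫ s in (0:ℝ)..1, dd v (fun y => f (y, s)) x := by
  rw [dd_eq_of_hasFDerivAt (hasFDerivAt_param f hf x)]
  have hc : Continuous (fun q : E × ℝ => (fderiv ℝ f q).comp (ContinuousLinearMap.inl ℝ E ℝ)) :=
    (hf.continuous_fderiv (by simp)).clm_comp continuous_const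
  have hi : IntervalIntegrable
      (fun s => (fderiv ℝ f (x, s)).comp (ContinuousLinearMap.inl ℝ E ℝ)) volume 0 1 :=
    (hc.comp (by fun_prop : Continuous fun s : ℝ => (x, s))).intervalIntegrable _ _
  rw [ContinuousLinearMap.intervalIntegral_apply hi]
  refine intervalIntegral.integral_congr fun s _ => ?_
  have h1 : HasFDerivAt (fun y : E => (y, s)) (ContinuousLinearMap.inl ℝ E ℝ) x :=
    hasFDerivAt_prodMk_left x s
  exact (dd_eq_of_hasFDerivAt (((hf.diff (x, s)).hasFDerivAt).comp x h1) v).symm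

end Calculus

section Lifted

theorem dd_line {E : Type} [NormedAddCommGroup E] [NormedSpace ℝ E] {f : E → ℝ} (hf : Sm f)
    (x v : E) (s : ℝ) : HasDerivAt (fun τ : ℝ => f (x + τ • v)) (dd v f (x + s • v)) s := by
  have h1 : HasDerivAt (fun τ : ℝ => x + τ • v) v s := by
    simpa using ((hasDerivAt_id s).smul_const v).const_add x
  exact (hf.diff (x + s • v)).hasFDerivAt.comp_hasDerivAt s h1

/-- The lifted domain, with coordinates `(t, θ, y₁, y₂)`. -/
abbrev Z := ℝ × ℝ × ℝ × ℝ

/-- The time direction. -/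
def eT : Z := (1, 0, 0, 0)

/-- The spatial directions `θ, y₁, y₂`. -/
def ev : Fin 3 → Z := ![(0, 1, 0, 0), (0, 0, 1, 0), (0, 0, 0, 1)]

theorem ev_fst (k : Fin 3) : (ev k).1 = 0 := by fin_cases k <;> rfl

/-- Iterated spatial derivative along a word of directions. -/
noncomputable def wd : List (Fin 3) → (Z → ℝ) → Z → ℝ
  | [], f => f
  | k :: l, f => wd l (dd (ev k) f)

theorem wd_smul_time {c : ℝ → ℝ} (hc : Sm c) (l : List (Fin 3)) :
    ∀ {f : Z → ℝ}, Sm f → wd l (fun z => c z.1 * f z) = fun z => c z.1 * wd l f z := by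
  induction l with
  | nil => intro f _; rfl
  | cons k l ih =>
    intro f hf
    have h1 : dd (ev k) (fun z : Z => c z.1 * f z) = fun z => c z.1 * dd (ev k) f z := by
      have hs : Sm (fun z : Z => c z.1) := hc.comp contDiff_fst
      rw [dd_mul _ hs hf]
      funext z
      have : dd (ev k) (fun z : Z => c z.1) z = 0 := by
        rw [dd_comp hc contDiff_fst]
        simp [dd, fderiv_fst, ev_fst]
      rw [this]; ring
    simp only [wd]
    rw [h1, ih (hf.dd _)]

theorem wd_add (l : List (Fin 3)) : ∀ {f g : Z → ℝ}, Sm f → Sm g →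
    wd l (fun z => f z + g z) = fun z => wd l f z + wd l g z := by
  induction l with
  | nil => intros; rfl
  | cons k l ih =>
    intro f g hf hg
    simp only [wd]
    rw [dd_add _ hf hg, ih (hf.dd _) (hg.dd _)]

/-- Weighted average in the fast variable. -/
noncomputable def Av (κ : ℝ → ℝ) (f : Z → ℝ) : Z → ℝ :=
  fun z => ∫ s in (0:ℝ)..1, κ s * f (z + s • ev 0)

theorem sm_Av_aux {κ : ℝ → ℝ} (hκ : Sm κ) {f : Z → ℝ} (hf : Sm f) :
    Sm (fun q : Z × ℝ => κ q.2 * f (q.1 + q.2 • ev 0)) :=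
  (hκ.comp contDiff_snd).mul
    (hf.comp (contDiff_fst.add (contDiff_snd.smul contDiff_const)))

theorem sm_Av {κ : ℝ → ℝ} (hκ : Sm κ) {f : Z → ℝ} (hf : Sm f) : Sm (Av κ f) :=
  sm_param _ (sm_Av_aux hκ hf)

theorem dd_Av {κ : ℝ → ℝ} (hκ : Sm κ) {f : Z → ℝ} (hf : Sm f) (v : Z) :
    dd v (Av κ f) = Av κ (dd v f) := by
  funext z
  refine (dd_param _ (sm_Av_aux hκ hf) v z).trans ?_
  refine intervalIntegral.integral_congr fun s _ => ?_
  have hsh : Sm (fun y : Z => y + s • ev 0) := contDiff_id.add contDiff_const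
  have h2 : dd v (fun y : Z => f (y + s • ev 0)) z = dd v f (z + s • ev 0) := by
    rw [dd_comp hf hsh]
    congr 1
    rw [fderiv_add_const]; simp
  change dd v (fun y : Z => κ s * f (y + s • ev 0)) z = κ s * dd v f (z + s • ev 0)
  have h3 : Sm (fun y : Z => f (y + s • ev 0)) := hf.comp hsh
  rw [dd_const_mul _ _ h3]
  exact congrArg (κ s * ·) h2

theorem wd_Av {κ : ℝ → ℝ} (hκ : Sm κ) (l : List (Fin 3)) : ∀ {f : Z → ℝ}, Sm f →
    wd l (Av κ f) = Av κ (wd l f) := by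
  induction l with
  | nil => intros; rfl
  | cons k l ih =>
    intro f hf
    simp only [wd]
    rw [dd_Av hκ hf, ih (hf.dd _)]

theorem abs_Av_le {κ : ℝ → ℝ} (hb : ∀ s ∈ Set.Icc (0:ℝ) 1, |κ s| ≤ 1) {f : Z → ℝ} {z : Z} {C : ℝ}
    (h : ∀ z' : Z, z'.1 = z.1 → |f z'| ≤ C) : |Av κ f z| ≤ C := by
  have hC : 0 ≤ C := (abs_nonneg _).trans (h z rfl)
  have := intervalIntegral.norm_integral_le_of_norm_le_const (a := (0:ℝ)) (b := 1)
    (f := fun s => κ s * f (z + s • ev 0)) (C := C) ?_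
  · simpa [Av] using this
  · intro s hs
    rw [Set.uIoc_of_le zero_le_one] at hs
    rw [Real.norm_eq_abs, abs_mul]
    have h1 := hb s ⟨hs.1.le, hs.2⟩
    have h2 := h (z + s • ev 0) (by simp [ev_fst])
    nlinarith [abs_nonneg (κ s), abs_nonneg (f (z + s • ev 0))]

/-- Periodicity in the fast variable. -/
def Per (f : Z → ℝ) : Prop := ∀ z, f (z + ev 0) = f z

theorem per_dd {f : Z → ℝ} (hf : Sm f) (h : Per f) (v : Z) : Per (dd v f) := by
  intro z
  have h1 : dd v (fun y => f (y + ev 0)) z = dd v f (z + ev 0) := by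
    have hs : Sm (fun y : Z => y + ev 0) := contDiff_id.add contDiff_const
    rw [dd_comp hf hs]
    congr 1
    rw [fderiv_add_const]; simp
  rw [← h1, show (fun y => f (y + ev 0)) = f from funext h]

/-- The antiderivative operator in the fast variable, up to means. -/
noncomputable def JJ (f : Z → ℝ) : Z → ℝ := Av (fun s => s - 1 / 2) f

/-- The mean in the fast variable. -/
noncomputable def Mn (f : Z → ℝ) : Z → ℝ := Av (fun _ => 1) f

theorem sm_half : Sm (fun s : ℝ => s - 1 / 2) := contDiff_id.sub contDiff_const

theorem dd_JJ {f : Z → ℝ} (hf : Sm f) (hp : Per f) :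
    dd (ev 0) (JJ f) = fun z => f z - Mn f z := by
  funext z
  rw [JJ, dd_Av sm_half hf]
  have h := intervalIntegral.integral_mul_deriv_eq_deriv_mul (a := (0:ℝ)) (b := 1)
    (u := fun s => s - 1 / 2) (v := fun s => f (z + s • ev 0)) (u' := fun _ => 1)
    (v' := fun s => dd (ev 0) f (z + s • ev 0))
    (fun s _ => (hasDerivAt_id s).sub_const _) (fun s _ => dd_line hf z (ev 0) s)
    intervalIntegrable_const (by
      apply Continuous.intervalIntegrable
      exact (hf.dd _).continuous.comp (by fun_prop))
  simp only [Av, Mn]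
  rw [h, one_smul, zero_smul, add_zero, hp z]
  ring

theorem dd_Mn {f : Z → ℝ} (hf : Sm f) (hp : Per f) : dd (ev 0) (Mn f) = fun _ => 0 := by
  funext z
  rw [Mn, dd_Av contDiff_const hf]
  simp only [Av, one_mul]
  rw [intervalIntegral.integral_eq_sub_of_hasDerivAt (fun s _ => dd_line hf z (ev 0) s) (by
      apply Continuous.intervalIntegrable
      exact (hf.dd _).continuous.comp (by fun_prop))]
  rw [one_smul, zero_smul, add_zero, hp z, sub_self]

theorem per_Av {κ : ℝ → ℝ} {f : Z → ℝ} (h : Per f) : Per (Av κ f) := by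
  intro z
  refine intervalIntegral.integral_congr fun s _ => ?_
  change κ s * f (z + ev 0 + s • ev 0) = _
  rw [add_right_comm, h]

theorem dd_dd_JJ {f : Z → ℝ} (hf : Sm f) (hp : Per f) :
    dd (ev 0) (dd (ev 0) (JJ (JJ f))) = fun z => f z - Mn f z := by
  have hJ : Sm (JJ f) := sm_Av sm_half hf
  have hM : Sm (Mn (JJ f)) := sm_Av contDiff_const hJ
  rw [dd_JJ hJ (per_Av hp), dd_sub _ hJ hM, dd_Mn hJ (per_Av hp), dd_JJ hf hp]
  simp

/-- Integration in time from `t₀`. -/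
noncomputable def Ti (t0 : ℝ) (f : Z → ℝ) : Z → ℝ :=
  fun z => (z.1 - t0) * ∫ s in (0:ℝ)..1, f (t0 + s * (z.1 - t0), z.2)

theorem Ti_eq (t0 : ℝ) (f : Z → ℝ) (z : Z) : Ti t0 f z = ∫ s in t0..z.1, f (s, z.2) := by
  have := intervalIntegral.mul_integral_comp_add_mul (a := (0:ℝ)) (b := 1)
    (f := fun s => f (s, z.2)) (c := z.1 - t0) (d := t0)
  rw [Ti]
  simp only [mul_zero, add_zero, mul_one, add_sub_cancel] at this
  rw [← this]
  congr 1
  refine intervalIntegral.integral_congr fun s _ => ?_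
  simp only [mul_comm]

theorem sm_Ti_aux (t0 : ℝ) {f : Z → ℝ} (hf : Sm f) :
    Sm (fun q : Z × ℝ => f (t0 + q.2 * (q.1.1 - t0), q.1.2)) :=
  hf.comp (by fun_prop)

theorem sm_Ti (t0 : ℝ) {f : Z → ℝ} (hf : Sm f) : Sm (Ti t0 f) :=
  (contDiff_fst.sub contDiff_const).mul (sm_param _ (sm_Ti_aux t0 hf))

theorem dd_Ti (t0 : ℝ) {f : Z → ℝ} (hf : Sm f) (k : Fin 3) :
    dd (ev k) (Ti t0 f) = Ti t0 (dd (ev k) f) := by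
  have hI := sm_param _ (sm_Ti_aux t0 hf)
  have h := wd_smul_time (c := fun t => t - t0) (contDiff_id.sub contDiff_const) [k] hI
  simp only [wd] at h
  refine h.trans ?_
  funext z
  rw [Ti, dd_param _ (sm_Ti_aux t0 hf)]
  congr 1
  refine intervalIntegral.integral_congr fun s _ => ?_
  have hL : Sm (fun y : Z => ((t0 + s * (y.1 - t0), y.2) : Z)) :=
    (contDiff_const.add (contDiff_const.mul (contDiff_fst.sub contDiff_const))).prodMk contDiff_snd
  have hd := dd_comp hf hL (ev k) z
  have hv : fderiv ℝ (fun y : Z => ((t0 + s * (y.1 - t0), y.2) : Z)) z (ev k) = ev k := by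
    have h1 : HasFDerivAt (fun y : Z => ((t0 + s * (y.1 - t0), y.2) : Z))
        ((s • ContinuousLinearMap.fst ℝ ℝ (ℝ × ℝ × ℝ)).prod
          (ContinuousLinearMap.snd ℝ ℝ (ℝ × ℝ × ℝ))) z :=
      (((hasFDerivAt_fst.sub_const t0).const_mul s).const_add t0).prodMk hasFDerivAt_snd
    rw [h1.fderiv]
    ext <;> simp [ev_fst]
  rw [hv] at hd
  exact hd

theorem wd_Ti (t0 : ℝ) (l : List (Fin 3)) : ∀ {f : Z → ℝ}, Sm f →
    wd l (Ti t0 f) = Ti t0 (wd l f) := by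
  induction l with
  | nil => intros; rfl
  | cons k l ih =>
    intro f hf
    simp only [wd]
    rw [dd_Ti t0 hf, ih (hf.dd _)]

theorem dd_time_Ti (t0 : ℝ) {f : Z → ℝ} (hf : Sm f) : dd eT (Ti t0 f) = f := by
  funext z
  have h1 := dd_line (sm_Ti t0 hf) z eT 0
  simp only [zero_smul, add_zero] at h1
  have hc : Continuous fun s : ℝ => f (s, z.2) := hf.continuous.comp (by fun_prop)
  have h2 : HasDerivAt (fun τ : ℝ => ∫ s in t0..z.1 + τ, f (s, z.2)) (f z) 0 := by
    have h3 : HasDerivAt (fun u : ℝ => ∫ s in t0..u, f (s, z.2)) (f (z.1 + 0, z.2)) (z.1 + 0) :=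
      intervalIntegral.integral_hasDerivAt_right (hc.intervalIntegrable _ _)
        hc.aestronglyMeasurable.stronglyMeasurableAtFilter hc.continuousAt
    have := h3.comp_const_add z.1 0
    simpa using this
  have h4 : (fun τ : ℝ => Ti t0 f (z + τ • eT)) = fun τ : ℝ => ∫ s in t0..z.1 + τ, f (s, z.2) := by
    funext τ
    rw [Ti_eq]
    have : (z + τ • eT).2 = z.2 := by ext <;> simp [eT]
    rw [this]
    simp [eT]
  rw [h4] at h1
  exact h1.unique h2

theorem abs_Ti_le {t0 : ℝ} (h0 : 0 ≤ t0) {f : Z → ℝ} {z : Z} {C : ℝ} (hz : z.1 ∈ Set.Icc t0 1)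
    (h : ∀ z' : Z, z'.1 ∈ Set.Icc t0 1 → |f z'| ≤ C) : |Ti t0 f z| ≤ C := by
  have hC : 0 ≤ C := (abs_nonneg _).trans (h z hz)
  have := intervalIntegral.norm_integral_le_of_norm_le_const (a := t0) (b := z.1)
    (f := fun s => f (s, z.2)) (C := C) ?_
  · rw [Ti_eq]
    rw [Real.norm_eq_abs, abs_of_nonneg (sub_nonneg.2 hz.1)] at this
    have h1 : z.1 - t0 ≤ 1 := by linarith [hz.2]
    nlinarith
  · intro s hs
    rw [Set.uIoc_of_le hz.1] at hs
    exact h _ ⟨hs.1.le, hs.2.trans hz.2⟩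

end Lifted

section Layer

/-- Data of an oscillating layer: frequency `N`, size `lam`, starting times, phases, background
gradients, amplitude, cutoff and background velocity gradient. -/
structure LD where
  (N lam t0 t1 : ℝ)
  (p1 p2 w1 w2 g1 g2 G ze al be et : ℝ → ℝ)
  hN : 1 ≤ N
  hlam : 1 ≤ lam
  ht0 : 0 ≤ t0
  ht1 : t0 < t1
  sp1 : Sm p1
  sp2 : Sm p2
  sw1 : Sm w1
  sw2 : Sm w2
  sg1 : Sm g1
  sg2 : Sm g2
  sG : Sm G
  sze : Sm ze
  hp : ∀ t, 0 < p1 t ^ 2 + p2 t ^ 2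
  bp1 : ∀ t ∈ Set.Icc t0 1, |p1 t| ≤ lam
  bp2 : ∀ t ∈ Set.Icc t0 1, |p2 t| ≤ lam
  bw1 : ∀ t ∈ Set.Icc t0 1, |w1 t| ≤ lam
  bw2 : ∀ t ∈ Set.Icc t0 1, |w2 t| ≤ lam
  bg1 : ∀ t ∈ Set.Icc t0 1, |g1 t| ≤ lam
  bg2 : ∀ t ∈ Set.Icc t0 1, |g2 t| ≤ lam
  bG : ∀ t ∈ Set.Icc t0 1, |G t| ≤ lam
  bze : ∀ t ∈ Set.Icc t0 1, |ze t| ≤ lam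
  br : ∀ t ∈ Set.Icc t0 1, |(p1 t ^ 2 + p2 t ^ 2)⁻¹| ≤ lam
  bp1' : ∀ t ∈ Set.Icc t0 1, |deriv p1 t| ≤ lam
  bp2' : ∀ t ∈ Set.Icc t0 1, |deriv p2 t| ≤ lam
  bw1' : ∀ t ∈ Set.Icc t0 1, |deriv w1 t| ≤ lam
  bw2' : ∀ t ∈ Set.Icc t0 1, |deriv w2 t| ≤ lam
  bze' : ∀ t ∈ Set.Icc t0 1, |deriv ze t| ≤ lam
  ze0 : ∀ t < t1, ze t = 0
  dp1 : ∀ t, HasDerivAt p1 (-(al t * p1 t + et t * p2 t)) t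
  dp2 : ∀ t, HasDerivAt p2 (-(be t * p1 t - al t * p2 t)) t
  dw1 : ∀ t, HasDerivAt w1 (-(al t * w1 t + et t * w2 t)) t
  dw2 : ∀ t, HasDerivAt w2 (-(be t * w1 t - al t * w2 t)) t
  dG : ∀ t, HasDerivAt G
    (p1 t * (g2 t * p1 t - g1 t * p2 t) * (p1 t ^ 2 + p2 t ^ 2)⁻¹ * G t) t

/-- `|p|⁻²`. -/
noncomputable def LD.r (d : LD) : ℝ → ℝ := fun t => (d.p1 t ^ 2 + d.p2 t ^ 2)⁻¹

/-- Uniformly polynomially bounded coefficients. -/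
def Cf (c : LD → ℝ → ℝ) : Prop := (∀ d, Sm (c d)) ∧
  ∃ (C : ℝ) (q : ℕ), 0 ≤ C ∧ ∀ (d : LD), ∀ t ∈ Set.Icc d.t0 1, |c d t| ≤ C * d.lam ^ q

/-- Coefficients bounded together with their time derivative. -/
def TCf (c : LD → ℝ → ℝ) : Prop := Cf c ∧ Cf (fun d => deriv (c d))

theorem pow_bd {a : ℝ} (ha : 1 ≤ a) {C D : ℝ} (hC : 0 ≤ C) (hD : 0 ≤ D) (p q : ℕ) :
    C * a ^ p + D * a ^ q ≤ (C + D) * a ^ (p + q) := by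
  have h1 : a ^ p ≤ a ^ (p + q) := pow_le_pow_right₀ ha (by omega)
  have h2 : a ^ q ≤ a ^ (p + q) := pow_le_pow_right₀ ha (by omega)
  nlinarith

theorem Cf.congr {c e : LD → ℝ → ℝ} (hc : Cf c) (h : ∀ d t, e d t = c d t) : Cf e := by
  have : e = c := by funext d t; exact h d t
  rwa [this]

theorem Cf.add {c e : LD → ℝ → ℝ} (hc : Cf c) (he : Cf e) : Cf (fun d t => c d t + e d t) := by
  obtain ⟨C, p, hC, h1⟩ := hc.2
  obtain ⟨D, q, hD, h2⟩ := he.2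
  refine ⟨fun d => (hc.1 d).add (he.1 d), C + D, p + q, by positivity, fun d t ht => ?_⟩
  exact (abs_add_le _ _).trans ((add_le_add (h1 d t ht) (h2 d t ht)).trans
    (pow_bd d.hlam hC hD p q))

theorem Cf.mul {c e : LD → ℝ → ℝ} (hc : Cf c) (he : Cf e) : Cf (fun d t => c d t * e d t) := by
  obtain ⟨C, p, hC, h1⟩ := hc.2
  obtain ⟨D, q, hD, h2⟩ := he.2
  refine ⟨fun d => (hc.1 d).mul (he.1 d), C * D, p + q, by positivity, fun d t ht => ?_⟩
  rw [abs_mul]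
  have h0 : 0 ≤ C * d.lam ^ p := (abs_nonneg _).trans (h1 d t ht)
  calc _ ≤ (C * d.lam ^ p) * (D * d.lam ^ q) :=
        mul_le_mul (h1 d t ht) (h2 d t ht) (abs_nonneg _) h0
    _ = _ := by ring

theorem Cf.const (a : ℝ) : Cf (fun _ _ => a) :=
  ⟨fun _ => contDiff_const, |a|, 0, abs_nonneg _, fun d t _ => by simp⟩

theorem Cf.sub {c e : LD → ℝ → ℝ} (hc : Cf c) (he : Cf e) : Cf (fun d t => c d t - e d t) := by
  exact (hc.add ((Cf.const (-1)).mul he)).congr fun d t => by ring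

theorem Cf.of {c : LD → ℝ → ℝ} (hs : ∀ d, Sm (c d))
    (h : ∀ (d : LD), ∀ t ∈ Set.Icc d.t0 1, |c d t| ≤ d.lam) : Cf c :=
  ⟨hs, 1, 1, zero_le_one, fun d t ht => by simpa using h d t ht⟩

theorem Sm.deriv {f : ℝ → ℝ} (h : Sm f) : Sm (deriv f) := (contDiff_infty_iff_deriv.1 h).2

theorem TCf.add {c e : LD → ℝ → ℝ} (hc : TCf c) (he : TCf e) :
    TCf (fun d t => c d t + e d t) := by
  refine ⟨hc.1.add he.1, Cf.congr (hc.2.add he.2) fun d t => ?_⟩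
  exact (deriv_fun_add ((hc.1.1 d).diff t) ((he.1.1 d).diff t))

theorem TCf.sub {c e : LD → ℝ → ℝ} (hc : TCf c) (he : TCf e) :
    TCf (fun d t => c d t - e d t) := by
  refine ⟨hc.1.sub he.1, Cf.congr (hc.2.sub he.2) fun d t => ?_⟩
  exact (deriv_fun_sub ((hc.1.1 d).diff t) ((he.1.1 d).diff t))

theorem TCf.mul {c e : LD → ℝ → ℝ} (hc : TCf c) (he : TCf e) :
    TCf (fun d t => c d t * e d t) := by
  refine ⟨hc.1.mul he.1, Cf.congr ((hc.2.mul he.1).add (hc.1.mul he.2)) fun d t => ?_⟩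
  exact (deriv_fun_mul ((hc.1.1 d).diff t) ((he.1.1 d).diff t))

theorem TCf.const (a : ℝ) : TCf (fun _ _ => a) := by
  refine ⟨Cf.const a, Cf.congr (Cf.const 0) fun d t => ?_⟩
  simp

theorem TCf.p1 : TCf LD.p1 := ⟨.of LD.sp1 LD.bp1, .of (fun d => d.sp1.deriv) LD.bp1'⟩
theorem TCf.p2 : TCf LD.p2 := ⟨.of LD.sp2 LD.bp2, .of (fun d => d.sp2.deriv) LD.bp2'⟩
theorem TCf.w1 : TCf LD.w1 := ⟨.of LD.sw1 LD.bw1, .of (fun d => d.sw1.deriv) LD.bw1'⟩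
theorem TCf.w2 : TCf LD.w2 := ⟨.of LD.sw2 LD.bw2, .of (fun d => d.sw2.deriv) LD.bw2'⟩
theorem TCf.ze : TCf LD.ze := ⟨.of LD.sze LD.bze, .of (fun d => d.sze.deriv) LD.bze'⟩
theorem Cf.g1 : Cf LD.g1 := .of LD.sg1 LD.bg1
theorem Cf.g2 : Cf LD.g2 := .of LD.sg2 LD.bg2
theorem Cf.G : Cf LD.G := .of LD.sG LD.bG

theorem LD.sr (d : LD) : Sm d.r :=
  ((d.sp1.pow 2).add (d.sp2.pow 2)).inv fun t => (d.hp t).ne'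

theorem TCf.r : TCf LD.r := by
  have h : Cf LD.r := .of LD.sr LD.br
  have hpp : TCf (fun d t => d.p1 t * d.p1 t + d.p2 t * d.p2 t) := (p1.mul p1).add (p2.mul p2)
  refine ⟨h, Cf.congr (((Cf.const (-1)).mul ((h.mul h).mul hpp.2))) fun d t => ?_⟩
  have h1 := ((hpp.1.1 d).diff t).hasDerivAt.fun_inv
    (by have := d.hp t; simp only [← pow_two]; exact this.ne')
  have h2 : d.r = fun t => (d.p1 t * d.p1 t + d.p2 t * d.p2 t)⁻¹ := by
    funext t; simp only [LD.r, pow_two]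
  simp only [h2]
  rw [h1.deriv]
  field_simp

/-- The region where the spatial cutoff is locally constant. -/
def flatSet : Set Z := {z | (|z.2.2.1| < 1 / 2 ∧ |z.2.2.2| < 1 / 2) ∨
  (3 / 4 < |z.2.2.1| ∨ 3 / 4 < |z.2.2.2|)}

theorem isOpen_flatSet : IsOpen flatSet := by
  have h1 : Continuous fun z : Z => |z.2.2.1| := by fun_prop
  have h2 : Continuous fun z : Z => |z.2.2.2| := by fun_prop
  exact ((isOpen_lt h1 continuous_const).inter (isOpen_lt h2 continuous_const)).union
    ((isOpen_lt continuous_const h1).union (isOpen_lt continuous_const h2))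

/-- Qualitative properties of profiles. -/
structure Good (d : LD) (f : Z → ℝ) : Prop where
  sm : Sm f
  per : Per f
  early : ∀ z : Z, z.1 < d.t1 → f z = 0
  flat1 : ∀ z ∈ flatSet, dd (ev 1) f z = 0
  flat2 : ∀ z ∈ flatSet, dd (ev 2) f z = 0

theorem Good.add {d : LD} {f g : Z → ℝ} (hf : Good d f) (hg : Good d g) :
    Good d (fun z => f z + g z) where
  sm := hf.sm.add hg.sm
  per z := by simp only [hf.per z, hg.per z]
  early z hz := by simp [hf.early z hz, hg.early z hz]
  flat1 z hz := by simp [dd_add _ hf.sm hg.sm, hf.flat1 z hz, hg.flat1 z hz]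
  flat2 z hz := by simp [dd_add _ hf.sm hg.sm, hf.flat2 z hz, hg.flat2 z hz]

theorem Good.mul {d : LD} {f g : Z → ℝ} (hf : Good d f) (hg : Good d g) :
    Good d (fun z => f z * g z) where
  sm := hf.sm.mul hg.sm
  per z := by simp only [hf.per z, hg.per z]
  early z hz := by simp [hf.early z hz]
  flat1 z hz := by simp [dd_mul _ hf.sm hg.sm, hf.flat1 z hz, hg.flat1 z hz]
  flat2 z hz := by simp [dd_mul _ hf.sm hg.sm, hf.flat2 z hz, hg.flat2 z hz]

theorem Good.cmul {d : LD} {f : Z → ℝ} {c : ℝ → ℝ} (hc : Sm c) (hf : Good d f) :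
    Good d (fun z => c z.1 * f z) where
  sm := (hc.comp contDiff_fst).mul hf.sm
  per z := by simp [ev_fst, hf.per z]
  early z hz := by simp [hf.early z hz]
  flat1 z hz := by
    have := wd_smul_time hc [1] hf.sm
    simp only [wd] at this
    simp [this, hf.flat1 z hz]
  flat2 z hz := by
    have := wd_smul_time hc [2] hf.sm
    simp only [wd] at this
    simp [this, hf.flat2 z hz]

theorem isOpen_early (a : ℝ) : IsOpen {z : Z | z.1 < a} := isOpen_lt (by fun_prop) (by fun_prop)

theorem Good.dd {d : LD} {f : Z → ℝ} (hf : Good d f) (v : Z) : Good d (dd v f) where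
  sm := hf.sm.dd v
  per := per_dd hf.sm hf.per v
  early := dd_zero_on (isOpen_early _) v hf.early
  flat1 z hz := by
    rw [dd_comm _ _ hf.sm]; exact dd_zero_on isOpen_flatSet v hf.flat1 z hz
  flat2 z hz := by
    rw [dd_comm _ _ hf.sm]; exact dd_zero_on isOpen_flatSet v hf.flat2 z hz

theorem Av_zero {κ : ℝ → ℝ} {f : Z → ℝ} {z : Z} (h : ∀ s : ℝ, f (z + s • ev 0) = 0) :
    Av κ f z = 0 := by simp [Av, h]

theorem flat_shift {z : Z} (hz : z ∈ flatSet) (s : ℝ) : z + s • ev 0 ∈ flatSet := by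
  simpa [flatSet, ev] using hz

theorem Good.Av {d : LD} {κ : ℝ → ℝ} (hκ : Sm κ) {f : Z → ℝ} (hf : Good d f) : Good d (Av κ f) where
  sm := sm_Av hκ hf.sm
  per := per_Av hf.per
  early z hz := Av_zero fun s => hf.early _ (by simpa [ev_fst] using hz)
  flat1 z hz := by rw [dd_Av hκ hf.sm]; exact Av_zero fun s => hf.flat1 _ (flat_shift hz s)
  flat2 z hz := by rw [dd_Av hκ hf.sm]; exact Av_zero fun s => hf.flat2 _ (flat_shift hz s)

theorem Ti_zero {t0 : ℝ} {f : Z → ℝ} {z : Z} (h : ∀ s ∈ Set.uIcc t0 z.1, f (s, z.2) = 0) :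
    Ti t0 f z = 0 := by
  rw [Ti_eq, intervalIntegral.integral_congr (g := fun _ => 0) h]; simp

theorem Good.Ti {d : LD} {f : Z → ℝ} (hf : Good d f) : Good d (Ti d.t0 f) where
  sm := sm_Ti _ hf.sm
  per z := by
    rw [Ti_eq, Ti_eq]
    have : (z + ev 0).1 = z.1 := by simp [ev_fst]
    rw [this]
    refine intervalIntegral.integral_congr fun s _ => ?_
    have := hf.per (s, z.2)
    simpa [ev] using this
  early z hz := Ti_zero fun s hs => hf.early _ (by
    rw [Set.mem_uIcc] at hs
    have := d.ht1
    change s < d.t1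
    rcases hs with h | h
    · exact h.2.trans_lt hz
    · exact h.2.trans_lt this)
  flat1 z hz := by rw [dd_Ti _ hf.sm]; exact Ti_zero fun s _ => hf.flat1 _ hz
  flat2 z hz := by rw [dd_Ti _ hf.sm]; exact Ti_zero fun s _ => hf.flat2 _ hz

/-- Uniform bound of one derivative. -/
def B1 (l : List (Fin 3)) (j : ℕ) (f : LD → Z → ℝ) : Prop :=
  ∃ (C : ℝ) (q : ℕ), 0 ≤ C ∧ ∀ (d : LD), ∀ z : Z, z.1 ∈ Set.Icc d.t0 1 →
    |wd l (f d) z| ≤ C * d.lam ^ q * d.N⁻¹ ^ j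

/-- Good profiles of order `N^{-j}`, uniformly with polynomial losses. -/
def Cl (j : ℕ) (f : LD → Z → ℝ) : Prop := (∀ d, Good d (f d)) ∧ ∀ l, B1 l j f

/-- Profiles of order `N^{-j}` together with their time derivative. -/
def TCl (j : ℕ) (f : LD → Z → ℝ) : Prop := Cl j f ∧ Cl j (fun d => dd eT (f d))

theorem LD.inv_pos (d : LD) : 0 ≤ d.N⁻¹ := inv_nonneg.2 (zero_le_one.trans d.hN)
theorem LD.inv_le (d : LD) : d.N⁻¹ ≤ 1 := inv_le_one_of_one_le₀ d.hN

theorem B1.congr_add {l : List (Fin 3)} {j : ℕ} {f g h : LD → Z → ℝ} (hf : B1 l j f)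
    (hg : B1 l j g) (hh : ∀ d z, wd l (h d) z = wd l (f d) z + wd l (g d) z) : B1 l j h := by
  obtain ⟨C, p, hC, h1⟩ := hf
  obtain ⟨D, q, hD, h2⟩ := hg
  refine ⟨C + D, p + q, by positivity, fun d z hz => ?_⟩
  rw [hh]
  refine (abs_add_le _ _).trans ((add_le_add (h1 d z hz) (h2 d z hz)).trans ?_)
  rw [← add_mul]
  exact mul_le_mul_of_nonneg_right (pow_bd d.hlam hC hD p q) (pow_nonneg d.inv_pos _)

theorem Cl.congr {j : ℕ} {f g : LD → Z → ℝ} (hf : Cl j f) (h : ∀ d, g d = f d) : Cl j g := by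
  have : g = f := funext h
  rwa [this]

theorem Cl.add {j : ℕ} {f g : LD → Z → ℝ} (hf : Cl j f) (hg : Cl j g) :
    Cl j (fun d z => f d z + g d z) :=
  ⟨fun d => (hf.1 d).add (hg.1 d), fun l => (hf.2 l).congr_add (hg.2 l) fun d z => by
    rw [wd_add l (hf.1 d).sm (hg.1 d).sm]⟩

theorem Cl.dd {j : ℕ} {f : LD → Z → ℝ} (hf : Cl j f) (k : Fin 3) :
    Cl j (fun d => dd (ev k) (f d)) :=
  ⟨fun d => (hf.1 d).dd _, fun l => hf.2 (k :: l)⟩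

theorem Cl.mul {j k : ℕ} {f g : LD → Z → ℝ} (hf : Cl j f) (hg : Cl k g) :
    Cl (j + k) (fun d z => f d z * g d z) := by
  refine ⟨fun d => (hf.1 d).mul (hg.1 d), fun l => ?_⟩
  induction l generalizing f g with
  | nil =>
    obtain ⟨C, p, hC, h1⟩ := hf.2 []
    obtain ⟨D, q, hD, h2⟩ := hg.2 []
    refine ⟨C * D, p + q, by positivity, fun d z hz => ?_⟩
    have h0 := (abs_nonneg _).trans (h1 d z hz)
    simp only [wd] at h1 h2 h0 ⊢
    rw [abs_mul]
    refine (mul_le_mul (h1 d z hz) (h2 d z hz) (abs_nonneg _) h0).trans_eq ?_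
    ring
  | cons a l ih =>
    refine (ih (hf.dd a) hg).congr_add (ih hf (hg.dd a)) fun d z => ?_
    have h1 := ((hf.1 d).dd (ev a)).mul (hg.1 d)
    have h2 := (hf.1 d).mul ((hg.1 d).dd (ev a))
    rw [← congrFun (wd_add l h1.sm h2.sm) z]
    simp only
    rw [dd_mul _ (hf.1 d).sm (hg.1 d).sm]

theorem Cl.cmul {j : ℕ} {c : LD → ℝ → ℝ} {f : LD → Z → ℝ} (hc : Cf c) (hf : Cl j f) :
    Cl j (fun d z => c d z.1 * f d z) := by
  refine ⟨fun d => (hf.1 d).cmul (hc.1 d), fun l => ?_⟩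
  obtain ⟨C, p, hC, h1⟩ := hc.2
  obtain ⟨D, q, hD, h2⟩ := hf.2 l
  refine ⟨C * D, p + q, by positivity, fun d z hz => ?_⟩
  have h0 := (abs_nonneg _).trans (h1 d z.1 hz)
  rw [wd_smul_time (hc.1 d) l (hf.1 d).sm, abs_mul]
  refine (mul_le_mul (h1 d _ hz) (h2 d z hz) (abs_nonneg _) h0).trans_eq ?_
  ring

theorem Cl.sub {j : ℕ} {f g : LD → Z → ℝ} (hf : Cl j f) (hg : Cl j g) :
    Cl j (fun d z => f d z - g d z) := by
  exact (hf.add (Cl.cmul (Cf.const (-1)) hg)).congr fun d => by funext z; ring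

theorem Cl.delta {j : ℕ} {f : LD → Z → ℝ} (hf : Cl j f) :
    Cl (j + 1) (fun d z => d.N⁻¹ * f d z) := by
  refine ⟨fun d => (hf.1 d).cmul (c := fun _ => d.N⁻¹) contDiff_const, fun l => ?_⟩
  obtain ⟨D, q, hD, h2⟩ := hf.2 l
  refine ⟨D, q, hD, fun d z hz => ?_⟩
  rw [wd_smul_time (c := fun _ => d.N⁻¹) contDiff_const l (hf.1 d).sm, abs_mul,
    abs_of_nonneg d.inv_pos, pow_succ]
  calc _ ≤ d.N⁻¹ * (D * d.lam ^ q * d.N⁻¹ ^ j) :=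
        mul_le_mul_of_nonneg_left (h2 d z hz) d.inv_pos
    _ = _ := by ring

theorem Cl.mono {j k : ℕ} (hjk : k ≤ j) {f : LD → Z → ℝ} (hf : Cl j f) : Cl k f := by
  refine ⟨hf.1, fun l => ?_⟩
  obtain ⟨D, q, hD, h2⟩ := hf.2 l
  refine ⟨D, q, hD, fun d z hz => (h2 d z hz).trans ?_⟩
  have := pow_le_pow_of_le_one d.inv_pos d.inv_le hjk
  have h0 : 0 ≤ D * d.lam ^ q := mul_nonneg hD (pow_nonneg (zero_le_one.trans d.hlam) _)
  exact mul_le_mul_of_nonneg_left this h0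

theorem Cl.Av {j : ℕ} {κ : ℝ → ℝ} (hκ : Sm κ) (hb : ∀ s ∈ Set.Icc (0:ℝ) 1, |κ s| ≤ 1)
    {f : LD → Z → ℝ} (hf : Cl j f) : Cl j (fun d => Av κ (f d)) := by
  refine ⟨fun d => (hf.1 d).Av hκ, fun l => ?_⟩
  obtain ⟨D, q, hD, h2⟩ := hf.2 l
  refine ⟨D, q, hD, fun d z hz => ?_⟩
  rw [wd_Av hκ l (hf.1 d).sm]
  exact abs_Av_le hb fun z' hz' => h2 d z' (hz'.symm ▸ hz)

theorem abs_half : ∀ s ∈ Set.Icc (0:ℝ) 1, |s - 1 / 2| ≤ 1 := fun s hs => by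
  rw [abs_le]; constructor <;> linarith [hs.1, hs.2]

theorem Cl.JJ {j : ℕ} {f : LD → Z → ℝ} (hf : Cl j f) : Cl j (fun d => JJ (f d)) :=
  hf.Av sm_half abs_half

theorem Cl.Mn {j : ℕ} {f : LD → Z → ℝ} (hf : Cl j f) : Cl j (fun d => Mn (f d)) :=
  hf.Av contDiff_const (by simp)

theorem Cl.Ti {j : ℕ} {f : LD → Z → ℝ} (hf : Cl j f) : Cl j (fun d => Ti d.t0 (f d)) := by
  refine ⟨fun d => (hf.1 d).Ti, fun l => ?_⟩
  obtain ⟨D, q, hD, h2⟩ := hf.2 l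
  refine ⟨D, q, hD, fun d z hz => ?_⟩
  rw [wd_Ti _ l (hf.1 d).sm]
  exact abs_Ti_le d.ht0 hz fun z' hz' => h2 d z' hz'

theorem TCl.Ti {j : ℕ} {f : LD → Z → ℝ} (hf : Cl j f) : TCl j (fun d => _root_.Ti d.t0 (f d)) := by
  refine ⟨hf.Ti, Cl.congr (hf) fun d => ?_⟩
  exact (dd_time_Ti _ (hf.1 d).sm)

theorem TCl.add {j : ℕ} {f g : LD → Z → ℝ} (hf : TCl j f) (hg : TCl j g) :
    TCl j (fun d z => f d z + g d z) := by
  refine ⟨hf.1.add hg.1, Cl.congr (hf.2.add hg.2) fun d => ?_⟩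
  exact (dd_add _ (hf.1.1 d).sm (hg.1.1 d).sm)

theorem TCl.sub {j : ℕ} {f g : LD → Z → ℝ} (hf : TCl j f) (hg : TCl j g) :
    TCl j (fun d z => f d z - g d z) := by
  refine ⟨hf.1.sub hg.1, Cl.congr (hf.2.sub hg.2) fun d => ?_⟩
  exact (dd_sub _ (hf.1.1 d).sm (hg.1.1 d).sm)

theorem TCl.dd {j : ℕ} {f : LD → Z → ℝ} (hf : TCl j f) (k : Fin 3) :
    TCl j (fun d => dd (ev k) (f d)) := by
  refine ⟨hf.1.dd k, Cl.congr (hf.2.dd k) fun d => ?_⟩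
  exact dd_comm _ _ (hf.1.1 d).sm

theorem TCl.JJ {j : ℕ} {f : LD → Z → ℝ} (hf : TCl j f) : TCl j (fun d => JJ (f d)) := by
  refine ⟨hf.1.JJ, Cl.congr (hf.2.JJ) fun d => ?_⟩
  exact (dd_Av sm_half (hf.1.1 d).sm _)

theorem dd_time_cmul {c : ℝ → ℝ} (hc : Sm c) {f : Z → ℝ} (hf : Sm f) :
    _root_.dd eT (fun z : Z => c z.1 * f z) = fun z => deriv c z.1 * f z + c z.1 * _root_.dd eT f z := by
  have hs : Sm (fun z : Z => c z.1) := hc.comp contDiff_fst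
  rw [dd_mul _ hs hf]
  funext z
  have : _root_.dd eT (fun z : Z => c z.1) z = deriv c z.1 := by
    rw [dd_comp hc contDiff_fst, fderiv_fst]
    simp [_root_.dd, eT]
  rw [this]

theorem TCl.cmul {j : ℕ} {c : LD → ℝ → ℝ} {f : LD → Z → ℝ} (hc : TCf c) (hf : TCl j f) :
    TCl j (fun d z => c d z.1 * f d z) := by
  refine ⟨Cl.cmul hc.1 hf.1, Cl.congr ((Cl.cmul hc.2 hf.1).add (Cl.cmul hc.1 hf.2)) fun d => ?_⟩
  exact (dd_time_cmul (hc.1.1 d) (hf.1.1 d).sm)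

theorem TCl.delta {j : ℕ} {f : LD → Z → ℝ} (hf : TCl j f) :
    TCl (j + 1) (fun d z => d.N⁻¹ * f d z) := by
  refine ⟨hf.1.delta, Cl.congr (hf.2.delta) fun d => ?_⟩
  exact (dd_const_mul _ _ (hf.1.1 d).sm)

theorem TCl.mono {j k : ℕ} (hjk : k ≤ j) {f : LD → Z → ℝ} (hf : TCl j f) : TCl k f :=
  ⟨hf.1.mono hjk, hf.2.mono hjk⟩

end Layer

section Operators

/-- The lower order part of a second order operator with time dependent coefficients. -/
noncomputable def OpS (e : ℝ) (c1 c2 c3 c4 c5 : ℝ → ℝ) (U : Z → ℝ) : Z → ℝ := fun z =>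
  e * ((c1 z.1 * dd (ev 0) (dd (ev 1) U) z + c2 z.1 * dd (ev 0) (dd (ev 2) U) z) +
    e * (c3 z.1 * dd (ev 1) (dd (ev 1) U) z + c4 z.1 * dd (ev 1) (dd (ev 2) U) z +
      c5 z.1 * dd (ev 2) (dd (ev 2) U) z))

theorem OpS_sub (e : ℝ) (c1 c2 c3 c4 c5 : ℝ → ℝ) {U V : Z → ℝ} (hU : Sm U) (hV : Sm V) (z : Z) :
    OpS e c1 c2 c3 c4 c5 (fun z => U z - V z) z =
      OpS e c1 c2 c3 c4 c5 U z - OpS e c1 c2 c3 c4 c5 V z := by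
  simp only [OpS, dd_sub _ hU hV, dd_sub _ (hU.dd _) (hV.dd _)]
  ring

theorem Good.OpS_zero {d : LD} {U : Z → ℝ} (hU : Good d U) (e : ℝ) (c1 c2 c3 c4 c5 : ℝ → ℝ) :
    ∀ z ∈ flatSet, OpS e c1 c2 c3 c4 c5 U z = 0 := by
  intro z hz
  have h1 := (hU.dd (ev 1)).flat1 z hz
  have h2 := (hU.dd (ev 2)).flat1 z hz
  have h3 := (hU.dd (ev 2)).flat2 z hz
  have h4 := dd_zero_on isOpen_flatSet (ev 0) hU.flat1 z hz
  have h5 := dd_zero_on isOpen_flatSet (ev 0) hU.flat2 z hz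
  simp [OpS, h1, h2, h3, h4, h5]

theorem Cl.OpS {j : ℕ} {U : LD → Z → ℝ} (hU : Cl j U) {c1 c2 c3 c4 c5 : LD → ℝ → ℝ}
    (h1 : Cf c1) (h2 : Cf c2) (h3 : Cf c3) (h4 : Cf c4) (h5 : Cf c5) :
    Cl (j + 1) (fun d => OpS d.N⁻¹ (c1 d) (c2 d) (c3 d) (c4 d) (c5 d) (U d)) := by
  have a1 := Cl.cmul h1 ((hU.dd 1).dd 0)
  have a2 := Cl.cmul h2 ((hU.dd 2).dd 0)
  have a3 := Cl.cmul h3 ((hU.dd 1).dd 1)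
  have a4 := Cl.cmul h4 ((hU.dd 2).dd 1)
  have a5 := Cl.cmul h5 ((hU.dd 2).dd 2)
  exact ((a1.add a2).add (((a3.add a4).add a5).delta.mono (Nat.le_succ _))).delta

theorem TCl.OpS {j : ℕ} {U : LD → Z → ℝ} (hU : TCl j U) {c1 c2 c3 c4 c5 : LD → ℝ → ℝ}
    (h1 : TCf c1) (h2 : TCf c2) (h3 : TCf c3) (h4 : TCf c4) (h5 : TCf c5) :
    TCl (j + 1) (fun d => _root_.OpS d.N⁻¹ (c1 d) (c2 d) (c3 d) (c4 d) (c5 d) (U d)) := by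
  have a1 := TCl.cmul h1 ((hU.dd 1).dd 0)
  have a2 := TCl.cmul h2 ((hU.dd 2).dd 0)
  have a3 := TCl.cmul h3 ((hU.dd 1).dd 1)
  have a4 := TCl.cmul h4 ((hU.dd 2).dd 1)
  have a5 := TCl.cmul h5 ((hU.dd 2).dd 2)
  exact ((a1.add a2).add (((a3.add a4).add a5).delta.mono (Nat.le_succ _))).delta

/-- The lifted partial derivative with phase component `c` and slow component `e`. -/
noncomputable def Xo (δ : ℝ) (c e : ℝ → ℝ) (f : Z → ℝ) : Z → ℝ := fun z =>
  c z.1 * dd (ev 0) f z + δ * (c z.1 * dd (ev 1) f z + e z.1 * dd (ev 2) f z)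

theorem sm_time {c : ℝ → ℝ} (hc : Sm c) : Sm (fun z : Z => c z.1) := hc.comp contDiff_fst

theorem sm_Xo {δ : ℝ} {c e : ℝ → ℝ} (hc : Sm c) (he : Sm e) {f : Z → ℝ} (hf : Sm f) :
    Sm (Xo δ c e f) :=
  ((sm_time hc).mul (hf.dd _)).add (contDiff_const.mul
    (((sm_time hc).mul (hf.dd _)).add ((sm_time he).mul (hf.dd _))))

theorem dd_smul_time {c : ℝ → ℝ} (hc : Sm c) (k : Fin 3) {f : Z → ℝ} (hf : Sm f) :
    dd (ev k) (fun z => c z.1 * f z) = fun z => c z.1 * dd (ev k) f z := wd_smul_time hc [k] hf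

theorem dd_Xo {δ : ℝ} {c e : ℝ → ℝ} (hc : Sm c) (he : Sm e) {f : Z → ℝ} (hf : Sm f) (k : Fin 3) :
    dd (ev k) (Xo δ c e f) = Xo δ c e (dd (ev k) f) := by
  have h0 := (sm_time hc).mul (hf.dd (ev 0))
  have h1 := (sm_time hc).mul (hf.dd (ev 1))
  have h2 := (sm_time he).mul (hf.dd (ev 2))
  unfold Xo
  rw [dd_add _ h0 (contDiff_const.mul (h1.add h2)), dd_const_mul _ _ (h1.add h2), dd_add _ h1 h2,
    dd_smul_time hc _ (hf.dd _), dd_smul_time hc _ (hf.dd _), dd_smul_time he _ (hf.dd _)]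
  simp only [dd_comm _ (ev k) hf]

theorem Xo_smul_time {δ : ℝ} {c e a : ℝ → ℝ} (ha : Sm a) {f : Z → ℝ} (hf : Sm f) :
    Xo δ c e (fun z => a z.1 * f z) = fun z => a z.1 * Xo δ c e f z := by
  funext z
  simp only [Xo, dd_smul_time ha _ hf]
  ring

theorem Xo_Xo {δ : ℝ} {c e c' e' : ℝ → ℝ} (hc : Sm c') (he : Sm e') {f : Z → ℝ} (hf : Sm f)
    (z : Z) : Xo δ c e (Xo δ c' e' f) z = c z.1 * c' z.1 * dd (ev 0) (dd (ev 0) f) z +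
      OpS δ (fun t => 2 * (c t * c' t)) (fun t => c t * e' t + e t * c' t) (fun t => c t * c' t)
        (fun t => c t * e' t + e t * c' t) (fun t => e t * e' t) f z := by
  rw [Xo, dd_Xo hc he hf, dd_Xo hc he hf, dd_Xo hc he hf]
  simp only [Xo, OpS, dd_comm (ev 1) (ev 0) hf, dd_comm (ev 2) (ev 0) hf, dd_comm (ev 2) (ev 1) hf]
  ring

/-- `|p|²`. -/
noncomputable def LD.pp (d : LD) : ℝ → ℝ := fun t => d.p1 t * d.p1 t + d.p2 t * d.p2 t
/-- `p·w`. -/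
noncomputable def LD.pw (d : LD) : ℝ → ℝ := fun t => d.p1 t * d.w1 t + d.p2 t * d.w2 t
/-- `|w|²`. -/
noncomputable def LD.ww (d : LD) : ℝ → ℝ := fun t => d.w1 t * d.w1 t + d.w2 t * d.w2 t
/-- `p × w`. -/
noncomputable def LD.sg (d : LD) : ℝ → ℝ := fun t => d.p1 t * d.w2 t - d.p2 t * d.w1 t
/-- The growth rate. -/
noncomputable def LD.ga (d : LD) : ℝ → ℝ := fun t =>
  d.p1 t * (d.g2 t * d.p1 t - d.g1 t * d.p2 t) * d.r t

theorem TCf.pp : TCf LD.pp := (p1.mul p1).add (p2.mul p2)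
theorem TCf.pw : TCf LD.pw := (p1.mul w1).add (p2.mul w2)
theorem TCf.ww : TCf LD.ww := (w1.mul w1).add (w2.mul w2)
theorem TCf.sg : TCf LD.sg := (p1.mul w2).sub (p2.mul w1)
theorem Cf.ga : Cf LD.ga := (TCf.p1.1.mul ((g2.mul TCf.p1.1).sub (g1.mul TCf.p2.1))).mul TCf.r.1

theorem LD.r_mul_pp (d : LD) (t : ℝ) : d.r t * d.pp t = 1 := by
  have := (d.hp t).ne'
  simp only [LD.r, LD.pp, ← pow_two]
  exact inv_mul_cancel₀ this

/-- Lower order part of the lifted Laplacian. -/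
noncomputable def Ddel (d : LD) : (Z → ℝ) → Z → ℝ :=
  OpS d.N⁻¹ (fun t => 2 * d.pp t) (fun t => 2 * d.pw t) d.pp (fun t => 2 * d.pw t) d.ww

/-- The lifted Laplacian. -/
noncomputable def Dop (d : LD) (U : Z → ℝ) : Z → ℝ := fun z =>
  d.pp z.1 * dd (ev 0) (dd (ev 0) U) z + Ddel d U z

/-- Lifted `∂₁`. -/
noncomputable def X1 (d : LD) : (Z → ℝ) → Z → ℝ := Xo d.N⁻¹ d.p1 d.w1
/-- Lifted `∂₂`. -/
noncomputable def X2 (d : LD) : (Z → ℝ) → Z → ℝ := Xo d.N⁻¹ d.p2 d.w2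

theorem Dop_eq (d : LD) {U : Z → ℝ} (hU : Sm U) (z : Z) :
    Dop d U z = X1 d (X1 d U) z + X2 d (X2 d U) z := by
  rw [X1, X2, Xo_Xo d.sp1 d.sw1 hU, Xo_Xo d.sp2 d.sw2 hU]
  simp only [Dop, Ddel, OpS, LD.pp, LD.pw, LD.ww]
  ring

/-- Lower order part of the lifted buoyancy operator. -/
noncomputable def Qdel (d : LD) (U : Z → ℝ) : Z → ℝ := fun z =>
  d.g1 z.1 * OpS d.N⁻¹ (fun t => 2 * (d.p1 t * d.p2 t)) (fun t => d.p1 t * d.w2 t + d.w1 t * d.p2 t)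
    (fun t => d.p1 t * d.p2 t) (fun t => d.p1 t * d.w2 t + d.w1 t * d.p2 t)
    (fun t => d.w1 t * d.w2 t) U z
  - d.g2 z.1 * OpS d.N⁻¹ (fun t => 2 * (d.p1 t * d.p1 t))
    (fun t => d.p1 t * d.w1 t + d.w1 t * d.p1 t)
    (fun t => d.p1 t * d.p1 t) (fun t => d.p1 t * d.w1 t + d.w1 t * d.p1 t)
    (fun t => d.w1 t * d.w1 t) U z

/-- Relative lower order part of the Laplacian acting on the density profile. -/
noncomputable def Kop (d : LD) (V : Z → ℝ) : Z → ℝ := fun z => d.r z.1 * Ddel d (JJ (JJ V)) z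

/-- The linear error operator. -/
noncomputable def EE (d : LD) (V : Z → ℝ) : Z → ℝ := fun z =>
  d.ga z.1 * Kop d V z + dd eT (Kop d V) z + d.r z.1 * Qdel d (JJ (JJ V)) z

/-- The derivative along the phase. -/
noncomputable def alp (δ : ℝ) (f : Z → ℝ) : Z → ℝ := fun z => dd (ev 0) f z + δ * dd (ev 1) f z

/-- The quadratic error operator. -/
noncomputable def BB (d : LD) (V U : Z → ℝ) : Z → ℝ := fun z =>
  d.N⁻¹ * ((d.G z.1 * (d.r z.1 * (d.r z.1 * d.sg z.1))) *
    (alp d.N⁻¹ (X1 d (JJ (JJ V))) z * dd (ev 2) (Dop d (JJ (JJ U))) z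
      - dd (ev 2) (X1 d (JJ (JJ V))) z * alp d.N⁻¹ (Dop d (JJ (JJ U))) z))

theorem two_mul_TCf {c : LD → ℝ → ℝ} (h : TCf c) : TCf (fun d t => 2 * c d t) :=
  (TCf.const 2).mul h

theorem TCl.Ddel {j : ℕ} {U : LD → Z → ℝ} (hU : TCl j U) : TCl (j + 1) (fun d => Ddel d (U d)) :=
  hU.OpS (two_mul_TCf .pp) (two_mul_TCf .pw) .pp (two_mul_TCf .pw) .ww

theorem TCl.Kop {j : ℕ} {V : LD → Z → ℝ} (hV : TCl j V) : TCl (j + 1) (fun d => Kop d (V d)) :=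
  TCl.cmul .r hV.JJ.JJ.Ddel

theorem Cl.Dop {j : ℕ} {U : LD → Z → ℝ} (hU : Cl j U) : Cl j (fun d => Dop d (U d)) :=
  (Cl.cmul TCf.pp.1 ((hU.dd 0).dd 0)).add ((hU.OpS (two_mul_TCf .pp).1 (two_mul_TCf .pw).1 TCf.pp.1
    (two_mul_TCf .pw).1 TCf.ww.1).mono (Nat.le_succ _))

theorem Cl.Qdel {j : ℕ} {U : LD → Z → ℝ} (hU : Cl j U) : Cl (j + 1) (fun d => Qdel d (U d)) :=
  have h12 : TCf (fun d t => d.p1 t * d.p2 t) := TCf.p1.mul .p2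
  have h11 : TCf (fun d t => d.p1 t * d.p1 t) := TCf.p1.mul .p1
  have a : TCf (fun d t => d.p1 t * d.w2 t + d.w1 t * d.p2 t) :=
    (TCf.p1.mul .w2).add (TCf.w1.mul .p2)
  have b : TCf (fun d t => d.p1 t * d.w1 t + d.w1 t * d.p1 t) :=
    (TCf.p1.mul .w1).add (TCf.w1.mul .p1)
  (Cl.cmul .g1 (hU.OpS (two_mul_TCf h12).1 a.1 h12.1 a.1 (TCf.w1.mul .w2).1)).sub
    (Cl.cmul .g2 (hU.OpS (two_mul_TCf h11).1 b.1 h11.1 b.1 (TCf.w1.mul .w1).1))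

theorem TCl.EE {j : ℕ} {V : LD → Z → ℝ} (hV : TCl j V) : Cl (j + 1) (fun d => EE d (V d)) :=
  ((Cl.cmul .ga hV.Kop.1).add hV.Kop.2).add (Cl.cmul TCf.r.1 hV.1.JJ.JJ.Qdel)

theorem Cl.Xo {j : ℕ} {c e : LD → ℝ → ℝ} (hc : Cf c) (he : Cf e) {U : LD → Z → ℝ} (hU : Cl j U) :
    Cl j (fun d => Xo d.N⁻¹ (c d) (e d) (U d)) :=
  (Cl.cmul hc (hU.dd 0)).add
    (((Cl.cmul hc (hU.dd 1)).add (Cl.cmul he (hU.dd 2))).delta.mono (Nat.le_succ _))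

theorem Cl.X1 {j : ℕ} {U : LD → Z → ℝ} (hU : Cl j U) : Cl j (fun d => X1 d (U d)) :=
  hU.Xo TCf.p1.1 TCf.w1.1

theorem Cl.X2 {j : ℕ} {U : LD → Z → ℝ} (hU : Cl j U) : Cl j (fun d => X2 d (U d)) :=
  hU.Xo TCf.p2.1 TCf.w2.1

theorem Cl.alp {j : ℕ} {U : LD → Z → ℝ} (hU : Cl j U) : Cl j (fun d => alp d.N⁻¹ (U d)) :=
  (hU.dd 0).add ((hU.dd 1).delta.mono (Nat.le_succ _))

theorem Cl.BB {j k : ℕ} {V U : LD → Z → ℝ} (hV : Cl j V) (hU : Cl k U) :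
    Cl (j + k + 1) (fun d => BB d (V d) (U d)) := by
  have a := hV.JJ.JJ.X1
  have b := hU.JJ.JJ.Dop
  have hc : Cf (fun d t => d.G t * (d.r t * (d.r t * d.sg t))) :=
    Cf.G.mul (TCf.r.1.mul (TCf.r.1.mul TCf.sg.1))
  exact (Cl.cmul hc ((a.alp.mul (b.dd 2)).sub ((a.dd 2).mul b.alp))).delta

theorem Good.JJ {d : LD} {V : Z → ℝ} (hV : Good d V) : Good d (JJ V) := hV.Av sm_half

theorem Good.Kop_zero {d : LD} {V : Z → ℝ} (hV : Good d V) : ∀ z ∈ flatSet, Kop d V z = 0 :=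
  fun z hz => by rw [Kop, Ddel, hV.JJ.JJ.OpS_zero _ _ _ _ _ _ z hz, mul_zero]

theorem Good.EE_zero {d : LD} {V : Z → ℝ} (hV : Good d V) : ∀ z ∈ flatSet, EE d V z = 0 :=
  fun z hz => by
    rw [EE, hV.Kop_zero z hz, dd_zero_on isOpen_flatSet _ hV.Kop_zero z hz, Qdel,
      hV.JJ.JJ.OpS_zero _ _ _ _ _ _ z hz, hV.JJ.JJ.OpS_zero _ _ _ _ _ _ z hz]
    ring

theorem BB_zero {V U : LD → Z → ℝ} (hV : Cl 0 V) (hU : Cl 0 U) (d : LD) :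
    ∀ z ∈ flatSet, BB d (V d) (U d) z = 0 := fun z hz => by
  have a := (hV.JJ.JJ.X1.1 d).flat2 z hz
  have b := (hU.JJ.JJ.Dop.1 d).flat2 z hz
  rw [BB, a, b]; ring

theorem Av_sub {κ : ℝ → ℝ} (hκ : Sm κ) {f g : Z → ℝ} (hf : Sm f) (hg : Sm g) :
    Av κ (fun z => f z - g z) = fun z => Av κ f z - Av κ g z := by
  funext z
  have hc : ∀ h : Z → ℝ, Sm h →
      IntervalIntegrable (fun s => κ s * h (z + s • ev 0)) volume 0 1 := fun h hh =>
    (hκ.continuous.mul (hh.continuous.comp (by fun_prop))).intervalIntegrable _ _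
  simp only [Av]
  rw [← intervalIntegral.integral_sub (hc f hf) (hc g hg)]
  simp only [mul_sub]

theorem sm_JJ {f : Z → ℝ} (hf : Sm f) : Sm (JJ f) := sm_Av sm_half hf

theorem JJ_JJ_sub {f g : Z → ℝ} (hf : Sm f) (hg : Sm g) :
    JJ (JJ (fun z => f z - g z)) = fun z => JJ (JJ f) z - JJ (JJ g) z := by
  have h1 : JJ (fun z => f z - g z) = fun z => JJ f z - JJ g z := Av_sub sm_half hf hg
  rw [h1]
  exact Av_sub sm_half (sm_JJ hf) (sm_JJ hg)

theorem Kop_sub (d : LD) {f g : Z → ℝ} (hf : Sm f) (hg : Sm g) :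
    Kop d (fun z => f z - g z) = fun z => Kop d f z - Kop d g z := by
  funext z
  rw [Kop, JJ_JJ_sub hf hg, Ddel, OpS_sub _ _ _ _ _ _ (sm_JJ (sm_JJ hf)) (sm_JJ (sm_JJ hg))]
  simp only [Kop, Ddel]; ring

theorem EE_sub {f g : LD → Z → ℝ} (hf : TCl 0 f) (hg : TCl 0 g) (d : LD) (z : Z) :
    EE d (fun z => f d z - g d z) z = EE d (f d) z - EE d (g d) z := by
  have sf := (hf.1.1 d).sm
  have sg := (hg.1.1 d).sm
  rw [EE, Kop_sub d sf sg, dd_sub _ (hf.Kop.1.1 d).sm (hg.Kop.1.1 d).sm, JJ_JJ_sub sf sg]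
  simp only [Qdel, OpS_sub _ _ _ _ _ _ (sm_JJ (sm_JJ sf)) (sm_JJ (sm_JJ sg)), EE]
  ring

theorem X1_sub (d : LD) {f g : Z → ℝ} (hf : Sm f) (hg : Sm g) :
    X1 d (fun z => f z - g z) = fun z => X1 d f z - X1 d g z := by
  funext z
  simp only [X1, Xo, dd_sub _ hf hg]; ring

theorem Dop_sub (d : LD) {f g : Z → ℝ} (hf : Sm f) (hg : Sm g) :
    Dop d (fun z => f z - g z) = fun z => Dop d f z - Dop d g z := by
  funext z
  simp only [Dop, dd_sub _ hf hg, dd_sub _ (hf.dd _) (hg.dd _), Ddel, OpS_sub _ _ _ _ _ _ hf hg]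
  ring

theorem BB_sub_sub {f g : LD → Z → ℝ} (hf : Cl 0 f) (hg : Cl 0 g) (d : LD) (z : Z) :
    BB d (fun z => f d z - g d z) (fun z => f d z - g d z) z =
      BB d (f d) (f d) z - BB d (f d) (g d) z - BB d (g d) (f d) z + BB d (g d) (g d) z := by
  have sf := (hf.1 d).sm
  have sg := (hg.1 d).sm
  simp only [BB, JJ_JJ_sub sf sg, X1_sub d (sm_JJ (sm_JJ sf)) (sm_JJ (sm_JJ sg)),
    Dop_sub d (sm_JJ (sm_JJ sf)) (sm_JJ (sm_JJ sg)), alp,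
    dd_sub _ (hf.JJ.JJ.X1.1 d).sm (hg.JJ.JJ.X1.1 d).sm,
    dd_sub _ (hf.JJ.JJ.Dop.1 d).sm (hg.JJ.JJ.Dop.1 d).sm]
  ring

/-- The normalized residual of a density profile. -/
noncomputable def rs (d : LD) (W : Z → ℝ) : Z → ℝ := fun z =>
  dd eT W z + EE d W z - BB d W W z

theorem exists_profile {W0 : LD → Z → ℝ} (h0 : TCl 0 W0) (m : ℕ) :
    ∃ W E : LD → Z → ℝ, TCl 0 W ∧ Cl (m + 1) E ∧ (∀ d, ∀ z ∈ flatSet, E d z = 0) ∧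
      (∀ d, ∀ z ∈ flatSet, W d z = W0 d z) ∧ ∀ d z, rs d (W d) z = dd eT (W0 d) z + E d z := by
  induction m with
  | zero =>
    refine ⟨W0, fun d z => EE d (W0 d) z - BB d (W0 d) (W0 d) z, h0,
      h0.EE.sub (h0.1.BB h0.1), fun d z hz => ?_, fun _ _ _ => rfl, fun d z => ?_⟩
    · simp only [(h0.1.1 d).EE_zero z hz, BB_zero h0.1 h0.1 d z hz, sub_zero]
    · rw [rs]; ring
  | succ m ih =>
    obtain ⟨W, E, hW, hE, hE0, hW0, hres⟩ := ih
    have hV : TCl (m + 1) (fun d => Ti d.t0 (E d)) := TCl.Ti hE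
    have hV0 : TCl 0 (fun d => Ti d.t0 (E d)) := hV.mono (Nat.zero_le _)
    refine ⟨fun d z => W d z - Ti d.t0 (E d) z, fun d z => (BB d (W d) (Ti d.t0 (E d)) z +
      BB d (Ti d.t0 (E d)) (W d) z - BB d (Ti d.t0 (E d)) (Ti d.t0 (E d)) z)
      - EE d (Ti d.t0 (E d)) z, hW.sub hV0, ?_, fun d z hz => ?_, fun d z hz => ?_, fun d z => ?_⟩
    · refine Cl.sub (Cl.sub (Cl.add ?_ ?_) ?_) hV.EE
      · exact (hW.1.BB hV.1).mono (by omega)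
      · exact (hV.1.BB hW.1).mono (by omega)
      · exact (hV.1.BB hV.1).mono (by omega)
    · have e1 := BB_zero hW.1 hV0.1 d z hz
      have e2 := BB_zero hV0.1 hW.1 d z hz
      have e3 := BB_zero hV0.1 hV0.1 d z hz
      have e4 := (hV0.1.1 d).EE_zero z hz
      simp only [e1, e2, e3, e4]; ring
    · have : Ti d.t0 (E d) z = 0 := Ti_zero fun s _ => hE0 d _ hz
      simp only [this, hW0 d z hz, sub_zero]
    · have h1 := hres d z
      rw [rs] at h1 ⊢
      rw [dd_sub _ (hW.1.1 d).sm (hV0.1.1 d).sm, EE_sub hW hV0, BB_sub_sub hW.1 hV0.1,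
        dd_time_Ti _ (hE.1 d).sm]
      linarith

/-- The residual of the lifted stream function equation. -/
noncomputable def Res (d : LD) (Φ : Z → ℝ) : Z → ℝ := fun z =>
  dd eT (Dop d Φ) z + (d.g1 z.1 * X1 d (X2 d Φ) z - d.g2 z.1 * X1 d (X1 d Φ) z)
    - (X1 d (X1 d Φ) z * X2 d (Dop d Φ) z - X2 d (X1 d Φ) z * X1 d (Dop d Φ) z)

/-- The stream function profile of a density profile. -/
noncomputable def Ph (d : LD) (W : Z → ℝ) : Z → ℝ := fun z =>
  d.G z.1 * (d.r z.1 * JJ (JJ W) z)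

theorem Xo_cross (d : LD) (f h : Z → ℝ) (z : Z) :
    X1 d f z * X2 d h z - X2 d f z * X1 d h z = d.N⁻¹ * (d.sg z.1 *
      (alp d.N⁻¹ f z * dd (ev 2) h z - dd (ev 2) f z * alp d.N⁻¹ h z)) := by
  simp only [X1, X2, Xo, alp, LD.sg]; ring

theorem OpS_smul_time {a : ℝ → ℝ} (ha : Sm a) (e : ℝ) (c1 c2 c3 c4 c5 : ℝ → ℝ) {U : Z → ℝ}
    (hU : Sm U) (z : Z) : OpS e c1 c2 c3 c4 c5 (fun z => a z.1 * U z) z =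
      a z.1 * OpS e c1 c2 c3 c4 c5 U z := by
  simp only [OpS, dd_smul_time ha _ hU, dd_smul_time ha _ (hU.dd _)]
  ring

theorem Dop_smul_time (d : LD) {a : ℝ → ℝ} (ha : Sm a) {U : Z → ℝ}
    (hU : Sm U) : Dop d (fun z => a z.1 * U z) = fun z => a z.1 * Dop d U z := by
  funext z
  simp only [Dop, dd_smul_time ha _ hU, dd_smul_time ha _ (hU.dd _), Ddel, OpS_smul_time ha _ _ _ _ _ _ hU]
  ring

theorem X1_smul_time (d : LD) {a : ℝ → ℝ} (ha : Sm a) {U : Z → ℝ}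
    (hU : Sm U) : X1 d (fun z => a z.1 * U z) = fun z => a z.1 * X1 d U z := Xo_smul_time ha hU

theorem X2_smul_time (d : LD) {a : ℝ → ℝ} (ha : Sm a) {U : Z → ℝ}
    (hU : Sm U) : X2 d (fun z => a z.1 * U z) = fun z => a z.1 * X2 d U z := Xo_smul_time ha hU

theorem alp_smul_time (e : ℝ) {a : ℝ → ℝ} (ha : Sm a) {U : Z → ℝ}
    (hU : Sm U) (z : Z) : alp e (fun z => a z.1 * U z) z = a z.1 * alp e U z := by
  simp only [alp, dd_smul_time ha _ hU]; ring

theorem Ph_eq (d : LD) (W : Z → ℝ) : Ph d W = fun z =>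
    (fun t => d.G t * d.r t) z.1 * JJ (JJ W) z := by
  funext z; simp only [Ph]; ring

theorem Dop_Ph (d : LD) {W : Z → ℝ} (hW : Sm W) (hp : Per W) :
    Dop d (Ph d W) = fun z => d.G z.1 * (W z - Mn W z + Kop d W z) := by
  have ha : Sm (fun t => d.G t * d.r t) := d.sG.mul d.sr
  rw [Ph_eq, Dop_smul_time d ha (sm_JJ (sm_JJ hW))]
  funext z
  have h1 := d.r_mul_pp z.1
  simp only [Dop, dd_dd_JJ hW hp, Kop]
  linear_combination (d.G z.1 * (W z - Mn W z)) * h1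

theorem Res_Ph {W : LD → Z → ℝ} (hW : TCl 0 W) (d : LD) (z : Z) :
    Res d (Ph d (W d)) z = d.G z.1 * (rs d (W d) z - Mn (dd eT (W d)) z) := by
  have sW := (hW.1.1 d).sm
  have hp := (hW.1.1 d).per
  have sU := sm_JJ (sm_JJ sW)
  have ha : Sm (fun t => d.G t * d.r t) := d.sG.mul d.sr
  have sK := (hW.Kop.1.1 d).sm
  have sM : Sm (Mn (W d)) := sm_Av contDiff_const sW
  have sX := (hW.1.JJ.JJ.X1.1 d).sm
  have sD := (hW.1.JJ.JJ.Dop.1 d).sm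
  have e1 : dd eT (Dop d (Ph d (W d))) z = d.ga z.1 * d.G z.1 * (W d z - Mn (W d) z + Kop d (W d) z)
      + d.G z.1 * (dd eT (W d) z - Mn (dd eT (W d)) z + dd eT (Kop d (W d)) z) := by
    have s1 : Sm (fun z => W d z - Mn (W d) z) := sW.sub sM
    rw [Dop_Ph d sW hp, dd_time_cmul d.sG (s1.add sK), dd_add _ s1 sK, dd_sub _ sW sM]
    have hg := (d.dG z.1).deriv
    have hm : dd eT (Mn (W d)) z = Mn (dd eT (W d)) z := by rw [Mn, dd_Av contDiff_const sW]; rfl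
    simp only [hg, hm, LD.ga, LD.r]
  have e2 : X1 d (X2 d (Ph d (W d))) z = d.G z.1 * d.r z.1 * X1 d (X2 d (JJ (JJ (W d)))) z := by
    rw [Ph_eq, X2_smul_time d ha sU, X1_smul_time d ha (hW.1.JJ.JJ.X2.1 d).sm]
  have e3 : X1 d (X1 d (Ph d (W d))) z = d.G z.1 * d.r z.1 * X1 d (X1 d (JJ (JJ (W d)))) z := by
    rw [Ph_eq, X1_smul_time d ha sU, X1_smul_time d ha sX]
  have e4 : X1 d (X2 d (JJ (JJ (W d)))) z = _ := Xo_Xo d.sp2 d.sw2 sU z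
  have e5 : X1 d (X1 d (JJ (JJ (W d)))) z = _ := Xo_Xo d.sp1 d.sw1 sU z
  have e6 : d.g1 z.1 * X1 d (X2 d (Ph d (W d))) z - d.g2 z.1 * X1 d (X1 d (Ph d (W d))) z =
      d.G z.1 * (d.r z.1 * Qdel d (JJ (JJ (W d))) z - d.ga z.1 * (W d z - Mn (W d) z)) := by
    rw [e2, e3, e4, e5, dd_dd_JJ sW hp]
    simp only [Qdel, LD.ga]
    ring
  have e7 : X1 d (X1 d (Ph d (W d))) z * X2 d (Dop d (Ph d (W d))) z
      - X2 d (X1 d (Ph d (W d))) z * X1 d (Dop d (Ph d (W d))) z =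
      d.G z.1 * BB d (W d) (W d) z := by
    rw [Xo_cross, Ph_eq, X1_smul_time d ha sU, Dop_smul_time d ha sU, alp_smul_time _ ha sX,
      alp_smul_time _ ha sD, dd_smul_time ha _ sX, dd_smul_time ha _ sD]
    simp only [BB]
    ring
  rw [Res, e1, e6, e7, rs, EE]
  ring

end Operators

section BaseProfile

/-- Smooth functions all of whose derivatives are bounded. -/
def BD (f : ℝ → ℝ) : Prop := Sm f ∧ ∀ n : ℕ, ∃ C, ∀ x, |deriv^[n] f x| ≤ C

theorem BD.deriv {f : ℝ → ℝ} (h : BD f) : BD (deriv f) := ⟨h.1.deriv, fun n => h.2 (n + 1)⟩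

theorem sm_iterate {f : ℝ → ℝ} (h : Sm f) (n : ℕ) : Sm (deriv^[n] f) := by
  induction n generalizing f with
  | zero => exact h
  | succ n ih => exact ih h.deriv

theorem BD.of_periodic {f : ℝ → ℝ} (hs : Sm f) (hp : Function.Periodic f 1) : BD f := by
  refine ⟨hs, fun n => ?_⟩
  have hp' : Function.Periodic (_root_.deriv^[n] f) 1 := by
    clear hs
    induction n generalizing f with
    | zero => exact hp
    | succ n ih =>
      refine ih (fun x => ?_)
      have := deriv_comp_add_const f 1 x
      rw [← this]; congr 1; funext y; exact hp y
  obtain ⟨C, hC⟩ := isCompact_Icc.exists_bound_of_continuousOn (s := Set.Icc (0:ℝ) 1)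
    (sm_iterate hs n).continuous.continuousOn
  refine ⟨C, fun x => ?_⟩
  obtain ⟨y, hy, hxy⟩ := hp'.exists_mem_Ico₀ one_pos x
  rw [hxy]
  exact hC y ⟨hy.1, hy.2.le⟩

theorem BD.of_support {f : ℝ → ℝ} (hs : Sm f) (h0 : ∀ x, 1 < |x| → f x = 0) : BD f := by
  refine ⟨hs, fun n => ?_⟩
  have h0' : ∀ x, 1 < |x| → _root_.deriv^[n] f x = 0 := by
    clear hs
    induction n generalizing f with
    | zero => exact h0
    | succ n ih =>
      refine ih (fun x hx => ?_)
      have ho : IsOpen {x : ℝ | 1 < |x|} := isOpen_lt continuous_const (by fun_prop)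
      have : f =ᶠ[nhds x] fun _ => 0 := Filter.eventuallyEq_of_mem (ho.mem_nhds hx) h0
      rw [this.deriv_eq]; simp
  obtain ⟨C, hC⟩ := isCompact_Icc.exists_bound_of_continuousOn (s := Set.Icc (-1:ℝ) 1)
    (sm_iterate hs n).continuous.continuousOn
  refine ⟨C, fun x => ?_⟩
  by_cases hx : 1 < |x|
  · rw [h0' x hx, abs_zero]; exact (norm_nonneg _).trans (hC 0 (by simp))
  · exact hC x (abs_le.1 (not_lt.1 hx))

/-- A smooth cutoff. -/
noncomputable def ch (s : ℝ) : ℝ := Real.smoothTransition ((9 / 16 - s ^ 2) * (16 / 5))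

theorem sm_ch : Sm ch := Real.smoothTransition.contDiff.comp (by fun_prop)

theorem ch_one {s : ℝ} (h : |s| ≤ 1 / 2) : ch s = 1 := by
  refine Real.smoothTransition.one_of_one_le ?_
  have := sq_le_sq' (abs_le.1 h).1 (abs_le.1 h).2
  linarith

theorem ch_zero {s : ℝ} (h : 3 / 4 ≤ |s|) : ch s = 0 := by
  refine Real.smoothTransition.zero_of_nonpos ?_
  have : (3 / 4 : ℝ) ^ 2 ≤ s ^ 2 := by rw [← sq_abs s]; gcongr
  linarith

theorem ch_neg (s : ℝ) : ch (-s) = ch s := by simp [ch]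

theorem deriv_ch {s : ℝ} (h : |s| < 1 / 2 ∨ 3 / 4 < |s|) : deriv ch s = 0 := by
  rcases h with h | h
  · have ho : IsOpen {x : ℝ | |x| < 1 / 2} := isOpen_lt (by fun_prop) continuous_const
    have : ch =ᶠ[nhds s] fun _ => 1 :=
      Filter.eventuallyEq_of_mem (ho.mem_nhds h) fun x hx => ch_one (le_of_lt hx)
    rw [this.deriv_eq]; simp
  · have ho : IsOpen {x : ℝ | 3 / 4 < |x|} := isOpen_lt continuous_const (by fun_prop)
    have : ch =ᶠ[nhds s] fun _ => 0 :=
      Filter.eventuallyEq_of_mem (ho.mem_nhds h) fun x hx => ch_zero (le_of_lt hx)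
    rw [this.deriv_eq]; simp

theorem bd_ch : BD ch := .of_support sm_ch fun x hx => ch_zero (by linarith)

/-- A smooth odd periodic function equal to the identity near zero. -/
noncomputable def wv (θ : ℝ) : ℝ :=
  ch (sin (2 * π * θ)) * arcsin (sin (2 * π * θ)) * (2 * π)⁻¹

theorem sm_wv : Sm wv := by
  have h : Sm (fun s => ch s * arcsin s) := by
    refine contDiff_iff_contDiffAt.2 fun s => ?_
    by_cases hs : 3 / 4 < |s|
    · have ho : IsOpen {x : ℝ | 3 / 4 < |x|} := isOpen_lt continuous_const (by fun_prop)
      have : (fun s => ch s * arcsin s) =ᶠ[nhds s] fun _ => 0 :=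
        Filter.eventuallyEq_of_mem (ho.mem_nhds hs) fun x hx => by
          simp [ch_zero (le_of_lt hx)]
      exact contDiffAt_const.congr_of_eventuallyEq this
    · have h1 : s ≠ -1 := by rintro rfl; norm_num at hs
      have h2 : s ≠ 1 := by rintro rfl; norm_num at hs
      exact sm_ch.contDiffAt.mul (contDiffAt_arcsin h1 h2)
  have h2 : Sm (fun θ : ℝ => sin (2 * π * θ)) := Real.contDiff_sin.comp (by fun_prop)
  exact (h.comp h2).mul contDiff_const

theorem wv_per : Function.Periodic wv 1 := by
  intro x
  have : sin (2 * π * (x + 1)) = sin (2 * π * x) := by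
    rw [mul_add, mul_one, sin_add_two_pi]
  simp only [wv, this]

theorem wv_neg (x : ℝ) : wv (-x) = - wv x := by
  simp only [wv, mul_neg, sin_neg, arcsin_neg, ch_neg]; ring

theorem wv_eq {x : ℝ} (h : |x| ≤ 1 / 16) : wv x = x := by
  have hp : |2 * π * x| ≤ 1 / 2 := by
    rw [abs_mul, abs_of_pos (by positivity)]
    have := pi_lt_four
    nlinarith [pi_pos, abs_nonneg x]
  have h1 : |sin (2 * π * x)| ≤ 1 / 2 := abs_sin_le_abs.trans hp
  have h2 := abs_le.1 hp
  have := pi_gt_three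
  rw [wv, ch_one h1, arcsin_sin (by linarith) (by linarith)]
  field_simp

theorem wv_mean : ∫ s in (0:ℝ)..1, wv s = 0 := by
  have h := intervalIntegral.integral_comp_sub_left (a := 0) (b := 1) wv 1
  have h2 : ∀ s, wv (1 - s) = - wv s := fun s => by
    rw [show (1:ℝ) - s = -s + 1 by ring, wv_per, wv_neg]
  simp only [h2, intervalIntegral.integral_neg, sub_self, sub_zero] at h
  linarith

theorem wv_mean' (x : ℝ) : ∫ s in (0:ℝ)..1, wv (x + s) = 0 := by
  have h := intervalIntegral.integral_comp_add_left (a := 0) (b := 1) wv x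
  rw [h, add_zero, wv_per.intervalIntegral_add_eq x 0, zero_add, wv_mean]

/-- Tensor products. -/
noncomputable def tp (a b c e : ℝ → ℝ) (z : Z) : ℝ :=
  a z.1 * (b z.2.1 * (c z.2.2.1 * e z.2.2.2))

theorem sm_tp {a b c e : ℝ → ℝ} (ha : Sm a) (hb : Sm b) (hc : Sm c) (he : Sm e) :
    Sm (tp a b c e) :=
  (ha.comp contDiff_fst).mul ((hb.comp (by fun_prop)).mul
    ((hc.comp (by fun_prop)).mul (he.comp (by fun_prop))))

theorem dd_coord {a : ℝ → ℝ} (ha : Sm a) (L : Z →L[ℝ] ℝ) (v : Z) :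
    dd v (fun z => a (L z)) = fun z => L v * deriv a (L z) := by
  funext z
  have h := (ha.diff (L z)).hasDerivAt.comp_hasFDerivAt z L.hasFDerivAt
  refine (dd_eq_of_hasFDerivAt h v).trans ?_
  simp [mul_comm]

/-- Coordinate projections. -/
noncomputable def pz0 : Z →L[ℝ] ℝ := ContinuousLinearMap.fst ℝ ℝ (ℝ × ℝ × ℝ)
noncomputable def pz1 : Z →L[ℝ] ℝ :=
  (ContinuousLinearMap.fst ℝ ℝ (ℝ × ℝ)).comp (ContinuousLinearMap.snd ℝ ℝ (ℝ × ℝ × ℝ))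
noncomputable def pz2 : Z →L[ℝ] ℝ := (ContinuousLinearMap.fst ℝ ℝ ℝ).comp
  ((ContinuousLinearMap.snd ℝ ℝ (ℝ × ℝ)).comp (ContinuousLinearMap.snd ℝ ℝ (ℝ × ℝ × ℝ)))
noncomputable def pz3 : Z →L[ℝ] ℝ := (ContinuousLinearMap.snd ℝ ℝ ℝ).comp
  ((ContinuousLinearMap.snd ℝ ℝ (ℝ × ℝ)).comp (ContinuousLinearMap.snd ℝ ℝ (ℝ × ℝ × ℝ)))

theorem dd_tp {a b c e : ℝ → ℝ} (ha : Sm a) (hb : Sm b) (hc : Sm c) (he : Sm e) (v : Z) :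
    dd v (tp a b c e) = fun z => v.1 * tp (deriv a) b c e z + v.2.1 * tp a (deriv b) c e z +
      v.2.2.1 * tp a b (deriv c) e z + v.2.2.2 * tp a b c (deriv e) z := by
  have sa : Sm (fun z => a (pz0 z)) := ha.comp (by fun_prop)
  have sb : Sm (fun z => b (pz1 z)) := hb.comp (by fun_prop)
  have sc : Sm (fun z => c (pz2 z)) := hc.comp (by fun_prop)
  have se : Sm (fun z => e (pz3 z)) := he.comp (by fun_prop)
  change dd v (fun z => a (pz0 z) * (b (pz1 z) * (c (pz2 z) * e (pz3 z)))) = _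
  rw [dd_mul _ sa (sb.mul (sc.mul se)), dd_mul _ sb (sc.mul se), dd_mul _ sc se,
    dd_coord ha, dd_coord hb, dd_coord hc, dd_coord he]
  funext z
  simp only [tp, pz0, pz1, pz2, pz3, ContinuousLinearMap.comp_apply, ContinuousLinearMap.coe_fst', ContinuousLinearMap.coe_snd']
  ring

theorem wd_tp (l : List (Fin 3)) : ∀ {b c e : ℝ → ℝ}, BD b → BD c → BD e →
    ∃ b' c' e', BD b' ∧ BD c' ∧ BD e' ∧ ∀ a, Sm a → wd l (tp a b c e) = tp a b' c' e' := by
  induction l with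
  | nil => intro b c e hb hc he; exact ⟨b, c, e, hb, hc, he, fun _ _ => rfl⟩
  | cons k l ih =>
    intro b c e hb hc he
    have key : ∃ b' c' e', BD b' ∧ BD c' ∧ BD e' ∧ ∀ a, Sm a →
        dd (ev k) (tp a b c e) = tp a b' c' e' := by
      fin_cases k
      · exact ⟨_, _, _, hb.deriv, hc, he, fun a ha => by
          rw [dd_tp ha hb.1 hc.1 he.1]; funext z; simp [ev]⟩
      · exact ⟨_, _, _, hb, hc.deriv, he, fun a ha => by
          rw [dd_tp ha hb.1 hc.1 he.1]; funext z; simp [ev]⟩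
      · exact ⟨_, _, _, hb, hc, he.deriv, fun a ha => by
          rw [dd_tp ha hb.1 hc.1 he.1]; funext z; simp [ev]⟩
    obtain ⟨b', c', e', hb', hc', he', h⟩ := key
    obtain ⟨b2, c2, e2, hb2, hc2, he2, h2⟩ := ih hb' hc' he'
    exact ⟨b2, c2, e2, hb2, hc2, he2, fun a ha => by rw [wd, h a ha, h2 a ha]⟩

theorem BD.bound {f : ℝ → ℝ} (h : BD f) : ∃ C, ∀ x, |f x| ≤ C := h.2 0

theorem B1_tp {a : LD → ℝ → ℝ} (ha : Cf a) (l : List (Fin 3)) :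
    B1 l 0 (fun d => tp (a d) wv ch ch) := by
  obtain ⟨b, c, e, hb, hc, he, h⟩ := wd_tp l (BD.of_periodic sm_wv wv_per) bd_ch bd_ch
  obtain ⟨B, hB⟩ := hb.bound
  obtain ⟨C, hC⟩ := hc.bound
  obtain ⟨D, hD⟩ := he.bound
  obtain ⟨K, q, hK, hk⟩ := ha.2
  have b0 := (abs_nonneg _).trans (hB 0)
  have c0 := (abs_nonneg _).trans (hC 0)
  have d0 := (abs_nonneg _).trans (hD 0)
  refine ⟨K * (B * (C * D)), q, by positivity, fun d z hz => ?_⟩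
  have h1 := hk d z.1 hz
  rw [h _ (ha.1 d), tp, abs_mul, abs_mul, abs_mul, pow_zero, mul_one]
  have h0 := (abs_nonneg _).trans h1
  calc _ ≤ (K * d.lam ^ q) * (B * (C * D)) := by
        gcongr
        · exact hB _
        · exact hC _
        · exact hD _
    _ = _ := by ring

theorem flat_ch {z : Z} (h : z ∈ flatSet) : deriv ch z.2.2.1 * ch z.2.2.2 = 0 ∧
    ch z.2.2.1 * deriv ch z.2.2.2 = 0 := by
  rcases h with h | h | h
  · rw [deriv_ch (Or.inl h.1), deriv_ch (Or.inl h.2)]; simp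
  · rw [deriv_ch (Or.inr h), ch_zero h.le]; simp
  · rw [deriv_ch (Or.inr h), ch_zero h.le]; simp

theorem Good_tp (d : LD) {a : ℝ → ℝ} (ha : Sm a) (h0 : ∀ t < d.t1, a t = 0) :
    Good d (tp a wv ch ch) where
  sm := sm_tp ha sm_wv sm_ch sm_ch
  per z := by simp [tp, ev, wv_per z.2.1]
  early z hz := by simp [tp, h0 _ hz]
  flat1 z hz := by
    rw [dd_tp ha sm_wv sm_ch sm_ch]
    simp [ev, tp, (flat_ch hz).1]
  flat2 z hz := by
    rw [dd_tp ha sm_wv sm_ch sm_ch]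
    simp [ev, tp, (flat_ch hz).2]

/-- The leading order profile of a layer. -/
noncomputable def prof (d : LD) : Z → ℝ := tp d.ze wv ch ch

theorem dd_time_prof (d : LD) : dd eT (prof d) = tp (deriv d.ze) wv ch ch := by
  rw [prof, dd_tp d.sze sm_wv sm_ch sm_ch]; funext z; simp [eT]

theorem TCl_prof : TCl 0 prof := by
  refine ⟨⟨fun d => Good_tp d d.sze d.ze0, B1_tp TCf.ze.1⟩, Cl.congr ?_ dd_time_prof⟩
  refine ⟨fun d => Good_tp d d.sze.deriv fun t ht => ?_, B1_tp TCf.ze.2⟩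
  have : d.ze =ᶠ[nhds t] fun _ => 0 :=
    Filter.eventuallyEq_of_mem (isOpen_Iio.mem_nhds ht) d.ze0
  rw [this.deriv_eq]; simp

theorem Mn_tp (a c e : ℝ → ℝ) (z : Z) : Mn (tp a wv c e) z = 0 := by
  have : ∀ s : ℝ, (1:ℝ) * tp a wv c e (z + s • ev 0) =
      (a z.1 * (c z.2.2.1 * e z.2.2.2)) * wv (z.2.1 + s) := fun s => by
    simp [tp, ev]; ring
  simp only [Mn, Av, this]
  rw [intervalIntegral.integral_const_mul, wv_mean', mul_zero]

end BaseProfile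

section Lift

/-- Space-time. -/
abbrev S := (ℝ × ℝ) × ℝ

/-- First spatial direction. -/
def e1 : S := ((1, 0), 0)
/-- Second spatial direction. -/
def e2 : S := ((0, 1), 0)
/-- Time direction. -/
def eS : S := ((0, 0), 1)

theorem fderiv_eq_of_line {E F : Type} [NormedAddCommGroup E] [NormedSpace ℝ E]
    [NormedAddCommGroup F] [NormedSpace ℝ F] {L : E → F} (hL : Sm L) {y v : E} {w : F}
    (h : HasDerivAt (fun τ : ℝ => L (y + τ • v)) w 0) : fderiv ℝ L y v = w := by
  have h1 : HasDerivAt (fun τ : ℝ => y + τ • v) v 0 := by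
    simpa using ((hasDerivAt_id (0:ℝ)).smul_const v).const_add y
  have h2 : HasFDerivAt L (fderiv ℝ L y) (y + (0:ℝ) • v) := by
    simpa using (hL.diff y).hasFDerivAt
  exact (h2.comp_hasDerivAt 0 h1).unique h

/-- The phase map of a layer. -/
noncomputable def Lf (d : LD) (y : S) : Z :=
  (y.2, d.N * (d.p1 y.2 * y.1.1 + d.p2 y.2 * y.1.2), d.p1 y.2 * y.1.1 + d.p2 y.2 * y.1.2,
    d.w1 y.2 * y.1.1 + d.w2 y.2 * y.1.2)

theorem sm_lin {a b : ℝ → ℝ} (ha : Sm a) (hb : Sm b) :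
    Sm (fun y : S => a y.2 * y.1.1 + b y.2 * y.1.2) :=
  ((ha.comp contDiff_snd).mul (by fun_prop)).add ((hb.comp contDiff_snd).mul (by fun_prop))

theorem sm_Lf (d : LD) : Sm (Lf d) :=
  contDiff_snd.prodMk ((contDiff_const.mul (sm_lin d.sp1 d.sp2)).prodMk
    ((sm_lin d.sp1 d.sp2).prodMk (sm_lin d.sw1 d.sw2)))

theorem line_lin (a b : ℝ → ℝ) (y : S) (v : ℝ × ℝ) :
    HasDerivAt (fun τ : ℝ => a (y + τ • ((v, 0) : S)).2 * (y + τ • ((v, 0) : S)).1.1 +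
      b (y + τ • ((v, 0) : S)).2 * (y + τ • ((v, 0) : S)).1.2)
      (a y.2 * v.1 + b y.2 * v.2) 0 := by
  have h : ∀ u w : ℝ, HasDerivAt (fun τ : ℝ => u + τ * w) w 0 := fun u w => by
    simpa using ((hasDerivAt_id (0:ℝ)).mul_const w).const_add u
  have := ((h y.1.1 v.1).const_mul (a y.2)).add ((h y.1.2 v.2).const_mul (b y.2))
  refine this.congr_of_eventuallyEq (Eventually.of_forall fun τ => ?_)
  simp

theorem line_time {a b : ℝ → ℝ} {a' b' : ℝ} {y : S} (ha : HasDerivAt a a' y.2)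
    (hb : HasDerivAt b b' y.2) :
    HasDerivAt (fun τ : ℝ => a (y + τ • eS).2 * (y + τ • eS).1.1 +
      b (y + τ • eS).2 * (y + τ • eS).1.2) (a' * y.1.1 + b' * y.1.2) 0 := by
  have ha2 : HasDerivAt a a' (y.2 + 0) := by simpa using ha
  have hb2 : HasDerivAt b b' (y.2 + 0) := by simpa using hb
  have := ((ha2.comp_const_add y.2 0).mul_const y.1.1).add
    ((hb2.comp_const_add y.2 0).mul_const y.1.2)
  refine this.congr_of_eventuallyEq (Eventually.of_forall fun τ => ?_)
  simp [eS]

theorem fderiv_Lf (d : LD) (y : S) (v : ℝ × ℝ) : fderiv ℝ (Lf d) y (v, 0) =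
    (d.N * (d.p1 y.2 * v.1 + d.p2 y.2 * v.2)) • ev 0 +
      ((d.p1 y.2 * v.1 + d.p2 y.2 * v.2) • ev 1 + (d.w1 y.2 * v.1 + d.w2 y.2 * v.2) • ev 2) := by
  have h1 := line_lin d.p1 d.p2 y v
  have h2 := line_lin d.w1 d.w2 y v
  have h0 : HasDerivAt (fun τ : ℝ => (y + τ • ((v, 0) : S)).2) 0 0 := by
    simpa using hasDerivAt_const (0:ℝ) y.2
  rw [fderiv_eq_of_line (sm_Lf d) (h0.prodMk ((h1.const_mul d.N).prodMk (h1.prodMk h2)))]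
  simp [ev]

theorem fderiv_Lf_time (d : LD) (y : S) :
    fderiv ℝ (Lf d) y eS = eT + ((d.N * (deriv d.p1 y.2 * y.1.1 + deriv d.p2 y.2 * y.1.2)) • ev 0 +
      ((deriv d.p1 y.2 * y.1.1 + deriv d.p2 y.2 * y.1.2) • ev 1 +
        (deriv d.w1 y.2 * y.1.1 + deriv d.w2 y.2 * y.1.2) • ev 2)) := by
  have h1 := line_time (y := y) (d.sp1.diff y.2).hasDerivAt (d.sp2.diff y.2).hasDerivAt
  have h2 := line_time (y := y) (d.sw1.diff y.2).hasDerivAt (d.sw2.diff y.2).hasDerivAt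
  have h0 : HasDerivAt (fun τ : ℝ => (y + τ • eS).2) 1 0 := by
    simpa [eS] using (hasDerivAt_id (0:ℝ)).const_add y.2
  rw [fderiv_eq_of_line (sm_Lf d) (h0.prodMk ((h1.const_mul d.N).prodMk (h1.prodMk h2)))]
  simp [ev, eT]

theorem LD.N_pos (d : LD) : 0 < d.N := zero_lt_one.trans_le d.hN

theorem dd_lift (d : LD) {f : Z → ℝ} (hf : Sm f) (v : ℝ × ℝ) (y : S) :
    dd (v, 0) (fun y => f (Lf d y)) y =
      d.N * (v.1 * X1 d f (Lf d y) + v.2 * X2 d f (Lf d y)) := by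
  rw [dd_comp hf (sm_Lf d), fderiv_Lf]
  simp only [dd_vec_add, dd_vec_smul, X1, X2, Xo, Lf]
  have := d.N_pos.ne'
  field_simp
  ring

theorem dd_e1_lift (d : LD) {f : Z → ℝ} (hf : Sm f) :
    dd e1 (fun y => f (Lf d y)) = fun y => d.N * X1 d f (Lf d y) := by
  funext y; rw [e1, dd_lift d hf]; ring

theorem dd_e2_lift (d : LD) {f : Z → ℝ} (hf : Sm f) :
    dd e2 (fun y => f (Lf d y)) = fun y => d.N * X2 d f (Lf d y) := by
  funext y; rw [e2, dd_lift d hf]; ring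

theorem material_lift (d : LD) {f : Z → ℝ} (hf : Sm f) (y : S) :
    dd eS (fun y => f (Lf d y)) y
      + (d.al y.2 * y.1.1 + d.be y.2 * y.1.2) * dd e1 (fun y => f (Lf d y)) y
      + (d.et y.2 * y.1.1 - d.al y.2 * y.1.2) * dd e2 (fun y => f (Lf d y)) y =
      dd eT f (Lf d y) := by
  rw [dd_e1_lift d hf, dd_e2_lift d hf, dd_comp hf (sm_Lf d), fderiv_Lf_time]
  simp only [dd_vec_add, dd_vec_smul, X1, X2, Xo, (d.dp1 y.2).deriv, (d.dp2 y.2).deriv,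
    (d.dw1 y.2).deriv, (d.dw2 y.2).deriv]
  have := d.N_pos.ne'
  have hL : (Lf d y).1 = y.2 := rfl
  rw [hL]
  field_simp
  ring

theorem sm_X1 (d : LD) {f : Z → ℝ} (hf : Sm f) : Sm (X1 d f) := sm_Xo d.sp1 d.sw1 hf
theorem sm_X2 (d : LD) {f : Z → ℝ} (hf : Sm f) : Sm (X2 d f) := sm_Xo d.sp2 d.sw2 hf

/-- The spatial Laplacian. -/
noncomputable def lapl (φ : S → ℝ) : S → ℝ := fun y => dd e1 (dd e1 φ) y + dd e2 (dd e2 φ) y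

theorem Sm.lapl {φ : S → ℝ} (h : Sm φ) : Sm (_root_.lapl φ) := ((h.dd _).dd _).add ((h.dd _).dd _)

/-- The nonlinear operator of the stream function formulation. -/
noncomputable def NN (φ : S → ℝ) : S → ℝ := fun y => dd eS (lapl φ) y
  + dd e1 (dd e2 φ) y * dd e1 (lapl φ) y - dd e1 (dd e1 φ) y * dd e2 (lapl φ) y

theorem Sm.NN {φ : S → ℝ} (h : Sm φ) : Sm (_root_.NN φ) :=
  ((h.lapl.dd _).add (((h.dd _).dd _).mul (h.lapl.dd _))).sub (((h.dd _).dd _).mul (h.lapl.dd _))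

theorem lapl_add {φ ψ : S → ℝ} (hφ : Sm φ) (hψ : Sm ψ) :
    lapl (fun y => φ y + ψ y) = fun y => lapl φ y + lapl ψ y := by
  funext y
  simp only [lapl, dd_add _ hφ hψ, dd_add _ (hφ.dd _) (hψ.dd _)]; ring

theorem NN_add {φ ψ : S → ℝ} (hφ : Sm φ) (hψ : Sm ψ) (y : S) :
    NN (fun y => φ y + ψ y) y - NN φ y = dd eS (lapl ψ) y
      + dd e1 (dd e2 φ) y * dd e1 (lapl ψ) y - dd e1 (dd e1 φ) y * dd e2 (lapl ψ) y
      + (dd e1 (dd e2 ψ) y * dd e1 (lapl φ) y - dd e1 (dd e1 ψ) y * dd e2 (lapl φ) y)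
      + (dd e1 (dd e2 ψ) y * dd e1 (lapl ψ) y - dd e1 (dd e1 ψ) y * dd e2 (lapl ψ) y) := by
  simp only [NN, lapl_add hφ hψ, dd_add _ hφ hψ, dd_add _ (hφ.dd _) (hψ.dd _),
    dd_add _ hφ.lapl hψ.lapl]
  ring

theorem dd_scaled_lift (d : LD) (c : ℝ) {f : Z → ℝ} (hf : Sm f) :
    dd e1 (fun y => c * f (Lf d y)) = (fun y => c * d.N * X1 d f (Lf d y)) ∧
    dd e2 (fun y => c * f (Lf d y)) = fun y => c * d.N * X2 d f (Lf d y) := by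
  have hs : Sm (fun y => f (Lf d y)) := hf.comp (sm_Lf d)
  constructor
  · rw [dd_const_mul _ _ hs, dd_e1_lift d hf]; funext y; ring
  · rw [dd_const_mul _ _ hs, dd_e2_lift d hf]; funext y; ring

theorem lapl_scaled_lift (d : LD) (c : ℝ) {f : Z → ℝ} (hf : Sm f) :
    lapl (fun y => c * f (Lf d y)) = fun y => c * d.N * d.N * Dop d f (Lf d y) := by
  funext y
  rw [lapl, (dd_scaled_lift d c hf).1, (dd_scaled_lift d c hf).2,
    (dd_scaled_lift d _ (sm_X1 d hf)).1, (dd_scaled_lift d _ (sm_X2 d hf)).2, Dop_eq d hf]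
  ring

/-- The stream function of a layer. -/
noncomputable def lay (d : LD) (Φ : Z → ℝ) : S → ℝ := fun y => d.N⁻¹ ^ 3 * Φ (Lf d y)

theorem sm_lay (d : LD) {Φ : Z → ℝ} (hf : Sm Φ) : Sm (lay d Φ) :=
  contDiff_const.mul (hf.comp (sm_Lf d))

theorem sm_Dop (d : LD) {U : Z → ℝ} (hU : Sm U) : Sm (Dop d U) := by
  rw [show Dop d U = fun z => X1 d (X1 d U) z + X2 d (X2 d U) z from funext (Dop_eq d hU)]
  exact (sm_X1 d (sm_X1 d hU)).add (sm_X2 d (sm_X2 d hU))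

theorem lay_d11 (d : LD) {Φ : Z → ℝ} (hf : Sm Φ) (y : S) :
    dd e1 (dd e1 (lay d Φ)) y = d.N⁻¹ * X1 d (X1 d Φ) (Lf d y) := by
  unfold lay
  rw [(dd_scaled_lift d _ hf).1, (dd_scaled_lift d _ (sm_X1 d hf)).1]
  have := d.N_pos.ne'
  field_simp

theorem lay_d12 (d : LD) {Φ : Z → ℝ} (hf : Sm Φ) (y : S) :
    dd e1 (dd e2 (lay d Φ)) y = d.N⁻¹ * X1 d (X2 d Φ) (Lf d y) := by
  unfold lay
  rw [(dd_scaled_lift d _ hf).2, (dd_scaled_lift d _ (sm_X2 d hf)).1]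
  have := d.N_pos.ne'
  field_simp

theorem lay_lapl (d : LD) {Φ : Z → ℝ} (hf : Sm Φ) :
    lapl (lay d Φ) = fun y => d.N⁻¹ * Dop d Φ (Lf d y) := by
  unfold lay
  rw [lapl_scaled_lift d _ hf]
  have := d.N_pos.ne'
  funext y
  field_simp

theorem NN_lay (d : LD) {φ : S → ℝ} {Φ : Z → ℝ} (hφ : Sm φ) (hΦ : Sm Φ) (y : S)
    (h12 : dd e1 (dd e2 φ) y = d.al y.2 * y.1.1 + d.be y.2 * y.1.2)
    (h11 : dd e1 (dd e1 φ) y = -(d.et y.2 * y.1.1 - d.al y.2 * y.1.2))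
    (hg1 : dd e1 (lapl φ) y = d.g1 y.2) (hg2 : dd e2 (lapl φ) y = d.g2 y.2) :
    NN (fun y => φ y + lay d Φ y) y - NN φ y = d.N⁻¹ * Res d Φ (Lf d y) := by
  have sD := sm_Dop d hΦ
  have hmat := material_lift d sD y
  have sDL : Sm (fun y => Dop d Φ (Lf d y)) := sD.comp (sm_Lf d)
  have hN := d.N_pos.ne'
  rw [NN_add hφ (sm_lay d hΦ), h12, h11, hg1, hg2, lay_d11 d hΦ, lay_d12 d hΦ, lay_lapl d hΦ,
    (dd_scaled_lift d _ sD).1, (dd_scaled_lift d _ sD).2,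
    dd_const_mul _ _ sDL]
  rw [dd_e1_lift d sD, dd_e2_lift d sD] at hmat
  have hc : X1 d (X2 d Φ) (Lf d y) = X2 d (X1 d Φ) (Lf d y) := by
    have e5 := Xo_Xo (δ := d.N⁻¹) (c := d.p1) (e := d.w1) d.sp2 d.sw2 hΦ (Lf d y)
    have e6 := Xo_Xo (δ := d.N⁻¹) (c := d.p2) (e := d.w2) d.sp1 d.sw1 hΦ (Lf d y)
    rw [X1, X2, e5, e6]
    simp only [OpS]; ring
  simp only [Res]
  rw [← hmat, ← hc]
  have hL : (Lf d y).1 = y.2 := rfl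
  rw [hL]
  field_simp
  ring

theorem NN_lay_zero {φ ψ : S → ℝ} (hφ : Sm φ) (hψ : Sm ψ) {U : Set S} (hU : IsOpen U)
    (h : ∀ y ∈ U, ψ y = 0) : ∀ y ∈ U, NN (fun y => φ y + ψ y) y - NN φ y = 0 := by
  intro y hy
  have d1 : ∀ v w : S, ∀ y ∈ U, dd v (dd w ψ) y = 0 := fun v w =>
    dd_zero_on hU v (dd_zero_on hU w h)
  have d2 : ∀ y ∈ U, lapl ψ y = 0 := fun y hy => by rw [lapl, d1 _ _ y hy, d1 _ _ y hy, add_zero]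
  have d3 : ∀ v : S, ∀ y ∈ U, dd v (lapl ψ) y = 0 := fun v => dd_zero_on hU v d2
  rw [NN_add hφ hψ, d3 _ y hy, d3 _ y hy, d3 _ y hy, d1 _ _ y hy, d1 _ _ y hy]
  ring

end Lift

section LayerBounds

/-- Smooth profiles with all derivatives of order `N^{-j}`. -/
def Cw (j : ℕ) (f : LD → Z → ℝ) : Prop := (∀ d, Sm (f d)) ∧ ∀ l, B1 l j f

theorem Cl.cw {j : ℕ} {f : LD → Z → ℝ} (h : Cl j f) : Cw j f := ⟨fun d => (h.1 d).sm, h.2⟩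

theorem Cw.add {j : ℕ} {f g : LD → Z → ℝ} (hf : Cw j f) (hg : Cw j g) :
    Cw j (fun d z => f d z + g d z) :=
  ⟨fun d => (hf.1 d).add (hg.1 d), fun l => (hf.2 l).congr_add (hg.2 l) fun d z => by
    rw [wd_add l (hf.1 d) (hg.1 d)]⟩

theorem Cw.dd {j : ℕ} {f : LD → Z → ℝ} (hf : Cw j f) (k : Fin 3) :
    Cw j (fun d => dd (ev k) (f d)) :=
  ⟨fun d => (hf.1 d).dd _, fun l => hf.2 (k :: l)⟩

theorem Cw.cmul {j : ℕ} {c : LD → ℝ → ℝ} {f : LD → Z → ℝ} (hc : Cf c) (hf : Cw j f) :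
    Cw j (fun d z => c d z.1 * f d z) := by
  refine ⟨fun d => (sm_time (hc.1 d)).mul (hf.1 d), fun l => ?_⟩
  obtain ⟨C, p, hC, h1⟩ := hc.2
  obtain ⟨D, q, hD, h2⟩ := hf.2 l
  refine ⟨C * D, p + q, by positivity, fun d z hz => ?_⟩
  have h0 := (abs_nonneg _).trans (h1 d z.1 hz)
  rw [wd_smul_time (hc.1 d) l (hf.1 d), abs_mul]
  refine (mul_le_mul (h1 d _ hz) (h2 d z hz) (abs_nonneg _) h0).trans_eq ?_
  ring

theorem Cf.inv_N : Cf (fun d _ => d.N⁻¹) :=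
  ⟨fun _ => contDiff_const, 1, 0, zero_le_one, fun d t _ => by
    simpa [abs_of_nonneg d.inv_pos] using d.inv_le⟩

theorem Cw.X1 {j : ℕ} {f : LD → Z → ℝ} (hf : Cw j f) : Cw j (fun d => X1 d (f d)) :=
  (Cw.cmul TCf.p1.1 (hf.dd 0)).add
    (Cw.cmul Cf.inv_N ((Cw.cmul TCf.p1.1 (hf.dd 1)).add (Cw.cmul TCf.w1.1 (hf.dd 2))))

theorem Cw.X2 {j : ℕ} {f : LD → Z → ℝ} (hf : Cw j f) : Cw j (fun d => X2 d (f d)) :=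
  (Cw.cmul TCf.p2.1 (hf.dd 0)).add
    (Cw.cmul Cf.inv_N ((Cw.cmul TCf.p2.1 (hf.dd 1)).add (Cw.cmul TCf.w2.1 (hf.dd 2))))

/-- Iterated spatial derivative on space-time. -/
noncomputable def Sp (i j : ℕ) (f : S → ℝ) : S → ℝ := (dd e1)^[i] ((dd e2)^[j] f)

theorem Sp_succ (i j : ℕ) (f : S → ℝ) : Sp (i + 1) j f = dd e1 (Sp i j f) :=
  Function.iterate_succ_apply' _ _ _

theorem Sp_zero_succ (j : ℕ) (f : S → ℝ) : Sp 0 (j + 1) f = dd e2 (Sp 0 j f) :=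
  Function.iterate_succ_apply' _ _ _

theorem sm_Sp (i j : ℕ) {f : S → ℝ} (hf : Sm f) : Sm (Sp i j f) := by
  induction i with
  | zero =>
    induction j with
    | zero => exact hf
    | succ j ih => rw [Sp_zero_succ]; exact ih.dd _
  | succ i ih => rw [Sp_succ]; exact ih.dd _

theorem dd_slice {f : S → ℝ} (hf : Sm f) (t : ℝ) (v : ℝ × ℝ) :
    dd v (fun x => f (x, t)) = fun x => dd (v, 0) f (x, t) := by
  funext x
  have hL : Sm (fun x : ℝ × ℝ => ((x, t) : S)) := contDiff_id.prodMk contDiff_const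
  rw [dd_comp hf hL]
  congr 1
  have h : HasFDerivAt (fun x : ℝ × ℝ => ((x, t) : S)) (ContinuousLinearMap.inl ℝ (ℝ × ℝ) ℝ) x :=
    hasFDerivAt_prodMk_left x t
  rw [h.fderiv]
  rfl

theorem pdMix_slice {f : S → ℝ} (hf : Sm f) (t : ℝ) (i j : ℕ) :
    pdMix i j (fun x => f (x, t)) = fun x => Sp i j f (x, t) := by
  have h1 : ∀ g : S → ℝ, Sm g → pd1 (fun x => g (x, t)) = fun x => dd e1 g (x, t) :=
    fun g hg => dd_slice hg t (1, 0)
  have h2 : ∀ g : S → ℝ, Sm g → pd2 (fun x => g (x, t)) = fun x => dd e2 g (x, t) :=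
    fun g hg => dd_slice hg t (0, 1)
  induction i with
  | zero =>
    induction j with
    | zero => rfl
    | succ j ih =>
      have : pdMix 0 (j + 1) (fun x => f (x, t)) = pd2 (pdMix 0 j (fun x => f (x, t))) :=
        Function.iterate_succ_apply' _ _ _
      rw [this, ih, h2 _ (sm_Sp _ _ hf), Sp_zero_succ]
  | succ i ih =>
    have : pdMix (i + 1) j (fun x => f (x, t)) = pd1 (pdMix i j (fun x => f (x, t))) :=
      Function.iterate_succ_apply' _ _ _
    rw [this, ih, h1 _ (sm_Sp _ _ hf), Sp_succ]

theorem Sp_add (i j : ℕ) {f g : S → ℝ} (hf : Sm f) (hg : Sm g) :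
    Sp i j (fun y => f y + g y) = fun y => Sp i j f y + Sp i j g y := by
  induction i with
  | zero =>
    induction j with
    | zero => rfl
    | succ j ih =>
      rw [Sp_zero_succ, ih, dd_add _ (sm_Sp _ _ hf) (sm_Sp _ _ hg), Sp_zero_succ, Sp_zero_succ]
  | succ i ih =>
    rw [Sp_succ, ih, dd_add _ (sm_Sp _ _ hf) (sm_Sp _ _ hg), Sp_succ, Sp_succ]

theorem dd_time_coef {c : ℝ → ℝ} (hc : Sm c) {f : S → ℝ} (hf : Sm f) (v : ℝ × ℝ) :
    dd (v, 0) (fun y : S => c y.2 * f y) = fun y => c y.2 * dd (v, 0) f y := by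
  have h1 : Sm (fun y : S => c y.2) := hc.comp contDiff_snd
  have h2 : ∀ y : S, dd (v, 0) (fun y : S => c y.2) y = 0 := fun y => by
    have := (hc.diff y.2).hasDerivAt.comp_hasFDerivAt y (hasFDerivAt_snd (𝕜 := ℝ) (p := y))
    refine (dd_eq_of_hasFDerivAt this _).trans ?_
    simp
  rw [dd_mul _ h1 hf]
  funext y
  rw [h2]; ring

theorem Sp_time_coef {c : ℝ → ℝ} (hc : Sm c) {f : S → ℝ} (hf : Sm f) (i j : ℕ) :
    Sp i j (fun y : S => c y.2 * f y) = fun y => c y.2 * Sp i j f y := by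
  induction i with
  | zero =>
    induction j with
    | zero => rfl
    | succ j ih => rw [Sp_zero_succ, ih, e2, dd_time_coef hc (sm_Sp _ _ hf), Sp_zero_succ]; rfl
  | succ i ih => rw [Sp_succ, ih, e1, dd_time_coef hc (sm_Sp _ _ hf), Sp_succ]; rfl

theorem Sp_lift {J : ℕ} {f : LD → Z → ℝ} (hf : Cw J f) (i j : ℕ) : ∃ K, Cw J K ∧
    ∀ d, Sp i j (fun y => f d (Lf d y)) = fun y => d.N ^ (i + j) * K d (Lf d y) := by
  induction i with
  | zero =>
    induction j with
    | zero => exact ⟨f, hf, fun d => by simp [Sp]⟩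
    | succ j ih =>
      obtain ⟨K, hK, h⟩ := ih
      refine ⟨_, hK.X2, fun d => ?_⟩
      rw [Sp_zero_succ, h, (dd_scaled_lift d _ (hK.1 d)).2]
      funext y; ring
  | succ i ih =>
    obtain ⟨K, hK, h⟩ := ih
    refine ⟨_, hK.X1, fun d => ?_⟩
    rw [Sp_succ, h, (dd_scaled_lift d _ (hK.1 d)).1]
    funext y; ring

theorem Sp_lift_slow {f : LD → Z → ℝ} (hf : Cw 0 f) (h0 : ∀ d, dd (ev 0) (f d) = fun _ => 0)
    (i j : ℕ) : ∃ K, Cw 0 K ∧ (∀ d, dd (ev 0) (K d) = fun _ => 0) ∧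
      ∀ d, Sp i j (fun y => f d (Lf d y)) = fun y => K d (Lf d y) := by
  have key : ∀ {c e : LD → ℝ → ℝ} (hc : Cf c) (he : Cf e) {K : LD → Z → ℝ}, Cw 0 K →
      (∀ d, dd (ev 0) (K d) = fun _ => 0) → ∃ K', Cw 0 K' ∧ (∀ d, dd (ev 0) (K' d) = fun _ => 0) ∧
        ∀ d z, d.N * Xo d.N⁻¹ (c d) (e d) (K d) z = K' d z := by
    intro c e hc he K hK h
    have hK' := (Cw.cmul hc (hK.dd 1)).add (Cw.cmul he (hK.dd 2))
    refine ⟨_, hK', fun d => ?_, fun d z => ?_⟩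
    · rw [dd_add _ ((sm_time (hc.1 d)).mul ((hK.1 d).dd _)) ((sm_time (he.1 d)).mul ((hK.1 d).dd _)),
        dd_smul_time (hc.1 d) _ ((hK.1 d).dd _), dd_smul_time (he.1 d) _ ((hK.1 d).dd _),
        dd_comm _ _ (hK.1 d), dd_comm (ev 0) (ev 2) (hK.1 d), h]
      funext z; simp [dd_const]
    · simp only [Xo, h]
      have := d.N_pos.ne'
      field_simp
      ring
  induction i with
  | zero =>
    induction j with
    | zero => exact ⟨f, hf, h0, fun d => rfl⟩
    | succ j ih =>
      obtain ⟨K, hK, hK0, h⟩ := ih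
      obtain ⟨K', a, b, c⟩ := key TCf.p2.1 TCf.w2.1 hK hK0
      refine ⟨K', a, b, fun d => ?_⟩
      rw [Sp_zero_succ, h, dd_e2_lift d (hK.1 d)]
      funext y; exact c d _
  | succ i ih =>
    obtain ⟨K, hK, hK0, h⟩ := ih
    obtain ⟨K', a, b, c⟩ := key TCf.p1.1 TCf.w1.1 hK hK0
    refine ⟨K', a, b, fun d => ?_⟩
    rw [Sp_succ, h, dd_e1_lift d (hK.1 d)]
    funext y; exact c d _

theorem Cw.lift_bound {J : ℕ} {K : LD → Z → ℝ} (hK : Cw J K) : ∃ (C : ℝ) (q : ℕ), 0 ≤ C ∧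
    ∀ d, ∀ y : S, y.2 ∈ Set.Icc d.t0 1 → |K d (Lf d y)| ≤ C * d.lam ^ q * d.N⁻¹ ^ J := by
  obtain ⟨C, q, hC, h⟩ := hK.2 []
  exact ⟨C, q, hC, fun d y hy => h d _ hy⟩

/-- The forcing generated by a layer with error profile `E` and density profile `W`. -/
noncomputable def FF (d : LD) (W E : Z → ℝ) : S → ℝ := fun y =>
  d.N⁻¹ * ((d.G y.2 * deriv d.ze y.2) * tp (fun _ => 1) wv ch ch (Lf d y) +
    ((d.G y.2 * E (Lf d y)) + (-d.G y.2) * Mn (dd eT W) (Lf d y)))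

theorem Cw_tp_one : Cw 0 (fun _ => tp (fun _ => 1) wv ch ch) :=
  ⟨fun _ => sm_tp contDiff_const sm_wv sm_ch sm_ch, B1_tp (Cf.const 1)⟩

theorem pow_inv_le {N : ℝ} (hN : 1 ≤ N) {a b c : ℕ} (h : a + c ≤ b) :
    N ^ a * N⁻¹ ^ b ≤ N⁻¹ ^ c := by
  have h0 : 0 < N := by linarith
  rw [inv_pow, inv_pow, ← div_eq_mul_inv, div_le_iff₀ (by positivity), inv_mul_eq_div,
    le_div_iff₀ (by positivity), ← pow_add]
  exact pow_le_pow_right₀ hN h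

theorem FF_bound {W E : LD → Z → ℝ} {m : ℕ} (hW : TCl 0 W) (hE : Cl (m + 1) E) (i j : ℕ)
    (hij : i + j ≤ m) : ∃ (C : ℝ) (q : ℕ), 0 ≤ C ∧ ∀ d : LD,
      (∀ t ∈ Set.Icc d.t0 1, |d.G t * deriv d.ze t| ≤ d.N⁻¹ ^ m) →
      ∀ y : S, y.2 ∈ Set.Icc d.t0 1 → |Sp i j (FF d (W d) (E d)) y| ≤ C * d.lam ^ q * d.N⁻¹ := by
  have hM : Cl 0 (fun d => Mn (dd eT (W d))) := hW.2.Mn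
  obtain ⟨K1, hK1, h1⟩ := Sp_lift Cw_tp_one i j
  obtain ⟨K2, hK2, h2⟩ := Sp_lift hE.cw i j
  obtain ⟨K3, hK3, -, h3⟩ := Sp_lift_slow hM.cw
    (fun d => dd_Mn ((hW.2.1 d).sm) (hW.2.1 d).per) i j
  obtain ⟨C1, q1, c1, b1⟩ := hK1.lift_bound
  obtain ⟨C2, q2, c2, b2⟩ := hK2.lift_bound
  obtain ⟨C3, q3, c3, b3⟩ := hK3.lift_bound
  refine ⟨C1 + (C2 + C3), q1 + ((q2 + 1) + (q3 + 1)), by positivity, fun d hd y hy => ?_⟩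
  have s1 : Sm (fun y => tp (fun _ => 1) wv ch ch (Lf d y)) :=
    (Cw_tp_one.1 d).comp (sm_Lf d)
  have s2 : Sm (fun y => E d (Lf d y)) := (hE.1 d).sm.comp (sm_Lf d)
  have s3 : Sm (fun y => Mn (dd eT (W d)) (Lf d y)) := (hM.1 d).sm.comp (sm_Lf d)
  have a1 : Sm (fun t => d.G t * deriv d.ze t) := d.sG.mul d.sze.deriv
  have a3 : Sm (fun t => - d.G t) := d.sG.neg
  have u1 : Sm (fun y : S => (d.G y.2 * deriv d.ze y.2) * tp (fun _ => 1) wv ch ch (Lf d y)) :=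
    (a1.comp contDiff_snd).mul s1
  have u2 : Sm (fun y : S => d.G y.2 * E d (Lf d y)) := (d.sG.comp contDiff_snd).mul s2
  have u3 : Sm (fun y : S => (-d.G y.2) * Mn (dd eT (W d)) (Lf d y)) := (a3.comp contDiff_snd).mul s3
  have e : Sp i j (FF d (W d) (E d)) y = d.N⁻¹ * ((d.G y.2 * deriv d.ze y.2) *
      (d.N ^ (i + j) * K1 d (Lf d y)) + (d.G y.2 * (d.N ^ (i + j) * K2 d (Lf d y)) +
        (- d.G y.2) * K3 d (Lf d y))) := by
    unfold FF
    rw [Sp_time_coef (c := fun _ => d.N⁻¹) contDiff_const (u1.add (u2.add u3)),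
      Sp_add i j u1 (u2.add u3), Sp_add i j u2 u3, Sp_time_coef a1 s1, Sp_time_coef d.sG s2,
      Sp_time_coef a3 s3, h1, h2, h3]
  have hN := d.N_pos
  have hl := d.hlam
  have hG := d.bG _ hy
  have G1 : |(d.G y.2 * deriv d.ze y.2) * (d.N ^ (i + j) * K1 d (Lf d y))| ≤ C1 * d.lam ^ q1 := by
    have hb := b1 d y hy
    rw [pow_zero, mul_one] at hb
    rw [abs_mul (d.G y.2 * deriv d.ze y.2), abs_mul (d.N ^ (i + j)), abs_of_pos (pow_pos hN (i + j))]
    have := pow_inv_le d.hN (a := i + j) (b := m) (c := 0) (by omega)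
    rw [pow_zero] at this
    calc _ ≤ d.N⁻¹ ^ m * (d.N ^ (i + j) * (C1 * d.lam ^ q1)) := by
          gcongr
          exact hd _ hy
      _ = (d.N ^ (i + j) * d.N⁻¹ ^ m) * (C1 * d.lam ^ q1) := by ring
      _ ≤ 1 * (C1 * d.lam ^ q1) := by gcongr
      _ = _ := one_mul _
  have G2 : |d.G y.2 * (d.N ^ (i + j) * K2 d (Lf d y))| ≤ C2 * d.lam ^ (q2 + 1) := by
    have hb := b2 d y hy
    rw [abs_mul, abs_mul, abs_of_pos (pow_pos hN (i + j))]
    have := pow_inv_le d.hN (a := i + j) (b := m + 1) (c := 0) (by omega)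
    rw [pow_zero] at this
    calc _ ≤ d.lam * (d.N ^ (i + j) * (C2 * d.lam ^ q2 * d.N⁻¹ ^ (m + 1))) := by gcongr
      _ = (d.N ^ (i + j) * d.N⁻¹ ^ (m + 1)) * (C2 * d.lam ^ (q2 + 1)) := by ring
      _ ≤ 1 * (C2 * d.lam ^ (q2 + 1)) := by gcongr
      _ = _ := one_mul _
  have G3 : |(- d.G y.2) * K3 d (Lf d y)| ≤ C3 * d.lam ^ (q3 + 1) := by
    have hb := b3 d y hy
    rw [pow_zero, mul_one] at hb
    rw [abs_mul, abs_neg]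
    calc _ ≤ d.lam * (C3 * d.lam ^ q3) := by gcongr
      _ = _ := by ring
  rw [e, abs_mul, abs_of_nonneg d.inv_pos, mul_comm _ d.N⁻¹]
  refine mul_le_mul_of_nonneg_left ?_ d.inv_pos
  refine (abs_add_le _ _).trans ((add_le_add G1 ((abs_add_le _ _).trans (add_le_add G2 G3))).trans ?_)
  exact (add_le_add le_rfl (pow_bd hl c2 c3 _ _)).trans (pow_bd hl c1 (by positivity) _ _)

end LayerBounds

section LayerSummary

/-- The region of space-time where a layer vanishes. -/
def offSet (d : LD) : Set S := {y | y.2 < d.t1 ∨ 3 / 4 < |d.p1 y.2 * y.1.1 + d.p2 y.2 * y.1.2| ∨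
  3 / 4 < |d.w1 y.2 * y.1.1 + d.w2 y.2 * y.1.2|}

theorem isOpen_offSet (d : LD) : IsOpen (offSet d) := by
  have h1 : Continuous fun y : S => |d.p1 y.2 * y.1.1 + d.p2 y.2 * y.1.2| :=
    (sm_lin d.sp1 d.sp2).continuous.abs
  have h2 : Continuous fun y : S => |d.w1 y.2 * y.1.1 + d.w2 y.2 * y.1.2| :=
    (sm_lin d.sw1 d.sw2).continuous.abs
  exact (isOpen_lt continuous_snd continuous_const).union
    ((isOpen_lt continuous_const h1).union (isOpen_lt continuous_const h2))

/-- First and second order data of a stream function at a point: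
`∂₁₁φ, ∂₁₂φ, ∂₁Δφ, ∂₂Δφ`. -/
def Jet (φ : S → ℝ) (y : S) (h11 h12 k1 k2 : ℝ) : Prop :=
  dd e1 (dd e1 φ) y = h11 ∧ dd e1 (dd e2 φ) y = h12 ∧
    dd e1 (lapl φ) y = k1 ∧ dd e2 (lapl φ) y = k2

theorem Jet.add {φ ψ : S → ℝ} (hφ : Sm φ) (hψ : Sm ψ) {y : S} {a b c d a' b' c' d' : ℝ}
    (h : Jet φ y a b c d) (h' : Jet ψ y a' b' c' d') :
    Jet (fun y => φ y + ψ y) y (a + a') (b + b') (c + c') (d + d') := by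
  simp only [Jet, lapl_add hφ hψ, dd_add _ hφ hψ, dd_add _ (hφ.dd _) (hψ.dd _),
    dd_add _ hφ.lapl hψ.lapl]
  exact ⟨by rw [h.1, h'.1], by rw [h.2.1, h'.2.1], by rw [h.2.2.1, h'.2.2.1],
    by rw [h.2.2.2, h'.2.2.2]⟩

theorem Jet.congr {φ : S → ℝ} {y : S} {a b c d a' b' c' d' : ℝ} (h : Jet φ y a b c d)
    (ha : a = a') (hb : b = b') (hc : c = c') (hd : d = d') : Jet φ y a' b' c' d' := by
  subst ha hb hc hd; exact h

theorem Ph_zero {d : LD} {W : Z → ℝ} {z : Z} (h : ∀ s : ℝ, W (z + s • ev 0) = 0) :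
    Ph d W z = 0 := by
  have : JJ (JJ W) z = 0 := by
    refine Av_zero fun s => Av_zero fun s' => ?_
    rw [add_assoc, ← add_smul]; exact h _
  rw [Ph, this, mul_zero, mul_zero]

theorem Mn_congr {f g : Z → ℝ} {z : Z} (h : ∀ s : ℝ, f (z + s • ev 0) = g (z + s • ev 0)) :
    Mn f z = Mn g z := by
  simp only [Mn, Av, h]

theorem dd_wv {x : ℝ} (hx : |x| < 1 / 16) : deriv wv x = 1 := by
  have : wv =ᶠ[nhds x] fun y => y :=
    eventuallyEq_of_mem ((isOpen_lt continuous_abs continuous_const).mem_nhds hx)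
      fun y hy => wv_eq (le_of_lt hy)
  rw [this.deriv_eq, deriv_id'']

theorem X_flat {d : LD} {f : Z → ℝ} (hf : Good d f) {z : Z} (hz : z ∈ flatSet) :
    X1 d f z = d.p1 z.1 * dd (ev 0) f z ∧ X2 d f z = d.p2 z.1 * dd (ev 0) f z := by
  constructor <;> simp [X1, X2, Xo, hf.flat1 z hz, hf.flat2 z hz]

theorem XX_flat {d : LD} {f : Z → ℝ} (hf : Good d f) {z : Z} (hz : z ∈ flatSet) :
    X1 d (X1 d f) z = d.p1 z.1 * d.p1 z.1 * dd (ev 0) (dd (ev 0) f) z ∧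
      X1 d (X2 d f) z = d.p1 z.1 * d.p2 z.1 * dd (ev 0) (dd (ev 0) f) z := by
  constructor
  · rw [X1, Xo_Xo d.sp1 d.sw1 hf.sm, hf.OpS_zero _ _ _ _ _ _ z hz, add_zero]
  · rw [X1, X2, Xo_Xo d.sp2 d.sw2 hf.sm, hf.OpS_zero _ _ _ _ _ _ z hz, add_zero]

theorem lay_jet (d : LD) {W : Z → ℝ} (hW : Good d W) (h : ∀ z ∈ flatSet, W z = prof d z) {y : S}
    (hf : Lf d y ∈ flatSet) :
    Jet (lay d (Ph d W)) y
      (d.N⁻¹ * (d.p1 y.2 * d.p1 y.2 * (d.G y.2 * d.r y.2 * prof d (Lf d y))))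
      (d.N⁻¹ * (d.p1 y.2 * d.p2 y.2 * (d.G y.2 * d.r y.2 * prof d (Lf d y))))
      (d.p1 y.2 * (d.G y.2 * dd (ev 0) (prof d) (Lf d y)))
      (d.p2 y.2 * (d.G y.2 * dd (ev 0) (prof d) (Lf d y))) := by
  have hsr : Sm (fun t => d.G t * d.r t) := d.sG.mul d.sr
  have hP : Good d (Ph d W) := by rw [Ph_eq]; exact hW.JJ.JJ.cmul hsr
  have hMn : ∀ z ∈ flatSet, Mn W z = 0 := fun z hz => by
    rw [Mn_congr fun s => h _ (flat_shift hz s), prof, Mn_tp]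
  have h00 : dd (ev 0) (dd (ev 0) (Ph d W)) (Lf d y) = d.G y.2 * d.r y.2 * prof d (Lf d y) := by
    have h2 := dd_dd_JJ hW.sm hW.per
    rw [Ph_eq, dd_smul_time hsr _ hW.JJ.JJ.sm, dd_smul_time hsr _ (hW.JJ.JJ.dd _).sm, h2]
    change (fun t => d.G t * d.r t) y.2 * (W (Lf d y) - Mn W (Lf d y)) = _
    rw [hMn _ hf, h _ hf, sub_zero]
  have hD := Dop_Ph d hW.sm hW.per
  have hDs : Sm (Dop d (Ph d W)) := sm_Dop d hP.sm
  have hDe : ∀ z ∈ flatSet, Dop d (Ph d W) z = d.G z.1 * prof d z := fun z hz => by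
    rw [hD]; simp only [h z hz, hMn z hz, hW.Kop_zero z hz]; ring
  have hp : Good d (prof d) := Good_tp d d.sze d.ze0
  have hv : ∀ v, dd v (Dop d (Ph d W)) (Lf d y) = dd v (fun z => d.G z.1 * prof d z) (Lf d y) :=
    fun v => dd_eqOn isOpen_flatSet v hDe _ hf
  have hg := hp.cmul d.sG
  have hX : X1 d (Dop d (Ph d W)) (Lf d y) = d.p1 y.2 * (d.G y.2 * dd (ev 0) (prof d) (Lf d y)) ∧
      X2 d (Dop d (Ph d W)) (Lf d y) = d.p2 y.2 * (d.G y.2 * dd (ev 0) (prof d) (Lf d y)) := by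
    have := X_flat hg hf
    rw [dd_smul_time d.sG _ hp.sm] at this
    simp only [X1, X2, Xo, hv]
    exact this
  have := d.N_pos.ne'
  refine ⟨?_, ?_, ?_, ?_⟩
  · rw [lay_d11 d hP.sm, (XX_flat hP hf).1, h00]; rfl
  · rw [lay_d12 d hP.sm, (XX_flat hP hf).2, h00]; rfl
  · rw [lay_lapl d hP.sm, (dd_scaled_lift d _ hDs).1, ← hX.1]; field_simp
  · rw [lay_lapl d hP.sm, (dd_scaled_lift d _ hDs).2, ← hX.2]; field_simp

theorem sm_FF {d : LD} {W E : Z → ℝ} (hW : Good d W) (hE : Good d E) : Sm (FF d W E) := by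
  have s1 : Sm (fun y => tp (fun _ => 1) wv ch ch (Lf d y)) :=
    (Cw_tp_one.1 d).comp (sm_Lf d)
  have s2 : Sm (fun y => E (Lf d y)) := hE.sm.comp (sm_Lf d)
  have s3 : Sm (fun y => Mn (dd eT W) (Lf d y)) :=
    (sm_Av contDiff_const (hW.sm.dd _)).comp (sm_Lf d)
  have a1 : Sm (fun t => d.G t * deriv d.ze t) := d.sG.mul d.sze.deriv
  have a3 : Sm (fun t => - d.G t) := d.sG.neg
  have u1 : Sm (fun y : S => (d.G y.2 * deriv d.ze y.2) * tp (fun _ => 1) wv ch ch (Lf d y)) :=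
    (a1.comp contDiff_snd).mul s1
  have u2 : Sm (fun y : S => d.G y.2 * E (Lf d y)) := (d.sG.comp contDiff_snd).mul s2
  have u3 : Sm (fun y : S => (-d.G y.2) * Mn (dd eT W) (Lf d y)) := (a3.comp contDiff_snd).mul s3
  exact contDiff_const.mul (u1.add (u2.add u3))

theorem Lf_mem_outer {d : LD} {y : S} (h : 3 / 4 < |d.p1 y.2 * y.1.1 + d.p2 y.2 * y.1.2| ∨
    3 / 4 < |d.w1 y.2 * y.1.1 + d.w2 y.2 * y.1.2|) : Lf d y ∈ flatSet := Or.inr h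

theorem tp_outer {d : LD} {y : S} (h : 3 / 4 < |d.p1 y.2 * y.1.1 + d.p2 y.2 * y.1.2| ∨
    3 / 4 < |d.w1 y.2 * y.1.1 + d.w2 y.2 * y.1.2|) (a : ℝ → ℝ) (s : ℝ) :
    tp a wv ch ch (Lf d y + s • ev 0) = 0 := by
  rcases h with h | h
  · have : ch (d.p1 y.2 * y.1.1 + d.p2 y.2 * y.1.2) = 0 := ch_zero h.le
    simp [tp, ev, Lf, this]
  · have : ch (d.w1 y.2 * y.1.1 + d.w2 y.2 * y.1.2) = 0 := ch_zero h.le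
    simp [tp, ev, Lf, this]

theorem lay_off {d : LD} {W : Z → ℝ} (hW : Good d W) (h : ∀ z ∈ flatSet, W z = prof d z) :
    ∀ y ∈ offSet d, lay d (Ph d W) y = 0 := by
  intro y hy
  rw [lay, Ph_zero, mul_zero]
  intro s
  rcases hy with hy | hy
  · exact hW.early _ (by simpa [ev, Lf] using hy)
  · rw [h _ (flat_shift (Lf_mem_outer hy) s)]
    exact tp_outer hy _ s

theorem FF_off {d : LD} {W E : Z → ℝ} (hW : Good d W) (h : ∀ z ∈ flatSet, W z = prof d z)
    (hE : Good d E) (hE0 : ∀ z ∈ flatSet, E z = 0) : ∀ y ∈ offSet d, FF d W E y = 0 := by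
  intro y hy
  rcases hy with hy | hy
  · have h1 : deriv d.ze y.2 = 0 := by
      have : d.ze =ᶠ[nhds y.2] fun _ => 0 := eventuallyEq_of_mem (isOpen_Iio.mem_nhds hy) d.ze0
      rw [this.deriv_eq]; simp
    have h3 : Mn (dd eT W) (Lf d y) = 0 :=
      Av_zero fun s => (hW.dd _).early _ (by simpa [ev, Lf] using hy)
    rw [FF, h1, hE.early _ hy, h3]; simp
  · have hm := Lf_mem_outer hy
    have h1 : tp (fun _ => 1) wv ch ch (Lf d y) = 0 := by simpa using tp_outer hy (fun _ => 1) 0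
    have h3 : Mn (dd eT W) (Lf d y) = 0 := by
      rw [Mn_congr fun s => dd_eqOn isOpen_flatSet _ h _ (flat_shift hm s), dd_time_prof, Mn_tp]
    rw [FF, h1, hE0 _ hm, h3]; simp

theorem NN_lay_eq {W E : LD → Z → ℝ} (hW : TCl 0 W)
    (hr : ∀ d z, rs d (W d) z = dd eT (prof d) z + E d z) (d : LD) {φ : S → ℝ} (hφ : Sm φ) {y : S}
    (hj : Jet φ y (-(d.et y.2 * y.1.1 - d.al y.2 * y.1.2)) (d.al y.2 * y.1.1 + d.be y.2 * y.1.2)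
      (d.g1 y.2) (d.g2 y.2)) :
    NN (fun y => φ y + lay d (Ph d (W d)) y) y - NN φ y = FF d (W d) (E d) y := by
  have hP : Sm (Ph d (W d)) := by
    rw [Ph_eq]; exact ((hW.1.1 d).JJ.JJ.cmul (d.sG.mul d.sr)).sm
  rw [NN_lay d hφ hP y hj.2.1 hj.1 hj.2.2.1 hj.2.2.2, Res_Ph hW, hr, dd_time_prof, FF]
  simp only [tp, Lf]
  ring

theorem exists_layer (m : ℕ) : ∃ (C : ℝ) (q : ℕ), 0 ≤ C ∧ ∀ d : LD,
    (∀ t ∈ Set.Icc d.t0 1, |d.G t * deriv d.ze t| ≤ d.N⁻¹ ^ m) → ∃ ψ Fo : S → ℝ, Sm ψ ∧ Sm Fo ∧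
      (∀ y ∈ offSet d, ψ y = 0 ∧ Fo y = 0) ∧
      (∀ i j, i + j ≤ m → ∀ y : S, y.2 ∈ Set.Icc d.t0 1 →
        |Sp i j Fo y| ≤ C * d.lam ^ q * d.N⁻¹) ∧
      (∀ φ, Sm φ → ∀ y, (y ∉ offSet d →
        Jet φ y (-(d.et y.2 * y.1.1 - d.al y.2 * y.1.2)) (d.al y.2 * y.1.1 + d.be y.2 * y.1.2)
          (d.g1 y.2) (d.g2 y.2)) → NN (fun y => φ y + ψ y) y - NN φ y = Fo y) ∧
      (∀ y : S, d.ze y.2 = 1 → |d.p1 y.2 * y.1.1 + d.p2 y.2 * y.1.2| < 1 / (16 * d.N) →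
        |d.w1 y.2 * y.1.1 + d.w2 y.2 * y.1.2| < 1 / 2 →
        Jet ψ y (d.G y.2 * d.r y.2 * d.p1 y.2 ^ 2 * (d.p1 y.2 * y.1.1 + d.p2 y.2 * y.1.2))
          (d.G y.2 * d.r y.2 * d.p1 y.2 * d.p2 y.2 * (d.p1 y.2 * y.1.1 + d.p2 y.2 * y.1.2))
          (d.G y.2 * d.p1 y.2) (d.G y.2 * d.p2 y.2)) := by
  obtain ⟨W, E, hW, hE, hE0, hWf, hr⟩ := exists_profile TCl_prof m
  choose! C q hC hb using fun (i j : ℕ) (h : i + j ≤ m) => FF_bound hW hE i j h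
  let I := (Finset.range (m + 1) ×ˢ Finset.range (m + 1)).filter fun p => p.1 + p.2 ≤ m
  have hI : ∀ p ∈ I, 0 ≤ C p.1 p.2 := fun p hp => hC _ _ (Finset.mem_filter.1 hp).2
  refine ⟨∑ p ∈ I, C p.1 p.2, ∑ p ∈ I, q p.1 p.2, Finset.sum_nonneg hI, fun d hd => ?_⟩
  have gW := hW.1.1 d
  refine ⟨lay d (Ph d (W d)), FF d (W d) (E d), sm_lay d ?_, sm_FF gW (hE.1 d),
    fun y hy => ⟨lay_off gW (hWf d) y hy, FF_off gW (hWf d) (hE.1 d) (hE0 d) y hy⟩, ?_, ?_, ?_⟩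
  · rw [Ph_eq]; exact (gW.JJ.JJ.cmul (d.sG.mul d.sr)).sm
  · intro i j hij y hy
    have hm : (i, j) ∈ I := Finset.mem_filter.2 ⟨Finset.mem_product.2
      ⟨Finset.mem_range.2 (by dsimp; omega), Finset.mem_range.2 (by dsimp; omega)⟩, hij⟩
    refine (hb i j hij d hd y hy).trans ?_
    have h1 : C i j ≤ ∑ p ∈ I, C p.1 p.2 :=
      Finset.single_le_sum (f := fun p : ℕ × ℕ => C p.1 p.2) hI hm
    have h2 : q i j ≤ ∑ p ∈ I, q p.1 p.2 :=
      Finset.single_le_sum (f := fun p : ℕ × ℕ => q p.1 p.2) (fun _ _ => Nat.zero_le _) hm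
    have hl := d.hlam
    have hN := d.inv_pos
    have h0 := Finset.sum_nonneg hI
    gcongr
  · intro φ hφ y hj
    by_cases hy : y ∈ offSet d
    · rw [FF_off gW (hWf d) (hE.1 d) (hE0 d) y hy]
      refine NN_lay_zero hφ (sm_lay d ?_) (isOpen_offSet d) (lay_off gW (hWf d)) y hy
      rw [Ph_eq]; exact (gW.JJ.JJ.cmul (d.sG.mul d.sr)).sm
    · exact NN_lay_eq hW hr d hφ (hj hy)
  · intro y hz h1 h2
    have hN := d.N_pos
    have h3 : |d.N * (d.p1 y.2 * y.1.1 + d.p2 y.2 * y.1.2)| < 1 / 16 := by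
      rw [abs_mul, abs_of_pos hN]
      calc _ < d.N * (1 / (16 * d.N)) := by gcongr
        _ = 1 / 16 := by field_simp
    have h4 : |d.p1 y.2 * y.1.1 + d.p2 y.2 * y.1.2| < 1 / 2 := by
      refine h1.trans_le ?_
      rw [div_le_div_iff₀ (by positivity) (by norm_num)]
      linarith [d.hN]
    have hf : Lf d y ∈ flatSet := Or.inl ⟨h4, h2⟩
    have hpr : prof d (Lf d y) = d.N * (d.p1 y.2 * y.1.1 + d.p2 y.2 * y.1.2) := by
      simp only [prof, tp, Lf]
      rw [hz, ch_one h4.le, ch_one h2.le, wv_eq h3.le]; ring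
    have hdp : dd (ev 0) (prof d) (Lf d y) = 1 := by
      rw [prof, dd_tp d.sze sm_wv sm_ch sm_ch]
      simp only [tp, Lf, ev]
      rw [hz, ch_one h4.le, ch_one h2.le, dd_wv h3]; simp
    have hJ := lay_jet d gW (hWf d) hf
    rw [hpr, hdp] at hJ
    refine hJ.congr ?_ ?_ ?_ ?_ <;> field_simp

end LayerSummary

section Tower

/-- The primitive of `f` with value `c` at time `1`. -/
noncomputable def prim (f : ℝ → ℝ) (c : ℝ) (t : ℝ) : ℝ := c + ∫ s in (1:ℝ)..t, f s

theorem prim_one (f : ℝ → ℝ) (c : ℝ) : prim f c 1 = c := by simp [prim]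

theorem hasDerivAt_prim {f : ℝ → ℝ} (hf : Continuous f) (c t : ℝ) :
    HasDerivAt (prim f c) (f t) t :=
  (intervalIntegral.integral_hasDerivAt_right (hf.intervalIntegrable _ _)
    hf.aestronglyMeasurable.stronglyMeasurableAtFilter hf.continuousAt).const_add c

theorem sm_prim {f : ℝ → ℝ} (hf : Sm f) (c : ℝ) : Sm (prim f c) := by
  refine contDiff_infty_iff_deriv.2 ⟨fun t => (hasDerivAt_prim hf.continuous c t).differentiableAt, ?_⟩
  rwa [show deriv (prim f c) = f from funext fun t => (hasDerivAt_prim hf.continuous c t).deriv]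

theorem sub_le_of_deriv_ge {f f' : ℝ → ℝ} {m u v : ℝ} (huv : u ≤ v)
    (hf : ∀ t, HasDerivAt f (f' t) t) (h : ∀ t ∈ Set.Icc u v, m ≤ f' t) :
    m * (v - u) ≤ f v - f u := by
  have hd : Differentiable ℝ f := fun t => (hf t).differentiableAt
  refine (convex_Icc u v).mul_sub_le_image_sub_of_le_deriv hd.continuous.continuousOn
    hd.differentiableOn (fun t ht => ?_) u (Set.left_mem_Icc.2 huv) v (Set.right_mem_Icc.2 huv) huv
  rw [(hf t).deriv]
  exact h t (interior_subset ht)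

theorem abs_sub_le_of_deriv {f f' : ℝ → ℝ} {m u v : ℝ} (huv : u ≤ v)
    (hf : ∀ t, HasDerivAt f (f' t) t) (h : ∀ t ∈ Set.Icc u v, |f' t| ≤ m) :
    |f u - f v| ≤ m * (v - u) := by
  have h1 := sub_le_of_deriv_ge (m := -m) huv hf fun t ht => (abs_le.1 (h t ht)).1
  have h2 := sub_le_of_deriv_ge (f := fun t => - f t) (m := -m) huv (fun t => (hf t).neg)
    fun t ht => by have := (abs_le.1 (h t ht)).2; linarith
  exact abs_le.2 ⟨by linarith, by linarith⟩

/-- The state of the construction after finitely many layers. -/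
structure St where
  (lam lamm N s ts : ℝ)
  (a1 a2 b1 b2 h g1 g2 al be et : ℝ → ℝ)
  φ : S → ℝ
  hs : s * s = 1
  hlamm : 1 ≤ lamm
  hlam : 10 ^ 5 * lamm ≤ lam
  hN : lam ^ 20 ≤ N
  hts0 : 0 ≤ ts
  hts : ts < 1 - 4 * lam⁻¹ ^ 9
  sa1 : Sm a1
  sa2 : Sm a2
  sb1 : Sm b1
  sb2 : Sm b2
  sh : Sm h
  sg1 : Sm g1
  sg2 : Sm g2
  sal : Sm al
  sbe : Sm be
  set : Sm et
  sφ : Sm φ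
  da1 : ∀ t, HasDerivAt a1 (-(al t * a1 t + et t * a2 t)) t
  da2 : ∀ t, HasDerivAt a2 (-(be t * a1 t - al t * a2 t)) t
  db1 : ∀ t, HasDerivAt b1 (-(al t * b1 t + et t * b2 t)) t
  db2 : ∀ t, HasDerivAt b2 (-(be t * b1 t - al t * b2 t)) t
  dh : ∀ t, HasDerivAt h (a1 t * (g2 t * a1 t - g1 t * a2 t) * (a1 t ^ 2 + a2 t ^ 2)⁻¹) t
  va1 : a1 1 = s
  va2 : a2 1 = lam
  vb1 : b1 1 = -s
  vb2 : b2 1 = lamm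
  vh : h 1 = 0
  cross : ∀ t, a1 t * b2 t - a2 t * b1 t = s * (lam + lamm)
  ba : ∀ t ∈ Set.Icc ts 1, |a1 t| ≤ lam ^ 2 ∧ |a2 t| ≤ lam ^ 2
  bb : ∀ t ∈ Set.Icc ts 1, |b1 t| ≤ lam ^ 2 ∧ |b2 t| ≤ lam ^ 2
  bg : ∀ t ∈ Set.Icc ts 1, |g1 t| ≤ lam ∧ |g2 t| ≤ lam
  bA : ∀ t ∈ Set.Icc ts 1, |al t| ≤ lam ∧ |be t| ≤ lam ∧ |et t| ≤ lam
  supp : ∀ y : S, y.2 ≤ 1 → 3 / 5 < |y.1.1| ∨ 3 / 5 < |y.1.2| → φ y = 0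
  jet : ∀ y : S, y.2 ∈ Set.Icc ts 1 → |a1 y.2 * y.1.1 + a2 y.2 * y.1.2| < 1 / (16 * N) →
    |b1 y.2 * y.1.1 + b2 y.2 * y.1.2| < 1 / (2 * lam ^ 3) →
    Jet φ y
      (-(et y.2 * y.1.1 - al y.2 * y.1.2) + lam ^ 10 * exp (h y.2) * (a1 y.2 ^ 2 + a2 y.2 ^ 2)⁻¹ *
        a1 y.2 ^ 2 * (a1 y.2 * y.1.1 + a2 y.2 * y.1.2))
      ((al y.2 * y.1.1 + be y.2 * y.1.2) + lam ^ 10 * exp (h y.2) * (a1 y.2 ^ 2 + a2 y.2 ^ 2)⁻¹ *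
        a1 y.2 * a2 y.2 * (a1 y.2 * y.1.1 + a2 y.2 * y.1.2))
      (g1 y.2 + lam ^ 10 * exp (h y.2) * a1 y.2) (g2 y.2 + lam ^ 10 * exp (h y.2) * a2 y.2)

namespace St

variable (z : St)

theorem lam_ge : 10 ^ 5 ≤ z.lam := by linarith [z.hlam, z.hlamm]
theorem lam_pos : 0 < z.lam := by linarith [z.lam_ge]
theorem N_pos : 0 < z.N := (pow_pos z.lam_pos 20).trans_le z.hN

/-- Amplitude of the density gradient of the last layer. -/
noncomputable def G (t : ℝ) : ℝ := z.lam ^ 10 * exp (z.h t)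
/-- Inverse squared wave number. -/
noncomputable def r (t : ℝ) : ℝ := (z.a1 t ^ 2 + z.a2 t ^ 2)⁻¹

theorem ne_zero_of_cross {a b c d e : ℝ} (h : a * d - b * c = e) (he : e ≠ 0) :
    0 < a ^ 2 + b ^ 2 := by
  rcases eq_or_ne a 0 with rfl | ha
  · have : b ≠ 0 := by rintro rfl; apply he; rw [← h]; ring
    positivity
  · positivity

theorem s_ne : z.s ≠ 0 := fun h => by have := z.hs; rw [h] at this; norm_num at this

theorem pos (t : ℝ) : 0 < z.a1 t ^ 2 + z.a2 t ^ 2 :=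
  ne_zero_of_cross (z.cross t) (mul_ne_zero z.s_ne (by linarith [z.hlamm, z.lam_pos]))

theorem sG : Sm z.G := contDiff_const.mul z.sh.exp
theorem sr : Sm z.r := ((z.sa1.pow 2).add (z.sa2.pow 2)).inv fun t => (z.pos t).ne'

/-- Ratio of consecutive determinants. -/
noncomputable def kap : ℝ := (z.N + z.lam) / (z.lam + z.lamm)
/-- Rate of rotation of the next wave vector. -/
noncomputable def dSg (t : ℝ) : ℝ := z.s * (z.N + z.lam) * z.G t * z.a1 t * z.r t
/-- Coefficient of the last wave vector in the next one. -/
noncomputable def Sg : ℝ → ℝ := prim z.dSg (z.kap - 1)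

theorem sdSg : Sm z.dSg := ((contDiff_const.mul z.sG).mul z.sa1).mul z.sr
theorem sSg : Sm z.Sg := sm_prim z.sdSg _
theorem dSg_hasDeriv (t : ℝ) : HasDerivAt z.Sg (z.dSg t) t :=
  hasDerivAt_prim z.sdSg.continuous _ t

/-- First component of the next wave vector. -/
noncomputable def c1 (t : ℝ) : ℝ := z.kap * z.b1 t + z.Sg t * z.a1 t
/-- Second component of the next wave vector. -/
noncomputable def c2 (t : ℝ) : ℝ := z.kap * z.b2 t + z.Sg t * z.a2 t
noncomputable def al' (t : ℝ) : ℝ := z.al t + z.G t * z.r t * (z.a1 t ^ 2 * z.a2 t)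
noncomputable def be' (t : ℝ) : ℝ := z.be t + z.G t * z.r t * (z.a1 t * z.a2 t ^ 2)
noncomputable def et' (t : ℝ) : ℝ := z.et t - z.G t * z.r t * z.a1 t ^ 3
noncomputable def k1 (t : ℝ) : ℝ := z.g1 t + z.G t * z.a1 t
noncomputable def k2 (t : ℝ) : ℝ := z.g2 t + z.G t * z.a2 t

theorem sc1 : Sm z.c1 := (contDiff_const.mul z.sb1).add (z.sSg.mul z.sa1)
theorem sc2 : Sm z.c2 := (contDiff_const.mul z.sb2).add (z.sSg.mul z.sa2)
theorem sal' : Sm z.al' := z.sal.add ((z.sG.mul z.sr).mul ((z.sa1.pow 2).mul z.sa2))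
theorem sbe' : Sm z.be' := z.sbe.add ((z.sG.mul z.sr).mul (z.sa1.mul (z.sa2.pow 2)))
theorem set' : Sm z.et' := z.set.sub ((z.sG.mul z.sr).mul (z.sa1.pow 3))
theorem sk1 : Sm z.k1 := z.sg1.add (z.sG.mul z.sa1)
theorem sk2 : Sm z.k2 := z.sg2.add (z.sG.mul z.sa2)

theorem kap_mul : z.kap * (z.lam + z.lamm) = z.N + z.lam := by
  have : z.lam + z.lamm ≠ 0 := by linarith [z.hlamm, z.lam_pos]
  rw [kap]; field_simp

theorem cross_c (t : ℝ) : z.c1 t * z.a2 t - z.c2 t * z.a1 t = -z.s * (z.N + z.lam) := by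
  rw [← z.kap_mul, c1, c2]
  linear_combination (-z.kap) * z.cross t

theorem cpos (t : ℝ) : 0 < z.c1 t ^ 2 + z.c2 t ^ 2 :=
  ne_zero_of_cross (z.cross_c t)
    (mul_ne_zero (neg_ne_zero.2 z.s_ne) (by linarith [z.N_pos, z.lam_pos]))

theorem da1' (t : ℝ) : HasDerivAt z.a1 (-(z.al' t * z.a1 t + z.et' t * z.a2 t)) t := by
  convert z.da1 t using 1
  rw [al', et']; ring

theorem da2' (t : ℝ) : HasDerivAt z.a2 (-(z.be' t * z.a1 t - z.al' t * z.a2 t)) t := by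
  convert z.da2 t using 1
  rw [al', be']; ring

theorem dc1 (t : ℝ) : HasDerivAt z.c1 (-(z.al' t * z.c1 t + z.et' t * z.c2 t)) t := by
  refine (((z.db1 t).const_mul z.kap).add ((z.dSg_hasDeriv t).mul (z.da1 t))).congr_deriv ?_
  have := z.cross_c t
  rw [dSg, al', et']
  have e : z.s * (z.N + z.lam) = -(z.c1 t * z.a2 t - z.c2 t * z.a1 t) := by rw [this]; ring
  rw [e, c1, c2]; ring

theorem dc2 (t : ℝ) : HasDerivAt z.c2 (-(z.be' t * z.c1 t - z.al' t * z.c2 t)) t := by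
  refine (((z.db2 t).const_mul z.kap).add ((z.dSg_hasDeriv t).mul (z.da2 t))).congr_deriv ?_
  have := z.cross_c t
  rw [dSg, al', be']
  have e : z.s * (z.N + z.lam) = -(z.c1 t * z.a2 t - z.c2 t * z.a1 t) := by rw [this]; ring
  rw [e, c1, c2]; ring

/-- Growth rate of the next layer. -/
noncomputable def gam (t : ℝ) : ℝ :=
  z.c1 t * (z.k2 t * z.c1 t - z.k1 t * z.c2 t) * (z.c1 t ^ 2 + z.c2 t ^ 2)⁻¹

theorem sgam : Sm z.gam :=
  (z.sc1.mul ((z.sk2.mul z.sc1).sub (z.sk1.mul z.sc2))).mul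
    (((z.sc1.pow 2).add (z.sc2.pow 2)).inv fun t => (z.cpos t).ne')

/-- Logarithmic amplitude of the next layer. -/
noncomputable def hn : ℝ → ℝ := prim z.gam 0

theorem shn : Sm z.hn := sm_prim z.sgam _
theorem dhn (t : ℝ) : HasDerivAt z.hn (z.gam t) t := hasDerivAt_prim z.sgam.continuous _ t

theorem Sg_one : z.Sg 1 = z.kap - 1 := prim_one _ _
theorem vc1 : z.c1 1 = -z.s := by rw [c1, z.Sg_one, z.va1, z.vb1]; ring
theorem vc2 : z.c2 1 = z.N := by
  rw [c2, z.Sg_one, z.va2, z.vb2]; linear_combination z.kap_mul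

end St

end Tower

section Window

namespace St

variable (z : St)

/-- Start of the time window on which the next layer lives. -/
noncomputable def t0 : ℝ := 1 - 4 * z.lam⁻¹ ^ 9

variable {z} {t : ℝ}

theorem mem_ts (ht : t ∈ Set.Icc z.t0 1) : t ∈ Set.Icc z.ts 1 :=
  ⟨z.hts.le.trans ht.1, ht.2⟩

theorem tau_le (ht : t ∈ Set.Icc z.t0 1) : (1 - t) * z.lam ^ 9 ≤ 4 := by
  have h1 : 1 - t ≤ 4 * z.lam⁻¹ ^ 9 := by have := ht.1; rw [t0] at this; linarith
  have hL := z.lam_pos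
  calc (1 - t) * z.lam ^ 9 ≤ 4 * z.lam⁻¹ ^ 9 * z.lam ^ 9 := by gcongr
    _ = 4 := by field_simp

theorem tau_small (ht : t ∈ Set.Icc z.t0 1) : 2 * z.lam ^ 3 * (1 - t) * z.lam ^ 4 ≤ 1 / 1000 := by
  have h1 := tau_le ht
  have hL := z.lam_ge
  have hL0 := z.lam_pos
  have h2 : (10 ^ 5 : ℝ) ^ 2 ≤ z.lam ^ 2 := by gcongr
  have h3 : 0 ≤ 2 * z.lam ^ 3 * (1 - t) * z.lam ^ 4 :=
    mul_nonneg (mul_nonneg (by positivity) (by linarith [ht.2])) (by positivity)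
  nlinarith

theorem eps_small (ht : t ∈ Set.Icc z.t0 1) :
    0 ≤ 2 * z.lam ^ 3 * (1 - t) ∧ 2 * z.lam ^ 3 * (1 - t) ≤ 1 / 1000 ∧
      2 * z.lam ^ 3 * (1 - t) * z.lam ≤ 1 / 1000 := by
  have h1 := tau_small ht
  have hL := z.lam_ge
  have h0 : 0 ≤ 2 * z.lam ^ 3 * (1 - t) :=
    mul_nonneg (by have := z.lam_pos; positivity) (by linarith [ht.2])
  have h2 : z.lam ≤ z.lam ^ 4 := le_self_pow₀ (by linarith) (by norm_num)
  have h3 := mul_le_mul_of_nonneg_left h2 h0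
  have h4 := mul_le_mul_of_nonneg_left (show 1 ≤ z.lam by linarith) h0
  exact ⟨h0, by linarith, by linarith⟩

theorem drift_aux {x y A B L : ℝ} (hL : 0 ≤ L) (hx : |x| ≤ L ^ 2) (hy : |y| ≤ L ^ 2)
    (hA : |A| ≤ L) (hB : |B| ≤ L) : |A * x| ≤ L ^ 3 ∧ |B * y| ≤ L ^ 3 := by
  constructor
  · rw [abs_mul]; calc _ ≤ L * L ^ 2 := by gcongr
      _ = _ := by ring
  · rw [abs_mul]; calc _ ≤ L * L ^ 2 := by gcongr
      _ = _ := by ring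

theorem near (ht : t ∈ Set.Icc z.t0 1) :
    |z.a1 t - z.s| ≤ 2 * z.lam ^ 3 * (1 - t) ∧ |z.a2 t - z.lam| ≤ 2 * z.lam ^ 3 * (1 - t) ∧
    |z.b1 t + z.s| ≤ 2 * z.lam ^ 3 * (1 - t) ∧ |z.b2 t - z.lamm| ≤ 2 * z.lam ^ 3 * (1 - t) := by
  have hm : ∀ u ∈ Set.Icc t 1, u ∈ Set.Icc z.ts 1 := fun u hu =>
    mem_ts ⟨ht.1.trans hu.1, hu.2⟩
  have hL := z.lam_pos.le
  have key : ∀ {x y A B : ℝ}, |x| ≤ z.lam ^ 2 → |y| ≤ z.lam ^ 2 → |A| ≤ z.lam → |B| ≤ z.lam →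
      |-(A * x + B * y)| ≤ 2 * z.lam ^ 3 ∧ |-(A * x - B * y)| ≤ 2 * z.lam ^ 3 := by
    intro x y A B hx hy hA hB
    obtain ⟨h1, h2⟩ := drift_aux hL hx hy hA hB
    rw [abs_neg, abs_neg]
    have := abs_add_le (A * x) (B * y)
    have := abs_sub (A * x) (B * y)
    exact ⟨by linarith, by linarith⟩
  have e : z.b1 t + z.s = z.b1 t - z.b1 1 := by rw [z.vb1]; ring
  refine ⟨?_, ?_, ?_, ?_⟩
  · rw [← z.va1]
    exact abs_sub_le_of_deriv ht.2 z.da1 fun u hu => (key (z.ba u (hm u hu)).1 (z.ba u (hm u hu)).2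
      (z.bA u (hm u hu)).1 (z.bA u (hm u hu)).2.2).1
  · have e2 : z.a2 t - z.lam = z.a2 t - z.a2 1 := by rw [z.va2]
    rw [e2]
    exact abs_sub_le_of_deriv ht.2 z.da2 fun u hu => (key (z.ba u (hm u hu)).1 (z.ba u (hm u hu)).2
      (z.bA u (hm u hu)).2.1 (z.bA u (hm u hu)).1).2
  · rw [e]
    exact abs_sub_le_of_deriv ht.2 z.db1 fun u hu => (key (z.bb u (hm u hu)).1 (z.bb u (hm u hu)).2
      (z.bA u (hm u hu)).1 (z.bA u (hm u hu)).2.2).1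
  · rw [← z.vb2]
    exact abs_sub_le_of_deriv ht.2 z.db2 fun u hu => (key (z.bb u (hm u hu)).1 (z.bb u (hm u hu)).2
      (z.bA u (hm u hu)).2.1 (z.bA u (hm u hu)).1).2

theorem s_cases : z.s = 1 ∨ z.s = -1 := mul_self_eq_one_iff.1 z.hs

theorem abs_s : |z.s| = 1 := by rcases z.s_cases with h | h <;> rw [h] <;> norm_num

theorem sa1_near (ht : t ∈ Set.Icc z.t0 1) : |z.s * z.a1 t - 1| ≤ 1 / 1000 := by
  have e : z.s * z.a1 t - 1 = z.s * (z.a1 t - z.s) := by linear_combination z.hs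
  rw [e, abs_mul, abs_s, one_mul]
  exact (near ht).1.trans (eps_small ht).2.1

theorem abs_a1_near (ht : t ∈ Set.Icc z.t0 1) : |(|z.a1 t|) - 1| ≤ 1 / 1000 := by
  have := abs_abs_sub_abs_le (z.a1 t) z.s
  rw [abs_s] at this
  exact this.trans ((near ht).1.trans (eps_small ht).2.1)

theorem a2_near (ht : t ∈ Set.Icc z.t0 1) : |z.a2 t - z.lam| ≤ 1 / 1000 :=
  (near ht).2.1.trans (eps_small ht).2.1

theorem r_bd (ht : t ∈ Set.Icc z.t0 1) :
    9 / 10 * (z.lam ^ 2)⁻¹ ≤ z.r t ∧ z.r t ≤ (z.lam ^ 2)⁻¹ := by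
  have hL := z.lam_ge
  have h1 := abs_le.1 (abs_a1_near ht)
  obtain ⟨h2, h2'⟩ := abs_le.1 ((near ht).2.1)
  obtain ⟨h3, h4, h5⟩ := eps_small ht
  set e := 2 * z.lam ^ 3 * (1 - t)
  have ha : z.a1 t ^ 2 = |z.a1 t| ^ 2 := (sq_abs _).symm
  have hlo : z.lam ^ 2 ≤ z.a1 t ^ 2 + z.a2 t ^ 2 := by rw [ha]; nlinarith
  have hhi : z.a1 t ^ 2 + z.a2 t ^ 2 ≤ 10 / 9 * z.lam ^ 2 := by rw [ha]; nlinarith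
  constructor
  · rw [r]
    calc 9 / 10 * (z.lam ^ 2)⁻¹ = (10 / 9 * z.lam ^ 2)⁻¹ := by rw [mul_inv]; norm_num
      _ ≤ _ := inv_anti₀ (z.pos t) hhi
  · exact inv_anti₀ (by positivity) hlo

theorem h_bd (ht : t ∈ Set.Icc z.t0 1) : |z.h t| ≤ 1 / 100 := by
  have hL := z.lam_ge
  have hL0 := z.lam_pos
  have h : |z.h t - z.h 1| ≤ 8 * (1 - t) := by
    refine abs_sub_le_of_deriv ht.2 z.dh fun u hu => ?_
    have hu' : u ∈ Set.Icc z.t0 1 := ⟨ht.1.trans hu.1, hu.2⟩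
    obtain ⟨hg1, hg2⟩ := z.bg u (mem_ts hu')
    have h1 : |z.a1 u| ≤ 2 := by have := abs_le.1 (abs_a1_near hu'); linarith
    have h2 : |z.a2 u| ≤ 2 * z.lam := by
      have := abs_le.1 (a2_near hu'); rw [abs_le]; constructor <;> linarith
    have h3 : |z.g2 u * z.a1 u - z.g1 u * z.a2 u| ≤ 3 * z.lam ^ 2 := by
      refine (abs_sub _ _).trans ?_
      rw [abs_mul, abs_mul]
      calc _ ≤ z.lam * 2 + z.lam * (2 * z.lam) := by gcongr
        _ ≤ _ := by nlinarith
    rw [abs_mul, abs_mul, abs_of_pos (inv_pos.2 (z.pos u))]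
    calc _ ≤ 2 * (3 * z.lam ^ 2) * (z.lam ^ 2)⁻¹ := by
          refine mul_le_mul (mul_le_mul h1 h3 (abs_nonneg _) (by norm_num)) (r_bd hu').2
            (inv_pos.2 (z.pos u)).le (by positivity)
      _ = 6 := by field_simp; norm_num
      _ ≤ 8 := by norm_num
  rw [z.vh, sub_zero] at h
  have h9 : (10 ^ 5 : ℝ) ^ 9 ≤ z.lam ^ 9 := by gcongr
  have := tau_le ht
  have h0 : 0 ≤ 1 - t := by linarith [ht.2]
  nlinarith

theorem G_bd (ht : t ∈ Set.Icc z.t0 1) :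
    9 / 10 * z.lam ^ 10 ≤ z.G t ∧ z.G t ≤ 11 / 10 * z.lam ^ 10 := by
  obtain ⟨h1, h2⟩ := abs_le.1 (h_bd ht)
  have h3 := add_one_le_exp (z.h t)
  have h4 := add_one_le_exp (-z.h t)
  rw [exp_neg] at h4
  have h5 : exp (z.h t) ≤ 11 / 10 := by
    have h0 := exp_pos (z.h t)
    have : (99 / 100) * exp (z.h t) ≤ 1 := by
      calc _ ≤ (exp (z.h t))⁻¹ * exp (z.h t) := by gcongr; linarith
        _ = 1 := by field_simp
    linarith
  have : 0 ≤ z.lam ^ 10 := by have := z.lam_pos; positivity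
  rw [G]
  constructor <;> nlinarith

theorem N_big : z.lam * 10 ^ 90 ≤ z.N := by
  have hL := z.lam_ge
  have h : (10 ^ 5 : ℝ) ^ 19 ≤ z.lam ^ 19 := by gcongr
  have := z.hN
  have h0 := z.lam_pos
  calc z.lam * 10 ^ 90 ≤ z.lam * z.lam ^ 19 := by gcongr; norm_num at h ⊢; linarith
    _ = z.lam ^ 20 := by ring
    _ ≤ _ := this

theorem kap_bd : z.N / z.lam * (9 / 10) ≤ z.kap ∧ z.kap ≤ 11 / 10 * (z.N / z.lam) := by
  have h1 := z.hlam
  have h2 := z.hlamm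
  have h3 := z.N_big
  have h0 := z.lam_pos
  have hN := z.N_pos
  rw [kap]
  constructor
  · rw [div_mul_eq_mul_div, div_le_div_iff₀ h0 (by linarith)]
    nlinarith [mul_pos h0 hN]
  · rw [← mul_div_assoc, div_le_div_iff₀ (by linarith) h0]
    nlinarith [mul_pos h0 hN]

theorem dSg_bd (ht : t ∈ Set.Icc z.t0 1) :
    z.N * z.lam ^ 8 / 2 ≤ z.dSg t ∧ z.dSg t ≤ 2 * (z.N * z.lam ^ 8) := by
  obtain ⟨h1, h2⟩ := abs_le.1 (sa1_near ht)
  obtain ⟨h3, h4⟩ := G_bd ht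
  obtain ⟨h5, h6⟩ := r_bd ht
  have h7 := z.N_big
  have h0 := z.lam_pos
  have hN := z.N_pos
  have e : z.dSg t = (z.N + z.lam) * z.G t * (z.s * z.a1 t) * z.r t := by rw [dSg]; ring
  have e2 : z.lam ^ 8 = z.lam ^ 10 * (z.lam ^ 2)⁻¹ := by field_simp
  have hr : 0 < (z.lam ^ 2)⁻¹ := by positivity
  have h10 : 0 < z.lam ^ 10 := by positivity
  rw [e, e2]
  constructor
  · calc _ = z.N * (1 / 2 * z.lam ^ 10) * 1 * (z.lam ^ 2)⁻¹ := by ring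
      _ ≤ z.N * (9 / 10 * z.lam ^ 10) * (9 / 10) * (9 / 10 * (z.lam ^ 2)⁻¹) := by
        have : 0 < z.N * z.lam ^ 10 * (z.lam ^ 2)⁻¹ := by positivity
        nlinarith
      _ ≤ _ := by
        have hG : 0 ≤ z.G t := by linarith
        have hs : 0 ≤ z.s * z.a1 t := by linarith
        have hNl : 0 ≤ z.N + z.lam := by linarith
        gcongr <;> linarith
  · have : 0 < z.G t := by nlinarith
    calc _ ≤ (11 / 10 * z.N) * (11 / 10 * z.lam ^ 10) * (11 / 10) * (z.lam ^ 2)⁻¹ := by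
          gcongr <;> linarith
      _ ≤ _ := by
        have : 0 < z.N * z.lam ^ 10 * (z.lam ^ 2)⁻¹ := by positivity
        nlinarith

/-- Remaining rotation. -/
noncomputable def Sig (z : St) (t : ℝ) : ℝ := z.Sg 1 - z.Sg t

theorem Sig_bd (ht : t ∈ Set.Icc z.t0 1) :
    z.N * z.lam ^ 8 / 2 * (1 - t) ≤ z.Sig t ∧ z.Sig t ≤ 2 * (z.N * z.lam ^ 8) * (1 - t) := by
  have hm : ∀ u ∈ Set.Icc t 1, u ∈ Set.Icc z.t0 1 := fun u hu => ⟨ht.1.trans hu.1, hu.2⟩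
  have h1 := sub_le_of_deriv_ge ht.2 z.dSg_hasDeriv fun u hu => (dSg_bd (hm u hu)).1
  have h2 := sub_le_of_deriv_ge (f := fun t => -z.Sg t) ht.2 (fun u => (z.dSg_hasDeriv u).neg)
    fun u hu => neg_le_neg (dSg_bd (hm u hu)).2
  exact ⟨h1, by rw [Sig]; linarith⟩

theorem Sig_nonneg (ht : t ∈ Set.Icc z.t0 1) : 0 ≤ z.Sig t := by
  refine le_trans ?_ (Sig_bd ht).1
  have := z.N_pos
  have := z.lam_pos
  exact mul_nonneg (by positivity) (by linarith [ht.2])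

theorem Sig_le (ht : t ∈ Set.Icc z.t0 1) : z.Sig t ≤ 8 * (z.N / z.lam) := by
  have h0 := z.lam_pos
  have := z.N_pos
  refine (Sig_bd ht).2.trans ?_
  calc _ = 2 * (z.N / z.lam) * ((1 - t) * z.lam ^ 9) := by field_simp
    _ ≤ 2 * (z.N / z.lam) * 4 := by gcongr; exact tau_le ht
    _ = _ := by ring

/-- Errors are dominated by the rotation. -/
theorem err_le (ht : t ∈ Set.Icc z.t0 1) :
    z.N / z.lam * (2 * z.lam ^ 3 * (1 - t)) * z.lam ^ 5 ≤ z.Sig t / 1000 := by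
  have h0 := z.lam_ge
  have := z.N_pos
  have h1 : 0 ≤ 1 - t := by linarith [ht.2]
  have h2 := (Sig_bd ht).1
  have : 4 * 1000 ≤ z.lam := by linarith
  have hp := z.lam_pos
  calc _ = 2 * (z.N * z.lam ^ 7 * (1 - t)) := by field_simp
    _ = (z.N * z.lam ^ 7 / 2 * (1 - t)) * (4 * 1000) / 1000 := by ring
    _ ≤ (z.N * z.lam ^ 7 / 2 * (1 - t)) * z.lam / 1000 := by gcongr
    _ ≤ _ := by linarith

theorem err_le' (ht : t ∈ Set.Icc z.t0 1) :
    z.N / z.lam * (2 * z.lam ^ 3 * (1 - t)) ≤ z.Sig t / 1000 ∧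
    z.N / z.lam * (2 * z.lam ^ 3 * (1 - t)) * z.lam ≤ z.Sig t / 1000 := by
  have h := err_le ht
  have h0 := z.lam_ge
  have h1 : 0 ≤ z.N / z.lam * (2 * z.lam ^ 3 * (1 - t)) := by
    have := z.N_pos; have := z.lam_pos; have := (eps_small ht).1; positivity
  have h2 : z.lam ≤ z.lam ^ 5 := le_self_pow₀ (by linarith) (by norm_num)
  have h3 := mul_le_mul_of_nonneg_left h2 h1
  have h4 := mul_le_mul_of_nonneg_left (show 1 ≤ z.lam by linarith) h1
  exact ⟨by linarith, by linarith⟩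

theorem Sg_eq (t : ℝ) : z.Sg t = z.kap - 1 - z.Sig t := by rw [Sig, z.Sg_one]; ring

theorem c1_bd (ht : t ∈ Set.Icc z.t0 1) :
    9 / 10 * (1 + z.Sig t) ≤ -z.s * z.c1 t ∧ -z.s * z.c1 t ≤ 11 / 10 * (1 + z.Sig t) := by
  obtain ⟨h1, h2⟩ := abs_le.1 (sa1_near ht)
  obtain ⟨n1, -, n3, -⟩ := near ht
  have hS := Sig_nonneg ht
  have he := (err_le' ht).1
  have hk := (kap_bd (z := z)).2
  have h0 := eps_small ht
  have e : -z.s * z.c1 t = (1 + z.Sig t) * (z.s * z.a1 t) - z.s * (z.kap * (z.a1 t + z.b1 t)) := by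
    rw [c1, Sg_eq]; ring
  have hk0 : 0 ≤ z.kap := by
    refine le_trans ?_ (kap_bd (z := z)).1
    have := z.N_pos; have := z.lam_pos; positivity
  have hb : |z.s * (z.kap * (z.a1 t + z.b1 t))| ≤ z.Sig t / 100 := by
    rw [abs_mul, abs_s, one_mul, abs_mul, abs_of_nonneg hk0]
    have : |z.a1 t + z.b1 t| ≤ 2 * (2 * z.lam ^ 3 * (1 - t)) := by
      have := abs_add_le (z.a1 t - z.s) (z.b1 t + z.s)
      rw [show z.a1 t - z.s + (z.b1 t + z.s) = z.a1 t + z.b1 t by ring] at this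
      linarith
    have hN0 : 0 ≤ z.N / z.lam := by have := z.N_pos; have := z.lam_pos; positivity
    calc _ ≤ (11 / 10 * (z.N / z.lam)) * (2 * (2 * z.lam ^ 3 * (1 - t))) := by gcongr
      _ ≤ _ := by linarith
  obtain ⟨h3, h4⟩ := abs_le.1 hb
  rw [e]
  constructor <;> nlinarith

theorem c2_bd (ht : t ∈ Set.Icc z.t0 1) :
    |z.c2 t - (z.N - z.Sig t * z.lam)| ≤ z.Sig t / 100 := by
  obtain ⟨-, n2, -, n4⟩ := near ht
  have hS := Sig_nonneg ht
  have he := (err_le' ht).1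
  have hk := (kap_bd (z := z)).2
  obtain ⟨h0, h0', -⟩ := eps_small ht
  have hN := z.N_big
  have hp := z.lam_pos
  have e : z.c2 t - (z.N - z.Sig t * z.lam) = z.kap * ((z.a2 t - z.lam) + (z.b2 t - z.lamm)) -
      (1 + z.Sig t) * (z.a2 t - z.lam) := by
    rw [c2, Sg_eq]; linear_combination z.kap_mul
  have hk0 : 0 ≤ z.kap := by
    refine le_trans ?_ (kap_bd (z := z)).1
    have := z.N_pos; positivity
  rw [e]
  refine (abs_sub _ _).trans ?_
  rw [abs_mul, abs_mul, abs_of_nonneg hk0, abs_of_nonneg (show 0 ≤ 1 + z.Sig t by linarith)]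
  have hsum := (abs_add_le (z.a2 t - z.lam) (z.b2 t - z.lamm)).trans (add_le_add n2 n4)
  have hNl : 1 ≤ z.N / z.lam := by rw [one_le_div hp]; linarith
  set ε := 2 * z.lam ^ 3 * (1 - t)
  calc _ ≤ (11 / 10 * (z.N / z.lam)) * (ε + ε) + (1 + z.Sig t) * ε := by gcongr
    _ ≤ _ := by nlinarith

theorem one_le_c1 (ht : t ∈ Set.Icc z.t0 1) : 9 / 10 ≤ |z.c1 t| := by
  have h1 := (c1_bd ht).1
  have hS := Sig_nonneg ht
  have := le_abs_self (-z.s * z.c1 t)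
  rw [abs_mul, abs_neg, abs_s, one_mul] at this
  linarith

theorem c1_le (ht : t ∈ Set.Icc z.t0 1) : |z.c1 t| ≤ z.N := by
  obtain ⟨h1, h2⟩ := c1_bd ht
  have hS := Sig_nonneg ht
  have e : |z.c1 t| = |-z.s * z.c1 t| := by rw [abs_mul, abs_neg, abs_s, one_mul]
  rw [e, abs_of_nonneg (by linarith)]
  have := Sig_le ht
  have hL := z.lam_ge
  have hN := z.N_big
  have : z.N / z.lam ≤ z.N / 10 ^ 5 := by
    have := z.N_pos
    gcongr
  linarith

theorem c2_le (ht : t ∈ Set.Icc z.t0 1) : |z.c2 t| ≤ 10 * z.N := by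
  have h1 := abs_le.1 (c2_bd ht)
  have hS := Sig_nonneg ht
  have h2 := Sig_le ht
  have hL := z.lam_ge
  have hN := z.N_pos
  have h3 : z.Sig t * z.lam ≤ 8 * z.N := by
    calc _ ≤ 8 * (z.N / z.lam) * z.lam := by have := z.lam_pos; gcongr
      _ = _ := by have := z.lam_pos; field_simp
  have h4 : z.Sig t ≤ z.Sig t * z.lam := le_mul_of_one_le_right hS (by linarith)
  rw [abs_le]
  constructor
  · linarith
  · nlinarith

theorem rn_le (ht : t ∈ Set.Icc z.t0 1) : (z.c1 t ^ 2 + z.c2 t ^ 2)⁻¹ ≤ 4 := by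
  have := one_le_c1 ht
  have h : 1 / 4 ≤ z.c1 t ^ 2 + z.c2 t ^ 2 := by
    rw [← sq_abs]; nlinarith [sq_nonneg (z.c2 t)]
  calc _ ≤ (1 / 4 : ℝ)⁻¹ := inv_anti₀ (by norm_num) h
    _ = 4 := by norm_num

theorem Sg_le (ht : t ∈ Set.Icc z.t0 1) : |z.Sg t| ≤ z.N := by
  obtain ⟨h1, h2⟩ := kap_bd (z := z)
  have h3 := Sig_le ht
  have hS := Sig_nonneg ht
  have hL := z.lam_ge
  have h4 : z.N / z.lam ≤ z.N / 10 ^ 5 := by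
    have := z.N_pos
    gcongr
  have h5 : 0 ≤ z.N / z.lam := by have := z.N_pos; have := z.lam_pos; positivity
  have hN := z.N_big
  rw [Sg_eq, abs_le]
  constructor <;> linarith

theorem lam12_le : 10 * z.lam ^ 12 ≤ z.N := by
  have hL := z.lam_ge
  have h := z.hN
  have : (10 : ℝ) ≤ z.lam ^ 8 := by
    calc (10 : ℝ) ≤ (10 ^ 5) ^ 8 := by norm_num
      _ ≤ _ := by gcongr
  have h0 : 0 < z.lam ^ 12 := by have := z.lam_pos; positivity
  calc _ ≤ z.lam ^ 8 * z.lam ^ 12 := by gcongr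
    _ = z.lam ^ 20 := by ring
    _ ≤ _ := h

theorem lam_le12 : z.lam ≤ z.lam ^ 12 :=
  le_self_pow₀ (by linarith [z.lam_ge]) (by norm_num)

theorem k_le (ht : t ∈ Set.Icc z.t0 1) : |z.k1 t| ≤ z.N ∧ |z.k2 t| ≤ z.N := by
  obtain ⟨g1, g2⟩ := z.bg t (mem_ts ht)
  obtain ⟨hG, hG'⟩ := G_bd ht
  have hL := z.lam_ge
  have hp := z.lam_pos
  have hG0 : 0 ≤ z.G t := le_trans (by positivity) hG
  have h1 : |z.a1 t| ≤ 2 * z.lam := by have := abs_le.1 (abs_a1_near ht); linarith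
  have h2 : |z.a2 t| ≤ 2 * z.lam := by
    have := abs_le.1 (a2_near ht); rw [abs_le]; constructor <;> linarith
  have h12 := z.lam12_le
  have h12' := z.lam_le12
  have e : 11 / 10 * z.lam ^ 10 * (2 * z.lam) ≤ 3 * z.lam ^ 12 := by
    have : 0 < z.lam ^ 11 := by positivity
    nlinarith
  rw [k1, k2]
  constructor
  · refine (abs_add_le _ _).trans ?_
    rw [abs_mul, abs_of_nonneg hG0]
    have : z.G t * |z.a1 t| ≤ 11 / 10 * z.lam ^ 10 * (2 * z.lam) := by gcongr
    have : 0 < z.lam ^ 12 := by positivity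
    linarith
  · refine (abs_add_le _ _).trans ?_
    rw [abs_mul, abs_of_nonneg hG0]
    have : z.G t * |z.a2 t| ≤ 11 / 10 * z.lam ^ 10 * (2 * z.lam) := by gcongr
    have : 0 < z.lam ^ 12 := by positivity
    linarith

theorem A_le (ht : t ∈ Set.Icc z.t0 1) :
    |z.al' t| ≤ z.N ∧ |z.be' t| ≤ z.N ∧ |z.et' t| ≤ z.N := by
  obtain ⟨hal, hbe, het⟩ := z.bA t (mem_ts ht)
  obtain ⟨hG, hG'⟩ := G_bd ht
  have hL := z.lam_ge
  have hp := z.lam_pos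
  have hG0 : 0 ≤ z.G t := le_trans (by positivity) hG
  have hr0 : 0 ≤ z.r t := (inv_pos.2 (z.pos t)).le
  have h1 : |z.a1 t| ≤ 2 := by have := abs_le.1 (abs_a1_near ht); linarith
  have h2 : |z.a2 t| ≤ 2 * z.lam := by
    have := abs_le.1 (a2_near ht); rw [abs_le]; constructor <;> linarith
  have h12 := z.lam12_le
  have h12' := z.lam_le12
  have h12p : 0 < z.lam ^ 12 := by positivity
  have key : ∀ X : ℝ, |X| ≤ 8 * z.lam ^ 2 → |z.G t * z.r t * X| ≤ 9 * z.lam ^ 12 := by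
    intro X hX
    rw [abs_mul, abs_of_nonneg (mul_nonneg hG0 hr0)]
    calc _ ≤ 11 / 10 * z.lam ^ 10 * (z.lam ^ 2)⁻¹ * (8 * z.lam ^ 2) := by
          gcongr; exact (r_bd ht).2
      _ = 88 / 10 * z.lam ^ 10 := by field_simp; norm_num
      _ ≤ 9 * z.lam ^ 12 := by
        have : z.lam ^ 10 ≤ z.lam ^ 12 := pow_le_pow_right₀ (by linarith) (by norm_num)
        have : 0 < z.lam ^ 10 := by positivity
        linarith
  have sq : z.lam ≤ z.lam ^ 2 := le_self_pow₀ (by linarith) (by norm_num)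
  have sq1 : 1 ≤ z.lam ^ 2 := by linarith
  rw [al', be', et']
  refine ⟨(abs_add_le _ _).trans ?_, (abs_add_le _ _).trans ?_, (abs_sub _ _).trans ?_⟩
  · have := key (z.a1 t ^ 2 * z.a2 t) (by
      rw [abs_mul, abs_pow]
      calc _ ≤ 2 ^ 2 * (2 * z.lam) := by gcongr
        _ ≤ _ := by linarith)
    linarith
  · have := key (z.a1 t * z.a2 t ^ 2) (by
      rw [abs_mul, abs_pow]
      calc _ ≤ 2 * (2 * z.lam) ^ 2 := by gcongr
        _ = _ := by ring)
    linarith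
  · have := key (z.a1 t ^ 3) (by
      rw [abs_pow]
      calc _ ≤ (2 : ℝ) ^ 3 := by gcongr
        _ ≤ _ := by linarith)
    linarith

end St

end Window

section Growth

namespace St

variable {z : St} {t : ℝ}

theorem gam_eq (t : ℝ) : z.gam t = (z.c1 t * (z.g2 t * z.c1 t - z.g1 t * z.c2 t) +
    (-z.s * z.c1 t) * z.G t * (z.N + z.lam)) * (z.c1 t ^ 2 + z.c2 t ^ 2)⁻¹ := by
  rw [gam, k1, k2]
  linear_combination (z.c1 t * z.G t * (z.c1 t ^ 2 + z.c2 t ^ 2)⁻¹) * z.cross_c t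

theorem gam_ge_aux (ht : t ∈ Set.Icc z.t0 1) :
    -(2 * z.lam) + (-z.s * z.c1 t) * z.G t * (z.N + z.lam) * (z.c1 t ^ 2 + z.c2 t ^ 2)⁻¹ ≤
      z.gam t := by
  obtain ⟨g1, g2⟩ := z.bg t (mem_ts ht)
  have hp := z.lam_pos
  have hc := z.cpos t
  have h1 : |z.c1 t * (z.g2 t * z.c1 t - z.g1 t * z.c2 t)| ≤
      2 * z.lam * (z.c1 t ^ 2 + z.c2 t ^ 2) := by
    rw [abs_mul]
    have : |z.g2 t * z.c1 t - z.g1 t * z.c2 t| ≤ z.lam * |z.c1 t| + z.lam * |z.c2 t| := by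
      refine (abs_sub _ _).trans ?_
      rw [abs_mul, abs_mul]
      gcongr
    calc _ ≤ |z.c1 t| * (z.lam * |z.c1 t| + z.lam * |z.c2 t|) := by gcongr
      _ = z.lam * (|z.c1 t| ^ 2 + |z.c1 t| * |z.c2 t|) := by ring
      _ ≤ z.lam * (2 * (|z.c1 t| ^ 2 + |z.c2 t| ^ 2)) := by
        gcongr; nlinarith [sq_nonneg (|z.c1 t| - |z.c2 t|), sq_nonneg (z.c2 t), sq_abs (z.c2 t)]
      _ = _ := by rw [sq_abs, sq_abs]; ring
  have h2 := (abs_le.1 h1).1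
  have h3 : -(2 * z.lam) ≤ z.c1 t * (z.g2 t * z.c1 t - z.g1 t * z.c2 t) *
      (z.c1 t ^ 2 + z.c2 t ^ 2)⁻¹ := by
    rw [← div_eq_mul_inv, le_div_iff₀ hc]; linarith
  rw [gam_eq, add_mul]
  linarith

theorem G_pos (t : ℝ) : 0 < z.G t := mul_pos (pow_pos z.lam_pos _) (exp_pos _)

theorem gam_ge (ht : t ∈ Set.Icc z.t0 1) : -(2 * z.lam) ≤ z.gam t := by
  refine le_trans ?_ (gam_ge_aux ht)
  have h1 := (c1_bd ht).1
  have hS := Sig_nonneg ht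
  have hc := z.cpos t
  have hG := G_pos (z := z) t
  have : 0 ≤ (-z.s * z.c1 t) * z.G t * (z.N + z.lam) * (z.c1 t ^ 2 + z.c2 t ^ 2)⁻¹ := by
    have := z.N_pos
    have := z.lam_pos
    have : 0 ≤ -z.s * z.c1 t := by linarith
    positivity
  linarith

theorem gam_ge_mid (ht : t ∈ Set.Icc z.t0 1) (h : |z.Sig t - z.N / z.lam| ≤ z.N / z.lam ^ 2) :
    z.lam ^ 11 / 20 ≤ z.gam t := by
  refine le_trans ?_ (gam_ge_aux ht)
  have hL := z.lam_ge
  have hp := z.lam_pos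
  have hN := z.N_pos
  have hNb := z.N_big
  obtain ⟨c1l, c1u⟩ := c1_bd ht
  have c2b := c2_bd ht
  have hG := (G_bd ht).1
  set M := z.N / z.lam with hM
  have hM1 : 10 ^ 90 ≤ M := by rw [hM, le_div_iff₀ hp]; linarith
  have hNM : z.N = M * z.lam := by rw [hM]; field_simp
  have e2 : z.N / z.lam ^ 2 = M / z.lam := by rw [hM]; field_simp
  have hML : M / z.lam ≤ M / 10 ^ 5 := by gcongr
  rw [e2] at h
  obtain ⟨h1, h2⟩ := abs_le.1 h
  have hD : |z.N - z.Sig t * z.lam| ≤ M := by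
    have : z.N - z.Sig t * z.lam = -((z.Sig t - M) * z.lam) := by rw [hNM]; ring
    rw [this, abs_neg, abs_mul, abs_of_pos hp]
    calc _ ≤ M / z.lam * z.lam := by gcongr
      _ = M := by field_simp
  have hc2 : |z.c2 t| ≤ 11 / 10 * M := by
    have := abs_add_le (z.c2 t - (z.N - z.Sig t * z.lam)) (z.N - z.Sig t * z.lam)
    rw [sub_add_cancel] at this
    linarith
  have hc1 : -z.s * z.c1 t ≤ 13 / 10 * M := by linarith
  have hc1' : 8 / 10 * M ≤ -z.s * z.c1 t := by linarith
  have e1 : z.c1 t ^ 2 = (-z.s * z.c1 t) ^ 2 := by linear_combination (-z.c1 t ^ 2) * z.hs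
  have hc : z.c1 t ^ 2 + z.c2 t ^ 2 ≤ 4 * M ^ 2 := by
    rw [e1, ← sq_abs (z.c2 t)]
    have : (-z.s * z.c1 t) ^ 2 ≤ (13 / 10 * M) ^ 2 := by gcongr; linarith
    have : |z.c2 t| ^ 2 ≤ (11 / 10 * M) ^ 2 := by gcongr
    nlinarith
  have hinv : (4 * M ^ 2)⁻¹ ≤ (z.c1 t ^ 2 + z.c2 t ^ 2)⁻¹ := inv_anti₀ (z.cpos t) hc
  have hMp : 0 < M := by linarith
  have hmain : 18 / 100 * z.lam ^ 11 ≤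
      (-z.s * z.c1 t) * z.G t * (z.N + z.lam) * (z.c1 t ^ 2 + z.c2 t ^ 2)⁻¹ := by
    calc 18 / 100 * z.lam ^ 11 = (8 / 10 * M) * (9 / 10 * z.lam ^ 10) * (M * z.lam) *
          (4 * M ^ 2)⁻¹ := by field_simp; norm_num
      _ ≤ _ := by
        have : 0 ≤ -z.s * z.c1 t := by linarith
        have := G_pos (z := z) t
        gcongr
        linarith
  have : z.lam ^ 11 = z.lam ^ 10 * z.lam := by ring
  have h10 : (10 ^ 5 : ℝ) ^ 10 ≤ z.lam ^ 10 := by gcongr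
  have : 10 ^ 50 * z.lam ≤ z.lam ^ 11 := by
    rw [this]; norm_num at h10 ⊢; gcongr
  linarith

theorem hn_one : z.hn 1 = 0 := prim_one _ _

theorem hn_le_one (ht : t ∈ Set.Icc z.t0 1) : z.hn t ≤ 1 := by
  have h := sub_le_of_deriv_ge ht.2 z.dhn fun u hu =>
    gam_ge (z := z) ⟨ht.1.trans hu.1, hu.2⟩
  rw [hn_one] at h
  have h1 := eps_small ht
  have h2 : z.lam ≤ z.lam ^ 3 := le_self_pow₀ (by linarith [z.lam_ge]) (by norm_num)
  have h3 : z.lam * (1 - t) ≤ z.lam ^ 3 * (1 - t) :=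
    mul_le_mul_of_nonneg_right h2 (by linarith [ht.2])
  linarith

theorem exists_resonance :
    ∃ u v, 1 - 3 * z.lam⁻¹ ^ 9 ≤ u ∧ u ≤ v ∧ v ≤ 1 ∧ v - u = z.lam⁻¹ ^ 10 / 2 ∧
      ∀ w ∈ Set.Icc u v, |z.Sig w - z.N / z.lam| ≤ z.N / z.lam ^ 2 := by
  have hp := z.lam_pos
  have hL := z.lam_ge
  have hN := z.N_pos
  have hi : 0 < z.lam⁻¹ ^ 9 := by positivity
  have hi10 : z.lam⁻¹ ^ 10 ≤ z.lam⁻¹ ^ 9 :=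
    pow_le_pow_of_le_one (by positivity) (inv_le_one_of_one_le₀ (by linarith)) (by norm_num)
  have hi10' : 0 < z.lam⁻¹ ^ 10 := by positivity
  have hcont : Continuous z.Sig := continuous_const.sub z.sSg.continuous
  have hmem : 1 - 2 * z.lam⁻¹ ^ 9 ∈ Set.Icc z.t0 1 := by
    rw [t0]; constructor <;> linarith
  have hlo : z.N / z.lam ≤ z.Sig (1 - 2 * z.lam⁻¹ ^ 9) := by
    refine le_trans (le_of_eq ?_) (Sig_bd hmem).1
    field_simp; ring
  have h1 : z.Sig 1 = 0 := sub_self _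
  obtain ⟨v, hv, hve⟩ := intermediate_value_Icc' hmem.2 hcont.continuousOn
    (show z.N / z.lam ∈ Set.Icc (z.Sig 1) _ from ⟨by rw [h1]; positivity, hlo⟩)
  refine ⟨v - z.lam⁻¹ ^ 10 / 2, v, by linarith [hv.1], by linarith, hv.2, by ring, fun w hw => ?_⟩
  rw [← hve]
  have hd : ∀ u, HasDerivAt z.Sig (-z.dSg u) u := fun u => (z.dSg_hasDeriv u).const_sub _
  refine (abs_sub_le_of_deriv (m := 2 * (z.N * z.lam ^ 8)) hw.2 hd fun u hu => ?_).trans ?_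
  · have hu' : u ∈ Set.Icc z.t0 1 := by
      rw [t0]; constructor <;> linarith [hw.1, hu.1, hv.1, hu.2, hv.2]
    obtain ⟨d1, d2⟩ := dSg_bd hu'
    have : 0 ≤ z.N * z.lam ^ 8 / 2 := by positivity
    rw [abs_neg, abs_of_nonneg (by linarith)]
    exact d2
  · calc 2 * (z.N * z.lam ^ 8) * (v - w) ≤ 2 * (z.N * z.lam ^ 8) * (z.lam⁻¹ ^ 10 / 2) := by
          gcongr; linarith [hw.1]
      _ = _ := by field_simp

theorem hn_le (ht : t ∈ Set.Icc z.t0 1) (ht' : t ≤ 1 - 3 * z.lam⁻¹ ^ 9) :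
    z.hn t ≤ -(z.lam / 100) := by
  obtain ⟨u, v, hu, huv, hv, hd, hw⟩ := exists_resonance (z := z)
  have hm : ∀ w, t ≤ w → w ≤ 1 → w ∈ Set.Icc z.t0 1 := fun w h1 h2 => ⟨ht.1.trans h1, h2⟩
  have h1 := sub_le_of_deriv_ge (m := -(2 * z.lam)) (ht'.trans hu) z.dhn fun w hw =>
    gam_ge (hm w hw.1 (hw.2.trans (huv.trans hv)))
  have h2 := sub_le_of_deriv_ge huv z.dhn fun w hw' =>
    gam_ge_mid (hm w ((ht'.trans hu).trans hw'.1) (hw'.2.trans hv)) (hw w hw')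
  have h3 := sub_le_of_deriv_ge (m := -(2 * z.lam)) hv z.dhn fun w hw =>
    gam_ge (hm w ((ht'.trans hu).trans (huv.trans hw.1)) hw.2)
  rw [hn_one] at h3
  have hp := z.lam_pos
  have hL := z.lam_ge
  have e : z.lam ^ 11 / 20 * (v - u) = z.lam / 40 := by rw [hd]; field_simp; norm_num
  rw [e] at h2
  have h4 := eps_small ht
  have h5 : z.lam ≤ z.lam ^ 3 := le_self_pow₀ (by linarith) (by norm_num)
  have h6 : z.lam * (1 - t) ≤ z.lam ^ 3 * (1 - t) :=
    mul_le_mul_of_nonneg_right h5 (by linarith [ht.2])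
  have h7 : 0 ≤ z.lam * (v - u) := by
    have : 0 ≤ v - u := by linarith
    positivity
  linarith

end St

end Growth

section NextLayer

theorem exists_bound_deriv_ch : ∃ K, 0 ≤ K ∧ ∀ x, |deriv ch x| ≤ K := by
  obtain ⟨K, hK⟩ := bd_ch.deriv.bound
  exact ⟨K, (abs_nonneg _).trans (hK 0), hK⟩

/-- A bound for the derivative of the cutoff. -/
noncomputable def chK : ℝ := exists_bound_deriv_ch.choose

theorem chK_nonneg : 0 ≤ chK := exists_bound_deriv_ch.choose_spec.1
theorem abs_deriv_ch (x : ℝ) : |deriv ch x| ≤ chK := exists_bound_deriv_ch.choose_spec.2 x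

theorem abs_ch_le (x : ℝ) : |ch x| ≤ 1 := by
  rw [ch, abs_of_nonneg (Real.smoothTransition.nonneg _)]
  exact Real.smoothTransition.le_one _

namespace St

variable (z : St)

/-- Temporal cutoff of the next layer. -/
noncomputable def ze (t : ℝ) : ℝ := ch ((1 - t) * z.lam ^ 9 * (3 / 10) - 2 / 5)

theorem sze : Sm z.ze := sm_ch.comp (by fun_prop)

theorem dze (t : ℝ) : HasDerivAt z.ze
    (deriv ch ((1 - t) * z.lam ^ 9 * (3 / 10) - 2 / 5) * (-z.lam ^ 9 * (3 / 10))) t := by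
  have h1 : HasDerivAt (fun t => (1 - t) * z.lam ^ 9 * (3 / 10) - 2 / 5) (-z.lam ^ 9 * (3 / 10)) t := by
    have := ((((hasDerivAt_id t).const_sub 1).mul_const (z.lam ^ 9)).mul_const (3 / 10)).sub_const (2/5)
    simpa using this
  exact HasDerivAt.comp t (sm_ch.diff _).hasDerivAt h1

theorem inv_pow_mul : z.lam⁻¹ ^ 9 * z.lam ^ 9 = 1 := by
  have := z.lam_pos
  field_simp

variable {z} {t : ℝ}

theorem ze_zero (ht : t < 1 - 23 / 6 * z.lam⁻¹ ^ 9) : z.ze t = 0 := by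
  have hp : 0 < z.lam ^ 9 := by have := z.lam_pos; positivity
  have : 23 / 6 * z.lam⁻¹ ^ 9 * z.lam ^ 9 ≤ (1 - t) * z.lam ^ 9 := by gcongr; linarith
  rw [mul_assoc, z.inv_pow_mul] at this
  refine ch_zero ?_
  rw [le_abs]; left; linarith

theorem ze_one (ht : t ∈ Set.Icc (1 - 3 * z.lam⁻¹ ^ 9) 1) : z.ze t = 1 := by
  have hp : 0 < z.lam ^ 9 := by have := z.lam_pos; positivity
  have h1 : (1 - t) * z.lam ^ 9 ≤ 3 * z.lam⁻¹ ^ 9 * z.lam ^ 9 := by gcongr; linarith [ht.1]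
  rw [mul_assoc, z.inv_pow_mul] at h1
  have h2 : 0 ≤ (1 - t) * z.lam ^ 9 := mul_nonneg (by linarith [ht.2]) hp.le
  refine ch_one ?_
  rw [abs_le]; constructor <;> linarith

theorem deriv_ze_zero (ht : t ∈ Set.Ioc (1 - 3 * z.lam⁻¹ ^ 9) 1) : deriv z.ze t = 0 := by
  have hp : 0 < z.lam ^ 9 := by have := z.lam_pos; positivity
  have h1 : (1 - t) * z.lam ^ 9 < 3 * z.lam⁻¹ ^ 9 * z.lam ^ 9 := by gcongr; linarith [ht.1]
  rw [mul_assoc, z.inv_pow_mul] at h1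
  have h2 : 0 ≤ (1 - t) * z.lam ^ 9 := mul_nonneg (by linarith [ht.2]) hp.le
  rw [(z.dze t).deriv, deriv_ch (Or.inl (by rw [abs_lt]; constructor <;> linarith)), zero_mul]

theorem abs_deriv_ze (t : ℝ) : |deriv z.ze t| ≤ chK * z.N := by
  have hp := z.lam_pos
  have h9 : z.lam ^ 9 ≤ z.lam ^ 12 := pow_le_pow_right₀ (by linarith [z.lam_ge]) (by norm_num)
  have h12 := z.lam12_le
  have h0 : 0 < z.lam ^ 9 := by positivity
  rw [(z.dze t).deriv, abs_mul]
  have : |-z.lam ^ 9 * (3 / 10)| ≤ z.N := by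
    rw [abs_mul, abs_neg, abs_of_pos h0, abs_of_pos (by norm_num : (0:ℝ) < 3 / 10)]; linarith
  have := chK_nonneg
  gcongr
  exact abs_deriv_ch _

/-- Amplitude of the next layer. -/
noncomputable def Gn (z : St) (t : ℝ) : ℝ := z.N ^ 10 * exp (z.hn t)

theorem sGn : Sm z.Gn := contDiff_const.mul z.shn.exp

theorem dGn (t : ℝ) : HasDerivAt z.Gn (z.gam t * z.Gn t) t := by
  refine (((z.dhn t).exp).const_mul (z.N ^ 10)).congr_deriv ?_
  rw [Gn]; ring

theorem Gn_le (ht : t ∈ Set.Icc z.t0 1) : |z.Gn t| ≤ 3 * z.N ^ 10 := by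
  have h1 : exp (z.hn t) ≤ exp 1 := exp_le_exp.2 (hn_le_one ht)
  have h2 := exp_one_lt_d9
  have h3 : 0 < z.N ^ 10 := pow_pos z.N_pos _
  rw [Gn, abs_of_pos (by positivity)]
  nlinarith

variable (z)

theorem t0_nonneg : 0 ≤ z.t0 := z.hts0.trans (by rw [t0]; exact z.hts.le)

theorem pow_le13 {k : ℕ} (hk : k ≤ 12) {C : ℝ} (hC : C ≤ 20) :
    C * z.N ^ k ≤ (4 + chK) * z.N ^ 13 := by
  have hN := z.N_big
  have hL := z.lam_ge
  have hN0 := z.N_pos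
  have hK := chK_nonneg
  calc C * z.N ^ k ≤ z.N * z.N ^ k := by gcongr; linarith
    _ = z.N ^ (k + 1) := by ring
    _ ≤ z.N ^ 13 := pow_le_pow_right₀ (by linarith) (by omega)
    _ ≤ _ := le_mul_of_one_le_left (by positivity) (by linarith)

theorem lin_bd {x y A B X Y L : ℝ} (hx : |x| ≤ X) (hy : |y| ≤ Y)
    (hA : |A| ≤ L) (hB : |B| ≤ L) :
    |-(A * x + B * y)| ≤ L * X + L * Y ∧ |-(A * x - B * y)| ≤ L * X + L * Y := by
  have h0 := (abs_nonneg _).trans hA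
  have h1 : |A * x| ≤ L * X := by rw [abs_mul]; gcongr
  have h2 : |B * y| ≤ L * Y := by rw [abs_mul]; gcongr
  rw [abs_neg, abs_neg]
  have := abs_add_le (A * x) (B * y)
  have := abs_sub (A * x) (B * y)
  exact ⟨by linarith, by linarith⟩

variable {z}

theorem a_le_N (ht : t ∈ Set.Icc z.t0 1) : |z.a1 t| ≤ z.N ∧ |z.a2 t| ≤ z.N := by
  have h1 := abs_le.1 (abs_a1_near ht)
  have h2 := abs_le.1 (a2_near ht)
  have hN := z.N_big
  have hL := z.lam_ge
  exact ⟨by linarith, abs_le.2 ⟨by linarith, by linarith⟩⟩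

theorem dc_le (ht : t ∈ Set.Icc z.t0 1) :
    |deriv z.c1 t| ≤ 11 * z.N ^ 2 ∧ |deriv z.c2 t| ≤ 11 * z.N ^ 2 := by
  obtain ⟨h1, h2, h3⟩ := A_le ht
  rw [(z.dc1 t).deriv, (z.dc2 t).deriv]
  exact ⟨((lin_bd (c1_le ht) (c2_le ht) h1 h3).1).trans_eq (by ring),
    ((lin_bd (c1_le ht) (c2_le ht) h2 h1).2).trans_eq (by ring)⟩

theorem da_le (ht : t ∈ Set.Icc z.t0 1) :
    |deriv (fun t => z.N ^ 3 * z.a1 t) t| ≤ 2 * z.N ^ 5 ∧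
    |deriv (fun t => z.N ^ 3 * z.a2 t) t| ≤ 2 * z.N ^ 5 := by
  obtain ⟨h1, h2, h3⟩ := A_le ht
  obtain ⟨h4, h5⟩ := a_le_N ht
  have hN : 0 < z.N ^ 3 := pow_pos z.N_pos _
  rw [((z.da1' t).const_mul _).deriv, ((z.da2' t).const_mul _).deriv, abs_mul, abs_mul,
    abs_of_pos hN]
  constructor
  · calc _ ≤ z.N ^ 3 * (z.N * z.N + z.N * z.N) := by gcongr; exact (lin_bd h4 h5 h1 h3).1
      _ = _ := by ring
  · calc _ ≤ z.N ^ 3 * (z.N * z.N + z.N * z.N) := by gcongr; exact (lin_bd h4 h5 h2 h1).2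
      _ = _ := by ring

variable (z)

/-- The next layer. -/
noncomputable def layer (M : ℝ) (hM : 1 ≤ M) : LD where
  N := M
  lam := (4 + chK) * z.N ^ 13
  t0 := z.t0
  t1 := 1 - 23 / 6 * z.lam⁻¹ ^ 9
  p1 := z.c1
  p2 := z.c2
  w1 := fun t => z.N ^ 3 * z.a1 t
  w2 := fun t => z.N ^ 3 * z.a2 t
  g1 := z.k1
  g2 := z.k2
  G := z.Gn
  ze := z.ze
  al := z.al'
  be := z.be'
  et := z.et'
  hN := hM
  hlam := by have := z.pow_le13 (k := 0) (by norm_num) (C := 1) (by norm_num); linarith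
  ht0 := z.t0_nonneg
  ht1 := by
    have : 0 < z.lam⁻¹ ^ 9 := by have := z.lam_pos; positivity
    rw [t0]; linarith
  sp1 := z.sc1
  sp2 := z.sc2
  sw1 := contDiff_const.mul z.sa1
  sw2 := contDiff_const.mul z.sa2
  sg1 := z.sk1
  sg2 := z.sk2
  sG := sGn
  sze := z.sze
  hp := z.cpos
  bp1 t ht := by
    have := z.pow_le13 (k := 1) (by norm_num) (C := 1) (by norm_num)
    have := c1_le ht; linarith
  bp2 t ht := by
    have := z.pow_le13 (k := 1) (by norm_num) (C := 10) (by norm_num)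
    have := c2_le ht; linarith
  bw1 t ht := by
    have := z.pow_le13 (k := 4) (by norm_num) (C := 1) (by norm_num)
    have h3 : 0 < z.N ^ 3 := pow_pos z.N_pos _
    rw [abs_mul, abs_of_pos h3]
    have := mul_le_mul_of_nonneg_left (a_le_N ht).1 h3.le
    linarith [pow_succ z.N 3]
  bw2 t ht := by
    have := z.pow_le13 (k := 4) (by norm_num) (C := 1) (by norm_num)
    have h3 : 0 < z.N ^ 3 := pow_pos z.N_pos _
    rw [abs_mul, abs_of_pos h3]
    have := mul_le_mul_of_nonneg_left (a_le_N ht).2 h3.le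
    linarith [pow_succ z.N 3]
  bg1 t ht := by
    have := z.pow_le13 (k := 1) (by norm_num) (C := 1) (by norm_num)
    have := (k_le ht).1; linarith
  bg2 t ht := by
    have := z.pow_le13 (k := 1) (by norm_num) (C := 1) (by norm_num)
    have := (k_le ht).2; linarith
  bG t ht := (Gn_le ht).trans (z.pow_le13 (by norm_num) (by norm_num))
  bze t _ := by
    have := z.pow_le13 (k := 0) (by norm_num) (C := 1) (by norm_num)
    have : |z.ze t| ≤ 1 := abs_ch_le _
    linarith
  br t ht := by
    have := z.pow_le13 (k := 0) (by norm_num) (C := 4) (by norm_num)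
    rw [abs_of_pos (inv_pos.2 (z.cpos t))]
    have := rn_le ht; linarith
  bp1' t ht := (dc_le ht).1.trans (z.pow_le13 (by norm_num) (by norm_num))
  bp2' t ht := (dc_le ht).2.trans (z.pow_le13 (by norm_num) (by norm_num))
  bw1' t ht := (da_le ht).1.trans (z.pow_le13 (by norm_num) (by norm_num))
  bw2' t ht := (da_le ht).2.trans (z.pow_le13 (by norm_num) (by norm_num))
  bze' t _ := by
    refine (abs_deriv_ze t).trans ?_
    have hN : z.N ≤ z.N ^ 13 :=
      le_self_pow₀ (by linarith [z.N_big, z.lam_ge]) (by norm_num)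
    have := chK_nonneg
    have := z.N_pos
    have : 0 < z.N ^ 13 := by positivity
    nlinarith
  ze0 t ht := ze_zero ht
  dp1 := z.dc1
  dp2 := z.dc2
  dw1 t := ((z.da1' t).const_mul _).congr_deriv (by ring)
  dw2 t := ((z.da2' t).const_mul _).congr_deriv (by ring)
  dG := dGn

variable {z}

theorem layer_small {m : ℕ} {M : ℝ} (hM : 1 ≤ M)
    (h : chK * z.N ^ 11 * M ^ m ≤ exp (z.lam / 100)) (ht : t ∈ Set.Icc z.t0 1) :
    |z.Gn t * deriv z.ze t| ≤ M⁻¹ ^ m := by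
  have hM0 : 0 < M := by linarith
  have hp : 0 < M⁻¹ ^ m := by positivity
  rcases lt_or_ge (1 - 3 * z.lam⁻¹ ^ 9) t with h1 | h1
  · rw [deriv_ze_zero ⟨h1, ht.2⟩, mul_zero, abs_zero]; exact hp.le
  · have h2 : exp (z.hn t) ≤ exp (-(z.lam / 100)) := exp_le_exp.2 (hn_le ht h1)
    have hK := chK_nonneg
    have hN := z.N_pos
    rw [abs_mul, Gn, abs_of_pos (by positivity)]
    calc _ ≤ z.N ^ 10 * exp (-(z.lam / 100)) * (chK * z.N) := by
          gcongr; exact abs_deriv_ze t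
      _ = chK * z.N ^ 11 * M ^ m * exp (-(z.lam / 100)) * M⁻¹ ^ m := by
        rw [inv_pow]; field_simp
      _ ≤ exp (z.lam / 100) * exp (-(z.lam / 100)) * M⁻¹ ^ m := by gcongr
      _ = M⁻¹ ^ m := by rw [← exp_add]; simp

theorem contained (ht : t ∈ Set.Icc z.t0 1) {x : ℝ × ℝ}
    (h1 : |z.c1 t * x.1 + z.c2 t * x.2| ≤ 3 / 4)
    (h2 : |z.N ^ 3 * z.a1 t * x.1 + z.N ^ 3 * z.a2 t * x.2| ≤ 3 / 4) :
    |z.a1 t * x.1 + z.a2 t * x.2| < 1 / (16 * z.N) ∧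
    |z.b1 t * x.1 + z.b2 t * x.2| < 1 / (2 * z.lam ^ 3) ∧ |x.1| ≤ 3 / 5 ∧ |x.2| ≤ 3 / 5 := by
  have hN := z.N_pos
  have hNb := z.N_big
  have hL := z.lam_ge
  have hp := z.lam_pos
  set A := z.a1 t * x.1 + z.a2 t * x.2 with hA
  set X := z.c1 t * x.1 + z.c2 t * x.2 with hX
  have e : z.N ^ 3 * z.a1 t * x.1 + z.N ^ 3 * z.a2 t * x.2 = z.N ^ 3 * A := by rw [hA]; ring
  have h3 : 0 < z.N ^ 3 := by positivity
  have hN10 : (10 : ℝ) ^ 90 ≤ z.N := by linarith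
  rw [e, abs_mul, abs_of_pos h3] at h2
  have hA2 : |A| * (z.N * z.N) ≤ 1 / 1000 := by
    have h0 := abs_nonneg A
    have : |A| * (z.N * z.N) * 1000 ≤ |A| * (z.N * z.N) * z.N := by gcongr; linarith
    have : |A| * (z.N * z.N) * z.N = z.N ^ 3 * |A| := by ring
    linarith
  have hA1 : |A| * z.N ≤ 1 / 1000 := by
    have h0 := abs_nonneg A
    have : |A| * z.N * 1 ≤ |A| * z.N * z.N := by gcongr; linarith
    linarith
  have hA0 : |A| ≤ 1 / 1000 := by
    have h0 := abs_nonneg A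
    have : |A| * 1 ≤ |A| * z.N := by gcongr; linarith
    linarith
  have hk := (kap_bd (z := z)).1
  have hk0 : 0 < z.kap := lt_of_lt_of_le (by positivity) hk
  have hS := Sg_le ht
  have hcr := z.cross_c t
  have hD : |(-z.s * (z.N + z.lam))| = z.N + z.lam := by
    rw [abs_mul, abs_neg, abs_s, one_mul, abs_of_pos (by linarith)]
  have ha1 : |z.a1 t| ≤ 2 := by have := abs_le.1 (abs_a1_near ht); linarith
  have ha2 : |z.a2 t| ≤ 2 * z.lam := by
    have := abs_le.1 (a2_near ht); rw [abs_le]; constructor <;> linarith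
  have hc1 := c1_le ht
  have hc2 := c2_le ht
  refine ⟨?_, ?_, ?_, ?_⟩
  · rw [lt_div_iff₀ (by positivity)]; linarith
  · have hb : z.kap * (z.b1 t * x.1 + z.b2 t * x.2) = X - z.Sg t * A := by
      rw [hX, hA, c1, c2]; ring
    have hb' : z.kap * |z.b1 t * x.1 + z.b2 t * x.2| ≤ 1 := by
      rw [← abs_of_pos hk0, ← abs_mul, hb]
      refine (abs_sub _ _).trans ?_
      rw [abs_mul]
      have : |z.Sg t| * |A| ≤ z.N * |A| := by gcongr
      linarith
    have h4 : 2 * z.lam ^ 3 < z.kap := by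
      refine lt_of_lt_of_le ?_ hk
      have h12 := z.lam12_le
      rw [div_mul_eq_mul_div, lt_div_iff₀ hp]
      have : z.lam ^ 4 ≤ z.lam ^ 12 := pow_le_pow_right₀ (by linarith) (by norm_num)
      have h40 : 0 < z.lam ^ 4 := by positivity
      calc 2 * z.lam ^ 3 * z.lam = 2 * z.lam ^ 4 := by ring
        _ < _ := by linarith
    rw [lt_div_iff₀ (by positivity)]
    rcases (abs_nonneg (z.b1 t * x.1 + z.b2 t * x.2)).eq_or_lt with h0 | h0
    · rw [← h0, zero_mul]; norm_num
    · calc _ < |z.b1 t * x.1 + z.b2 t * x.2| * z.kap := by gcongr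
        _ ≤ 1 := by linarith
  · have e1 : (-z.s * (z.N + z.lam)) * x.1 = z.a2 t * X - z.c2 t * A := by
      rw [← hcr, hX, hA]; ring
    have : (z.N + z.lam) * |x.1| ≤ 2 * z.lam * (3 / 4) + 10 * z.N * |A| := by
      rw [← hD, ← abs_mul, e1]
      refine (abs_sub _ _).trans ?_
      rw [abs_mul, abs_mul]; gcongr
    by_contra hc
    push Not at hc
    have : z.N * (3 / 5) ≤ (z.N + z.lam) * |x.1| := by gcongr; linarith
    linarith
  · have e1 : (-z.s * (z.N + z.lam)) * x.2 = z.c1 t * A - z.a1 t * X := by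
      rw [← hcr, hX, hA]; ring
    have : (z.N + z.lam) * |x.2| ≤ z.N * |A| + 2 * (3 / 4) := by
      rw [← hD, ← abs_mul, e1]
      refine (abs_sub _ _).trans ?_
      rw [abs_mul, abs_mul]; gcongr
    by_contra hc
    push Not at hc
    have : z.N * (3 / 5) ≤ (z.N + z.lam) * |x.2| := by gcongr; linarith
    linarith

end St

end NextLayer

section InductionStep

theorem Sp_eqOn {f g : S → ℝ} {U : Set S} (hU : IsOpen U) (h : ∀ y ∈ U, f y = g y) (i j : ℕ) :
    ∀ y ∈ U, Sp i j f y = Sp i j g y := by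
  induction i with
  | zero =>
    induction j with
    | zero => exact h
    | succ j ih => intro y hy; rw [Sp_zero_succ, Sp_zero_succ]; exact dd_eqOn hU _ ih y hy
  | succ i ih => intro y hy; rw [Sp_succ, Sp_succ]; exact dd_eqOn hU _ ih y hy

theorem Sp_zero_on {f : S → ℝ} {U : Set S} (hU : IsOpen U) (h : ∀ y ∈ U, f y = 0) (i j : ℕ) :
    ∀ y ∈ U, Sp i j f y = 0 := by
  induction i with
  | zero =>
    induction j with
    | zero => exact h
    | succ j ih => intro y hy; rw [Sp_zero_succ]; exact dd_zero_on hU _ ih y hy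
  | succ i ih => intro y hy; rw [Sp_succ]; exact dd_zero_on hU _ ih y hy

theorem dd_e2_lin {a b : ℝ → ℝ} (ha : Sm a) (hb : Sm b) (y : S) :
    dd e2 (fun y : S => a y.2 * y.1.1 + b y.2 * y.1.2) y = b y.2 := by
  rw [dd, show e2 = ((0, 1), 0) from rfl, fderiv_eq_of_line (sm_lin ha hb) (line_lin a b y (0, 1))]
  simp

theorem isOpen_before (c : ℝ) : IsOpen {y : S | y.2 < c} := isOpen_lt continuous_snd continuous_const

namespace St

variable {z : St} {t : ℝ}

theorem layer_jet (z : St) {M : ℝ} (hM : 1 ≤ M) {y : S} (hy : y.2 ≤ 1)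
    (h : y ∉ offSet (z.layer M hM)) :
    Jet z.φ y (-(z.et' y.2 * y.1.1 - z.al' y.2 * y.1.2)) (z.al' y.2 * y.1.1 + z.be' y.2 * y.1.2)
      (z.k1 y.2) (z.k2 y.2) ∧ y.2 ∈ Set.Icc z.t0 1 ∧ |y.1.1| ≤ 3 / 5 ∧ |y.1.2| ≤ 3 / 5 := by
  simp only [offSet, Set.mem_ofPred_eq, not_or, not_lt] at h
  have ht : y.2 ∈ Set.Icc z.t0 1 := ⟨(z.layer M hM).ht1.le.trans h.1, hy⟩
  obtain ⟨h1, h2, h3, h4⟩ := contained ht h.2.1 h.2.2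
  refine ⟨(z.jet y (mem_ts ht) h1 h2).congr ?_ ?_ rfl rfl, ht, h3, h4⟩
  · rw [et', al', G, r]; ring
  · rw [be', al', G, r]; ring

theorem next_time (z : St) : 1 - 3 * z.lam⁻¹ ^ 9 < 1 - 4 * z.N⁻¹ ^ 9 := by
  have hp := z.lam_pos
  have hN := z.N_big
  have h : z.N⁻¹ ≤ z.lam⁻¹ / 2 := by
    rw [show z.lam⁻¹ / 2 = (2 * z.lam)⁻¹ by field_simp]
    exact inv_anti₀ (by positivity) (by linarith)
  have h2 : z.N⁻¹ ^ 9 ≤ (z.lam⁻¹ / 2) ^ 9 := by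
    have := z.N_pos
    gcongr
  have : 0 < z.lam⁻¹ ^ 9 := by positivity
  have h3 : (z.lam⁻¹ / 2) ^ 9 = z.lam⁻¹ ^ 9 / 512 := by ring
  linarith

theorem window_sub (z : St) (ht : t ∈ Set.Icc (1 - 3 * z.lam⁻¹ ^ 9) 1) : t ∈ Set.Icc z.t0 1 := by
  have : 0 < z.lam⁻¹ ^ 9 := by have := z.lam_pos; positivity
  exact ⟨by rw [t0]; linarith [ht.1], ht.2⟩

/-- Adding a layer to a state. -/
noncomputable def next (z : St) (M : ℝ) (hM : 1 ≤ M) (hNM : z.N ^ 20 ≤ M) (ψ : S → ℝ) (hψ : Sm ψ)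
    (h0 : ∀ y ∈ offSet (z.layer M hM), ψ y = 0)
    (hJ : ∀ y : S, z.ze y.2 = 1 → |z.c1 y.2 * y.1.1 + z.c2 y.2 * y.1.2| < 1 / (16 * M) →
        |z.N ^ 3 * z.a1 y.2 * y.1.1 + z.N ^ 3 * z.a2 y.2 * y.1.2| < 1 / 2 →
        Jet ψ y (z.Gn y.2 * (z.c1 y.2 ^ 2 + z.c2 y.2 ^ 2)⁻¹ * z.c1 y.2 ^ 2 *
            (z.c1 y.2 * y.1.1 + z.c2 y.2 * y.1.2))
          (z.Gn y.2 * (z.c1 y.2 ^ 2 + z.c2 y.2 ^ 2)⁻¹ * z.c1 y.2 * z.c2 y.2 *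
            (z.c1 y.2 * y.1.1 + z.c2 y.2 * y.1.2))
          (z.Gn y.2 * z.c1 y.2) (z.Gn y.2 * z.c2 y.2)) : St where
  lam := z.N
  lamm := z.lam
  N := M
  s := -z.s
  ts := 1 - 3 * z.lam⁻¹ ^ 9
  a1 := z.c1
  a2 := z.c2
  b1 := z.a1
  b2 := z.a2
  h := z.hn
  g1 := z.k1
  g2 := z.k2
  al := z.al'
  be := z.be'
  et := z.et'
  φ := fun y => z.φ y + ψ y
  hs := by rw [neg_mul_neg]; exact z.hs
  hlamm := by linarith [z.lam_ge]
  hlam := by linarith [z.N_big, z.lam_pos]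
  hN := hNM
  hts0 := by
    have : 0 < z.lam⁻¹ ^ 9 := by have := z.lam_pos; positivity
    have := z.t0_nonneg
    rw [t0] at this; linarith
  hts := z.next_time
  sa1 := z.sc1
  sa2 := z.sc2
  sb1 := z.sa1
  sb2 := z.sa2
  sh := z.shn
  sg1 := z.sk1
  sg2 := z.sk2
  sal := z.sal'
  sbe := z.sbe'
  set := z.set'
  sφ := z.sφ.add hψ
  da1 := z.dc1
  da2 := z.dc2
  db1 := z.da1'
  db2 := z.da2'
  dh := z.dhn
  va1 := z.vc1
  va2 := z.vc2
  vb1 := by rw [z.va1, neg_neg]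
  vb2 := z.va2
  vh := hn_one
  cross := z.cross_c
  ba t ht := by
    have hw := z.window_sub ht
    have h1 := c1_le hw
    have h2 := c2_le hw
    have : 10 * z.N ≤ z.N ^ 2 := by nlinarith [z.N_big, z.lam_ge]
    constructor <;> linarith [z.N_pos]
  bb t ht := by
    obtain ⟨h1, h2⟩ := a_le_N (z.window_sub ht)
    have : 10 * z.N ≤ z.N ^ 2 := by nlinarith [z.N_big, z.lam_ge]
    constructor <;> linarith [z.N_pos]
  bg t ht := k_le (z.window_sub ht)
  bA t ht := A_le (z.window_sub ht)
  supp y hy hx := by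
    rw [z.supp y hy hx, h0 y, add_zero]
    by_contra hc
    obtain ⟨-, -, h1, h2⟩ := z.layer_jet hM hy hc
    rcases hx with hx | hx <;> linarith
  jet y ht h1 h2 := by
    have hw := z.window_sub ht
    have hN := z.N_pos
    have hNb := z.N_big
    have hL := z.lam_ge
    have e : z.N ^ 3 * z.a1 y.2 * y.1.1 + z.N ^ 3 * z.a2 y.2 * y.1.2 =
      z.N ^ 3 * (z.a1 y.2 * y.1.1 + z.a2 y.2 * y.1.2) := by ring
    have h3 : |z.N ^ 3 * z.a1 y.2 * y.1.1 + z.N ^ 3 * z.a2 y.2 * y.1.2| < 1 / 2 := by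
      rw [e, abs_mul, abs_of_pos (by positivity)]
      rw [lt_div_iff₀ (by positivity)] at h2
      linarith
    have h4 : |z.c1 y.2 * y.1.1 + z.c2 y.2 * y.1.2| ≤ 3 / 4 := by
      refine h1.le.trans ?_
      rw [div_le_div_iff₀ (by positivity) (by norm_num)]; linarith
    obtain ⟨j1, j2, -, -⟩ := contained hw h4 (h3.le.trans (by norm_num))
    refine ((z.jet y (mem_ts hw) j1 j2).add z.sφ hψ (hJ y (ze_one ht) h1 h3)).congr ?_ ?_ rfl rfl
    · rw [et', al', G, r, Gn]; ring
    · rw [be', al', G, r, Gn]; ring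

theorem be'_large (ht : t ∈ Set.Icc z.t0 1) : z.lam ^ 10 / 2 ≤ |z.be' t| := by
  obtain ⟨-, hbe, -⟩ := z.bA t (mem_ts ht)
  obtain ⟨hG, -⟩ := G_bd ht
  obtain ⟨hr, -⟩ := r_bd ht
  have h1 := abs_le.1 (abs_a1_near ht)
  have h2 := abs_le.1 (a2_near ht)
  have hL := z.lam_ge
  have hp := z.lam_pos
  have hG0 := G_pos (z := z) t
  have hr0 : 0 < z.r t := inv_pos.2 (z.pos t)
  have h3 : 7 / 10 * z.lam ^ 10 ≤ |z.G t * z.r t * (z.a1 t * z.a2 t ^ 2)| := by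
    rw [abs_mul, abs_mul, abs_mul, abs_of_pos hG0, abs_of_pos hr0, abs_pow, sq_abs]
    calc 7 / 10 * z.lam ^ 10 ≤ 9 / 10 * z.lam ^ 10 * (9 / 10 * (z.lam ^ 2)⁻¹) *
          (99 / 100 * (99 / 100 * z.lam) ^ 2) := by
          rw [show 9 / 10 * z.lam ^ 10 * (9 / 10 * (z.lam ^ 2)⁻¹) *
            (99 / 100 * (99 / 100 * z.lam) ^ 2) =
            9 / 10 * (9 / 10) * (99 / 100) * (99 / 100) ^ 2 * z.lam ^ 10 by field_simp]
          gcongr; norm_num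
      _ ≤ _ := by gcongr <;> linarith
  have h4 : 10 * z.lam ≤ z.lam ^ 10 := by
    have : (10 ^ 5 : ℝ) ^ 9 ≤ z.lam ^ 9 := by gcongr
    have e : z.lam ^ 10 = z.lam ^ 9 * z.lam := by ring
    rw [e]; gcongr; norm_num at this; linarith
  have h5 := abs_sub_abs_le_abs_sub (z.G t * z.r t * (z.a1 t * z.a2 t ^ 2)) (-z.be t)
  rw [abs_neg, sub_neg_eq_add, add_comm (z.G t * z.r t * (z.a1 t * z.a2 t ^ 2))] at h5
  rw [be']
  linarith

/-- Where the last layer is exactly a shear, below the scale of the next layer. -/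
theorem exists_large (z : St) {M : ℝ} (hM : 1 ≤ M) {ψ : S → ℝ} (hψ : Sm ψ)
    (h0 : ∀ y ∈ offSet (z.layer M hM), ψ y = 0) (ht : t ∈ Set.Ico z.t0 1) :
    ∃ x, z.lam ^ 10 / 2 ≤ |dd e2 (dd e1 (dd e2 (fun y => z.φ y + ψ y))) (x, t)| := by
  have hN := z.N_pos
  have hNb := z.N_big
  have hL := z.lam_ge
  have hne : z.s * (z.lam + z.lamm) ≠ 0 := mul_ne_zero z.s_ne (by linarith [z.hlamm])
  let x : ℝ × ℝ := ((z.s * (z.lam + z.lamm))⁻¹ * (1 / (32 * z.N)) * z.b2 t,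
    -((z.s * (z.lam + z.lamm))⁻¹ * (1 / (32 * z.N)) * z.b1 t))
  have hxa : z.a1 t * x.1 + z.a2 t * x.2 = 1 / (32 * z.N) := by
    have : z.a1 t * x.1 + z.a2 t * x.2 =
      (z.s * (z.lam + z.lamm))⁻¹ * (z.a1 t * z.b2 t - z.a2 t * z.b1 t) * (1 / (32 * z.N)) := by
      simp only [x]; ring
    rw [this, z.cross, inv_mul_cancel₀ hne, one_mul]
  have hxb : z.b1 t * x.1 + z.b2 t * x.2 = 0 := by simp only [x]; ring
  have htI : t ∈ Set.Icc z.t0 1 := ⟨ht.1, ht.2.le⟩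
  let U : Set S := {y | z.ts < y.2} ∩ {y | y.2 < 1} ∩
    {y | |z.a1 y.2 * y.1.1 + z.a2 y.2 * y.1.2| < 1 / (16 * z.N)} ∩
    {y | |z.b1 y.2 * y.1.1 + z.b2 y.2 * y.1.2| < 1 / (2 * z.lam ^ 3)}
  have hU : IsOpen U := by
    refine (((isOpen_lt continuous_const continuous_snd).inter (isOpen_before 1)).inter ?_).inter ?_
    · exact isOpen_lt (sm_lin z.sa1 z.sa2).continuous.abs continuous_const
    · exact isOpen_lt (sm_lin z.sb1 z.sb2).continuous.abs continuous_const
  have hxU : (x, t) ∈ U := by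
    refine ⟨⟨⟨?_, ht.2⟩, ?_⟩, ?_⟩
    · exact lt_of_lt_of_le z.hts ht.1
    · change |z.a1 t * x.1 + z.a2 t * x.2| < _
      rw [hxa, abs_of_pos (by positivity), div_lt_div_iff₀ (by positivity) (by positivity)]
      linarith
    · change |z.b1 t * x.1 + z.b2 t * x.2| < _
      have := z.lam_pos
      rw [hxb, abs_zero]; positivity
  have hxO : (x, t) ∈ offSet (z.layer M hM) := by
    right; right
    change 3 / 4 < |z.N ^ 3 * z.a1 t * x.1 + z.N ^ 3 * z.a2 t * x.2|
    have e : z.N ^ 3 * z.a1 t * x.1 + z.N ^ 3 * z.a2 t * x.2 = z.N ^ 2 / 32 := by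
      rw [show z.N ^ 3 * z.a1 t * x.1 + z.N ^ 3 * z.a2 t * x.2 =
        z.N ^ 3 * (z.a1 t * x.1 + z.a2 t * x.2) by ring, hxa]
      field_simp
    rw [e, abs_of_pos (by positivity)]
    nlinarith
  refine ⟨x, ?_⟩
  have hV := hU.inter (isOpen_offSet (z.layer M hM))
  have e1' : ∀ y ∈ U ∩ offSet (z.layer M hM), z.φ y + ψ y = z.φ y := fun y hy => by
    rw [h0 y hy.2, add_zero]
  have key : ∀ y ∈ U ∩ offSet (z.layer M hM), dd e1 (dd e2 (fun y => z.φ y + ψ y)) y =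
      z.al' y.2 * y.1.1 + z.be' y.2 * y.1.2 := by
    intro y hy
    rw [dd_eqOn hV e1 (dd_eqOn hV e2 e1') y hy,
      (z.jet y ⟨hy.1.1.1.1.le, hy.1.1.1.2.le⟩ hy.1.1.2 hy.1.2).2.1]
    rw [be', al', G, r]; ring
  rw [dd_eqOn hV e2 key (x, t) ⟨hxU, hxO⟩, dd_e2_lin z.sal' z.sbe']
  exact be'_large htI

end St

theorem exists_next (m : ℕ) : ∃ (C : ℝ) (q : ℕ), 0 ≤ C ∧ ∀ (z : St) (M : ℝ), z.N ^ 20 ≤ M →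
    C * z.N ^ q ≤ M → chK * z.N ^ 11 * M ^ m ≤ exp (z.lam / 100) →
    ∃ z' : St, z'.lam = z.N ∧ z'.N = M ∧ (∀ y : S, y.2 < z.t0 → z'.φ y = z.φ y) ∧
      (∀ i j, i + j ≤ m → ∀ y : S, y.2 < 1 →
        |Sp i j (NN z'.φ) y - Sp i j (NN z.φ) y| ≤ z.N⁻¹) ∧
      ∀ t ∈ Set.Ico z.t0 1, ∃ x, z.lam ^ 10 / 2 ≤ |dd e2 (dd e1 (dd e2 z'.φ)) (x, t)| := by
  obtain ⟨C, q, hC, H⟩ := exists_layer m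
  have hK := chK_nonneg
  refine ⟨C * (4 + chK) ^ q, 13 * q + 1, by positivity, fun z M hM hM' hexp => ?_⟩
  have hN := z.N_pos
  have hN1 : 1 ≤ z.N := by linarith [z.N_big, z.lam_ge]
  have h1 : 1 ≤ M := (one_le_pow₀ hN1).trans hM
  have hM0 : 0 < M := by linarith
  obtain ⟨ψ, Fo, sψ, sFo, hoff, hb, hNN, hJ⟩ := H (z.layer M h1) fun t ht =>
    St.layer_small h1 hexp ht
  have hψ0 : ∀ y ∈ offSet (z.layer M h1), ψ y = 0 := fun y hy => (hoff y hy).1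
  refine ⟨z.next M h1 hM ψ sψ hψ0 hJ, rfl, rfl, fun y hy => ?_, fun i j hij y hy => ?_,
    fun t ht => z.exists_large h1 sψ hψ0 ht⟩
  · have : y ∈ offSet (z.layer M h1) := Or.inl (hy.trans (z.layer M h1).ht1)
    change z.φ y + ψ y = _
    rw [hψ0 y this, add_zero]
  · change |Sp i j (NN (fun y => z.φ y + ψ y)) y - _| ≤ _
    have e : ∀ y ∈ {y : S | y.2 < 1}, NN (fun y => z.φ y + ψ y) y = NN z.φ y + Fo y := by
      intro y hy
      have := hNN z.φ z.sφ y fun h => (z.layer_jet h1 (le_of_lt hy) h).1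
      linarith
    rw [Sp_eqOn (isOpen_before 1) e i j y hy, Sp_add i j z.sφ.NN sFo, add_sub_cancel_left]
    rcases lt_or_ge y.2 z.t0 with ht | ht
    · rw [Sp_zero_on (isOpen_before z.t0) (fun y hy =>
        (hoff y (Or.inl (lt_trans hy (z.layer M h1).ht1))).2) i j y ht, abs_zero]
      positivity
    · refine (hb i j hij y ⟨ht, hy.le⟩).trans ?_
      change C * ((4 + chK) * z.N ^ 13) ^ q * M⁻¹ ≤ _
      rw [← div_eq_mul_inv, div_le_iff₀ hM0]
      calc _ = z.N⁻¹ * (C * (4 + chK) ^ q * z.N ^ (13 * q + 1)) := by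
            rw [mul_pow, ← pow_mul]; field_simp; ring
        _ ≤ _ := by gcongr

end InductionStep

section BaseState

theorem dd_pow_lin (c a b : ℝ) (n : ℕ) (v : ℝ × ℝ) :
    dd ((v, 0) : S) (fun y : S => c * (a * y.1.1 + b * y.1.2) ^ n) =
      fun y : S => c * n * (a * v.1 + b * v.2) * (a * y.1.1 + b * y.1.2) ^ (n - 1) := by
  funext y
  have hs : Sm fun y : S => c * (a * y.1.1 + b * y.1.2) ^ n :=
    contDiff_const.mul ((sm_lin (a := fun _ => a) (b := fun _ => b) contDiff_const
      contDiff_const).pow n)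
  rw [dd, fderiv_eq_of_line hs (((line_lin (fun _ => a) (fun _ => b) y v).pow n).const_mul c)]
  simp; ring

theorem jet_cubic (c a b : ℝ) (y : S) :
    Jet (fun y : S => c * (a * y.1.1 + b * y.1.2) ^ 3) y
      (c * 6 * a ^ 2 * (a * y.1.1 + b * y.1.2)) (c * 6 * a * b * (a * y.1.1 + b * y.1.2))
      (c * 6 * (a ^ 2 + b ^ 2) * a) (c * 6 * (a ^ 2 + b ^ 2) * b) := by
  have h1 : ∀ v w : ℝ × ℝ, dd ((v, 0) : S) (dd ((w, 0) : S)
      (fun y : S => c * (a * y.1.1 + b * y.1.2) ^ 3)) = fun y : S =>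
      (c * 6 * (a * v.1 + b * v.2) * (a * w.1 + b * w.2)) * (a * y.1.1 + b * y.1.2) ^ 1 := by
    intro v w
    rw [dd_pow_lin, dd_pow_lin]
    funext y; push_cast; ring
  have h2 : lapl (fun y : S => c * (a * y.1.1 + b * y.1.2) ^ 3) = fun y : S =>
      (c * 6 * (a ^ 2 + b ^ 2)) * (a * y.1.1 + b * y.1.2) ^ 1 := by
    funext y
    rw [lapl, e1, e2, h1, h1]; dsimp only; ring
  refine ⟨?_, ?_, ?_, ?_⟩
  · rw [e1, h1]; dsimp only; ring
  · rw [e1, e2, h1]; dsimp only; ring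
  · rw [h2, e1, dd_pow_lin]; simp
  · rw [h2, e2, dd_pow_lin]; simp

theorem jet_eqOn {f g : S → ℝ} {U : Set S} (hU : IsOpen U) (h : ∀ y ∈ U, f y = g y) {y : S}
    (hy : y ∈ U) {a b c d : ℝ} (hg : Jet g y a b c d) : Jet f y a b c d := by
  have d2 : ∀ v w : S, ∀ y ∈ U, dd v (dd w f) y = dd v (dd w g) y := fun v w =>
    dd_eqOn hU v (dd_eqOn hU w h)
  have hl : ∀ y ∈ U, lapl f y = lapl g y := fun y hy => by
    rw [lapl, lapl, d2 _ _ y hy, d2 _ _ y hy]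
  refine ⟨?_, ?_, ?_, ?_⟩
  · rw [d2 _ _ y hy, hg.1]
  · rw [d2 _ _ y hy, hg.2.1]
  · rw [dd_eqOn hU _ hl y hy, hg.2.2.1]
  · rw [dd_eqOn hU _ hl y hy, hg.2.2.2]

/-- The stream function of the first layer. -/
noncomputable def basePhi (L : ℝ) (y : S) : ℝ :=
  L ^ 10 / 6 * (1 + L ^ 2)⁻¹ * (1 * y.1.1 + L * y.1.2) ^ 3 *
    (ch (5 / 4 * y.1.1) * ch (5 / 4 * y.1.2))

theorem sm_basePhi (L : ℝ) : Sm (basePhi L) := by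
  have h1 : Sm fun y : S => ch (5 / 4 * y.1.1) := sm_ch.comp (by fun_prop)
  have h2 : Sm fun y : S => ch (5 / 4 * y.1.2) := sm_ch.comp (by fun_prop)
  exact (contDiff_const.mul ((sm_lin (a := fun _ => 1) (b := fun _ => L) contDiff_const
      contDiff_const).pow 3)).mul (h1.mul h2)

theorem basePhi_zero {L : ℝ} {y : S} (h : 3 / 5 < |y.1.1| ∨ 3 / 5 < |y.1.2|) :
    basePhi L y = 0 := by
  have key : ∀ x : ℝ, 3 / 5 < |x| → ch (5 / 4 * x) = 0 := fun x hx => by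
    apply ch_zero
    rw [abs_mul, abs_of_pos (by norm_num : (0:ℝ) < 5 / 4)]; linarith
  rw [basePhi]
  rcases h with h | h <;> simp [key _ h]

theorem jet_basePhi {L : ℝ} {y : S} (h1 : |y.1.1| < 2 / 5) (h2 : |y.1.2| < 2 / 5) :
    Jet (basePhi L) y
      (L ^ 10 * (1 + L ^ 2)⁻¹ * (1 * y.1.1 + L * y.1.2))
      (L ^ 10 * (1 + L ^ 2)⁻¹ * L * (1 * y.1.1 + L * y.1.2))
      (L ^ 10) (L ^ 10 * L) := by
  have hU : IsOpen {y : S | |y.1.1| < 2 / 5 ∧ |y.1.2| < 2 / 5} :=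
    (isOpen_lt (f := fun y : S => |y.1.1|) (by fun_prop) continuous_const).inter
      (isOpen_lt (f := fun y : S => |y.1.2|) (by fun_prop) continuous_const)
  have key : ∀ x : ℝ, |x| < 2 / 5 → ch (5 / 4 * x) = 1 := fun x hx => by
    apply ch_one
    rw [abs_mul, abs_of_pos (by norm_num : (0:ℝ) < 5 / 4)]; linarith
  have hp : 1 + L ^ 2 ≠ 0 := by positivity
  refine jet_eqOn hU (g := fun y => L ^ 10 / 6 * (1 + L ^ 2)⁻¹ * (1 * y.1.1 + L * y.1.2) ^ 3)
    (fun y hy => ?_) ⟨h1, h2⟩ ((jet_cubic _ _ _ _).congr ?_ ?_ ?_ ?_)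
  · rw [basePhi, key _ hy.1, key _ hy.2]; ring
  all_goals field_simp

theorem exists_base {L M : ℝ} (hL : 10 ^ 5 ≤ L) (hM : L ^ 20 ≤ M) :
    ∃ z : St, z.lam = L ∧ z.N = M := by
  have h1 : 1 ≤ L := by linarith
  have hL2 : L ≤ L ^ 2 := by nlinarith
  have hM1 : 1 ≤ M := (one_le_pow₀ h1).trans hM
  have hc : ∀ (c : ℝ) t, HasDerivAt (fun _ : ℝ => c) 0 t := fun c t => hasDerivAt_const t c
  have h4 : L⁻¹ ^ 9 ≤ (1 / 8) ^ 9 := by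
    gcongr
    rw [inv_le_comm₀ (by linarith) (by norm_num)]; linarith
  refine ⟨{ lam := L, lamm := 1, N := M, s := 1, ts := 0
            a1 := fun _ => 1, a2 := fun _ => L, b1 := fun _ => -1, b2 := fun _ => 1
            h := fun _ => 0, g1 := fun _ => 0, g2 := fun _ => 0
            al := fun _ => 0, be := fun _ => 0, et := fun _ => 0
            φ := basePhi L
            hs := by norm_num
            hlamm := le_rfl
            hlam := by linarith
            hN := hM
            hts0 := le_rfl
            hts := by norm_num at h4 ⊢; linarith
            sa1 := contDiff_const, sa2 := contDiff_const, sb1 := contDiff_const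
            sb2 := contDiff_const, sh := contDiff_const, sg1 := contDiff_const
            sg2 := contDiff_const, sal := contDiff_const, sbe := contDiff_const
            set := contDiff_const
            sφ := sm_basePhi L
            da1 := fun t => by simpa using hc 1 t
            da2 := fun t => by simpa using hc L t
            db1 := fun t => by simpa using hc (-1) t
            db2 := fun t => by simpa using hc 1 t
            dh := fun t => by simpa using hc 0 t
            va1 := rfl, va2 := rfl, vb1 := rfl, vb2 := rfl, vh := rfl
            cross := fun t => by ring
            ba := fun t _ => ⟨by rw [abs_one]; linarith, by rw [abs_of_pos] <;> linarith⟩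
            bb := fun t _ => ⟨by rw [abs_neg, abs_one]; linarith, by rw [abs_one]; linarith⟩
            bg := fun t _ => by simp; linarith
            bA := fun t _ => by simp; linarith
            supp := fun y _ h => basePhi_zero h
            jet := fun y _ ha hb => ?_ }, rfl, rfl⟩
  have e1 : |y.1.1 + L * y.1.2| < 1 / 8 := by
    rw [one_mul] at ha
    refine ha.trans_le ?_
    rw [div_le_div_iff₀] <;> linarith
  have e2 : |-y.1.1 + y.1.2| < 1 / 8 := by
    rw [neg_one_mul, one_mul] at hb
    refine hb.trans_le ?_
    have : L ≤ L ^ 3 := by nlinarith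
    rw [div_le_div_iff₀] <;> linarith
  have e3 : |y.1.2| < 1 / 4 := by
    rw [abs_lt] at e1 e2 ⊢
    constructor
    · by_contra! hh; nlinarith
    · by_contra! hh; nlinarith
  refine (jet_basePhi ?_ (by linarith)).congr ?_ ?_ ?_ ?_
  · rw [abs_lt] at e2 e3 ⊢; constructor <;> linarith
  all_goals simp

end BaseState

section Scales

theorem exists_exp_dominates (K : ℝ) (p : ℕ) : ∃ T : ℝ, ∀ L, T ≤ L → K * L ^ p ≤ exp (L / 100) := by
  have h : Tendsto (fun L : ℝ => K * 100 ^ p * ((L / 100) ^ p * exp (-(L / 100)))) atTop (nhds 0) := by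
    have := ((tendsto_pow_mul_exp_neg_atTop_nhds_zero p).comp
      (tendsto_id.atTop_div_const (by norm_num : (0:ℝ) < 100))).const_mul (K * 100 ^ p)
    simpa using this
  obtain ⟨T, hT⟩ := eventually_atTop.1 (h.eventually_le_const one_pos)
  refine ⟨T, fun L hL => ?_⟩
  have h1 := hT L hL
  rw [exp_neg, div_pow] at h1
  have he := exp_pos (L / 100)
  field_simp at h1
  linarith

/-- Rapidly growing scales, together with slowly growing orders of differentiability. -/
theorem exists_scales (C : ℕ → ℝ) (q : ℕ → ℕ) {K : ℝ} (hK : 0 ≤ K) :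
    ∃ (L : ℕ → ℝ) (m : ℕ → ℕ), 10 ^ 5 ≤ L 0 ∧ (∀ n, L n ^ 20 ≤ L (n + 1)) ∧
      (∀ n, C (m n) * L (n + 1) ^ q (m n) ≤ L (n + 2)) ∧
      (∀ n, K * L (n + 1) ^ 11 * L (n + 2) ^ m n ≤ exp (L n / 100)) ∧ Tendsto m atTop atTop := by
  set E : ℕ → ℕ := fun j => 21 + ∑ i ∈ Finset.range (j + 1), q i with hE
  have hEmono : Monotone E := fun a b hab =>
    Nat.add_le_add_left (Finset.sum_le_sum_of_subset (Finset.range_mono (by omega))) _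
  have hqE : ∀ j, q j + 1 ≤ E j := fun j => by
    have := Finset.single_le_sum (f := q) (fun i _ => Nat.zero_le _)
      (Finset.mem_range.2 (Nat.lt_add_one j))
    simp only [hE]; omega
  choose T hT using fun j => exists_exp_dominates K (E j * 11 + E j * E j * j)
  choose R hR using fun j => exists_nat_ge (max (T j) (C j))
  set m : ℕ → ℕ := fun n => Nat.findGreatest (fun j => j = 0 ∨ R j + 1 ≤ n) n with hm
  have hmono : Monotone m := fun a b hab =>
    Nat.findGreatest_mono (fun j hj => hj.imp id fun h => h.trans hab) hab
  have hspec : ∀ n, m n = 0 ∨ R (m n) + 1 ≤ n := fun n =>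
    Nat.findGreatest_spec (P := fun j => j = 0 ∨ R j + 1 ≤ n) (Nat.zero_le n) (Or.inl rfl)
  let L : ℕ → ℝ := fun n => Nat.rec (10 ^ 5 + R 0 : ℝ) (fun n x => x ^ E (m n)) n
  have hL0 : L 0 = 10 ^ 5 + R 0 := rfl
  have hLs : ∀ n, L (n + 1) = L n ^ E (m n) := fun n => rfl
  have hE21 : ∀ j, 21 ≤ E j := fun j => by simp only [hE]; omega
  have hbig : ∀ n, 10 ^ 5 + (R 0 : ℝ) + n ≤ L n := by
    intro n
    induction n with
    | zero => simp [hL0]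
    | succ n ih =>
      have h1 : 2 ≤ L n := by linarith [Nat.cast_nonneg (α := ℝ) (R 0), Nat.cast_nonneg (α := ℝ) n]
      have h2 : L n ^ 2 ≤ L (n + 1) := by
        rw [hLs]; exact pow_le_pow_right₀ (by linarith) (by have := hE21 (m n); omega)
      push_cast
      nlinarith
  have h1 : ∀ n, 1 ≤ L n := fun n => by
    linarith [hbig n, Nat.cast_nonneg (α := ℝ) (R 0), Nat.cast_nonneg (α := ℝ) n]
  have hRL : ∀ n, (R (m (n + 1)) : ℝ) ≤ L n := fun n => by
    rcases hspec (n + 1) with h | h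
    · rw [h]; linarith [hbig n, Nat.cast_nonneg (α := ℝ) n]
    · have : (R (m (n + 1)) : ℝ) ≤ n := by exact_mod_cast (by omega : R (m (n + 1)) ≤ n)
      linarith [hbig n, Nat.cast_nonneg (α := ℝ) (R 0)]
  have hRL' : ∀ n, (R (m n) : ℝ) ≤ L (n + 1) := fun n => by
    rcases hspec n with h | h
    · rw [h]; linarith [hbig (n + 1), Nat.cast_nonneg (α := ℝ) (n + 1)]
    · have : (R (m n) : ℝ) ≤ (n + 1 : ℕ) := by exact_mod_cast (by omega : R (m n) ≤ n + 1)
      linarith [hbig (n + 1), Nat.cast_nonneg (α := ℝ) (R 0)]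
  refine ⟨L, m, ?_, fun n => ?_, fun n => ?_, fun n => ?_, ?_⟩
  · rw [hL0]; linarith [Nat.cast_nonneg (α := ℝ) (R 0)]
  · rw [hLs]; exact pow_le_pow_right₀ (h1 n) (by have := hE21 (m n); omega)
  · have hp := one_le_pow₀ (h1 (n + 1)) (n := q (m n))
    calc C (m n) * L (n + 1) ^ q (m n) ≤ L (n + 1) * L (n + 1) ^ q (m n) := by
          gcongr; exact ((le_max_right _ _).trans (hR _)).trans (hRL' n)
      _ = L (n + 1) ^ (q (m n) + 1) := by ring
      _ ≤ L (n + 1) ^ E (m (n + 1)) := pow_le_pow_right₀ (h1 (n + 1))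
          ((hqE _).trans (hEmono (hmono n.le_succ)))
      _ = L (n + 2) := (hLs (n + 1)).symm
  · have e0 := hEmono (hmono n.le_succ)
    refine le_trans ?_ (hT (m (n + 1)) (L n) (((le_max_left _ _).trans (hR _)).trans (hRL n)))
    rw [mul_assoc]
    refine mul_le_mul_of_nonneg_left ?_ hK
    rw [hLs (n + 1), hLs n, ← pow_mul, ← pow_mul, ← pow_mul, ← pow_add]
    refine pow_le_pow_right₀ (h1 n) ?_
    have := hmono n.le_succ
    simp only [Nat.succ_eq_add_one] at this e0
    rw [← mul_assoc]
    exact Nat.add_le_add (Nat.mul_le_mul_right _ e0)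
      (Nat.mul_le_mul (Nat.mul_le_mul e0 le_rfl) this)
  · refine tendsto_atTop.2 fun j => ?_
    filter_upwards [eventually_ge_atTop (max j (R j + 1))] with n hn
    exact Nat.le_findGreatest ((le_max_left _ _).trans hn) (Or.inr ((le_max_right _ _).trans hn))

/-- A sequence of states with rapidly growing scales. -/
theorem exists_states : ∃ (z : ℕ → St) (m : ℕ → ℕ), (∀ n, (z (n + 1)).lam = (z n).N) ∧
    Tendsto m atTop atTop ∧ ∀ n, (∀ y : S, y.2 < (z n).t0 → (z (n + 1)).φ y = (z n).φ y) ∧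
      (∀ i j, i + j ≤ m n → ∀ y : S, y.2 < 1 →
        |Sp i j (NN (z (n + 1)).φ) y - Sp i j (NN (z n).φ) y| ≤ (z n).N⁻¹) ∧
      ∀ t ∈ Set.Ico (z n).t0 1,
        ∃ x, (z n).lam ^ 10 / 2 ≤ |dd e2 (dd e1 (dd e2 (z (n + 1)).φ)) (x, t)| := by
  choose C q hC H using exists_next
  obtain ⟨L, m, h0, h1, h2, h3, hm⟩ := exists_scales C q chK_nonneg
  obtain ⟨z0, hz0, hz0'⟩ := exists_base h0 (h1 0)
  have step : ∀ n (z : {z : St // z.lam = L n ∧ z.N = L (n + 1)}), ∃ z' : {z : St //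
      z.lam = L (n + 1) ∧ z.N = L (n + 1 + 1)}, (∀ y : S, y.2 < z.1.t0 → z'.1.φ y = z.1.φ y) ∧
      (∀ i j, i + j ≤ m n → ∀ y : S, y.2 < 1 →
        |Sp i j (NN z'.1.φ) y - Sp i j (NN z.1.φ) y| ≤ z.1.N⁻¹) ∧
      ∀ t ∈ Set.Ico z.1.t0 1,
        ∃ x, z.1.lam ^ 10 / 2 ≤ |dd e2 (dd e1 (dd e2 z'.1.φ)) (x, t)| := by
    rintro n ⟨z, hz, hz'⟩
    obtain ⟨z', a, b, c⟩ := H (m n) z (L (n + 2)) (by rw [hz']; exact h1 _)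
      (by rw [hz']; exact h2 n) (by rw [hz, hz']; exact h3 n)
    exact ⟨⟨z', a.trans hz', b⟩, c⟩
  choose f hf using step
  let Z : ∀ n, {z : St // z.lam = L n ∧ z.N = L (n + 1)} := fun n =>
    Nat.rec ⟨z0, hz0, hz0'⟩ (fun n z => f n z) n
  exact ⟨fun n => (Z n).1, m, fun n => (Z (n + 1)).2.1.trans (Z n).2.2.symm, hm,
    fun n => hf n (Z n)⟩

end Scales

section Limit

theorem lapl_eqOn {f g : S → ℝ} {U : Set S} (hU : IsOpen U) (h : ∀ y ∈ U, f y = g y) :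
    ∀ y ∈ U, lapl f y = lapl g y := fun y hy => by
  rw [lapl, lapl, dd_eqOn hU _ (dd_eqOn hU _ h) y hy, dd_eqOn hU _ (dd_eqOn hU _ h) y hy]

theorem NN_eqOn {f g : S → ℝ} {U : Set S} (hU : IsOpen U) (h : ∀ y ∈ U, f y = g y) :
    ∀ y ∈ U, NN f y = NN g y := fun y hy => by
  have hl := lapl_eqOn hU h
  simp only [NN]
  rw [dd_eqOn hU _ hl y hy, dd_eqOn hU _ hl y hy, dd_eqOn hU _ hl y hy,
    dd_eqOn hU _ (dd_eqOn hU _ h) y hy, dd_eqOn hU _ (dd_eqOn hU _ h) y hy]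

theorem isOpen_outside :
    IsOpen {y : S | y.2 < 1 ∧ (3 / 5 < |y.1.1| ∨ 3 / 5 < |y.1.2|)} :=
  (isOpen_before 1).inter
    ((isOpen_lt (g := fun y : S => |y.1.1|) continuous_const (by fun_prop)).union
      (isOpen_lt (g := fun y : S => |y.1.2|) continuous_const (by fun_prop)))

theorem lapl_zero_on {f : S → ℝ} {U : Set S} (hU : IsOpen U) (h : ∀ y ∈ U, f y = 0) :
    ∀ y ∈ U, lapl f y = 0 := fun y hy => by
  rw [lapl, dd_zero_on hU _ (dd_zero_on hU _ h) y hy, dd_zero_on hU _ (dd_zero_on hU _ h) y hy,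
    add_zero]

theorem NN_zero_on {f : S → ℝ} {U : Set S} (hU : IsOpen U) (h : ∀ y ∈ U, f y = 0) :
    ∀ y ∈ U, NN f y = 0 := fun y hy => by
  have hl := lapl_zero_on hU h
  simp only [NN]
  rw [dd_zero_on hU _ hl y hy, dd_zero_on hU _ hl y hy, dd_zero_on hU _ hl y hy]
  ring

theorem exists_bound_of_zero_outside {f : S → ℝ} (hf : Continuous f)
    (h0 : ∀ y : S, y.2 < 1 → 3 / 5 < |y.1.1| ∨ 3 / 5 < |y.1.2| → f y = 0) :
    ∃ B, 0 ≤ B ∧ ∀ y : S, 0 ≤ y.2 → y.2 < 1 → |f y| ≤ B := by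
  have hK : IsCompact ((Set.Icc (-1 : ℝ) 1 ×ˢ Set.Icc (-1 : ℝ) 1) ×ˢ Set.Icc (0 : ℝ) 1) :=
    (isCompact_Icc.prod isCompact_Icc).prod isCompact_Icc
  obtain ⟨B, hB⟩ := hK.exists_bound_of_continuousOn hf.continuousOn
  have hB0 : 0 ≤ B := (norm_nonneg _).trans (hB ((0, 0), 0) (by norm_num))
  refine ⟨B, hB0, fun y h1 h2 => ?_⟩
  by_cases h : 3 / 5 < |y.1.1| ∨ 3 / 5 < |y.1.2|
  · rw [h0 y h2 h, abs_zero]; exact hB0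
  · push Not at h
    refine hB y ⟨⟨?_, ?_⟩, h1, h2.le⟩
    · exact abs_le.1 (by linarith [h.1])
    · exact abs_le.1 (by linarith [h.2])

/-- The limiting stream function, locally equal to smooth approximations. -/
theorem exists_stream : ∃ (Φ : S → ℝ) (φ : ℕ → S → ℝ) (τ lam : ℕ → ℝ),
    (∀ n, Sm (φ n)) ∧ (∀ n y, y.2 < τ n → Φ y = φ n y) ∧ (∀ n, τ n < 1) ∧ (∀ n, 0 ≤ τ n) ∧
    (∀ t < 1, ∃ n, t < τ n) ∧
    (∀ n, ∀ y : S, y.2 < 1 → 3 / 5 < |y.1.1| ∨ 3 / 5 < |y.1.2| → φ n y = 0) ∧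
    (∀ k, ∃ M, ∀ i j, i + j ≤ k → ∀ n, ∀ y : S, 0 ≤ y.2 → y.2 < τ n →
      |Sp i j (NN (φ n)) y| ≤ M) ∧
    (∀ n, 2 ≤ lam n) ∧ Tendsto lam atTop atTop ∧ (∀ n, τ n = 1 - 4 * (lam n)⁻¹ ^ 9) ∧
    ∀ n, ∀ t ∈ Set.Ico (τ n) 1, ∃ k, t < τ k ∧
      ∃ x, lam n ^ 10 / 2 ≤ |dd e2 (dd e1 (dd e2 (φ k))) (x, t)| := by
  obtain ⟨z, m, hlam, hm, H⟩ := exists_states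
  have hge : ∀ n, 1 ≤ (z n).lam := fun n => by linarith [(z n).lam_ge]
  have hdouble : ∀ n, 2 * (z n).lam ≤ (z (n + 1)).lam := fun n => by
    rw [hlam]; linarith [(z n).N_big, (z n).lam_pos]
  have hmono : Monotone fun n => (z n).lam := monotone_nat_of_le_succ fun n => by
    linarith [hdouble n, hge n]
  have hpow : ∀ n, (2:ℝ) ^ n ≤ (z n).lam := by
    intro n
    induction n with
    | zero => simpa using hge 0
    | succ n ih => rw [pow_succ]; linarith [hdouble n]
  have htend : Tendsto (fun n => (z n).lam) atTop atTop :=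
    tendsto_atTop_mono hpow (tendsto_pow_atTop_atTop_of_one_lt one_lt_two)
  have hτmono : Monotone fun n => (z n).t0 := fun a b hab => by
    have := inv_anti₀ (z a).lam_pos (hmono hab)
    have := pow_le_pow_left₀ (inv_nonneg.2 (z b).lam_pos.le) this 9
    simp only [St.t0]; linarith
  have hτ1 : ∀ n, (z n).t0 < 1 := fun n => by
    have := pow_pos (inv_pos.2 (z n).lam_pos) 9
    simp only [St.t0]; linarith
  have hex : ∀ t < 1, ∃ n, t < (z n).t0 := by
    intro t ht
    have h1 : Tendsto (fun n => (z n).t0) atTop (nhds 1) := by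
      have := ((tendsto_inv_atTop_zero.comp htend).pow 9).const_mul 4 |>.const_sub 1
      simpa [St.t0] using this
    exact (h1.eventually_const_lt ht).exists
  have hagree : ∀ n k, n ≤ k → ∀ y : S, y.2 < (z n).t0 → (z k).φ y = (z n).φ y := by
    intro n k hnk
    induction k, hnk using Nat.le_induction with
    | base => exact fun _ _ => rfl
    | succ k hk ih =>
      intro y hy
      rw [(H k).1 y (hy.trans_le (hτmono hk)), ih y hy]
  have hsupp : ∀ n, ∀ y : S, y.2 < 1 → 3 / 5 < |y.1.1| ∨ 3 / 5 < |y.1.2| → (z n).φ y = 0 :=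
    fun n y hy h => (z n).supp y hy.le h
  classical
  refine ⟨fun y => if h : ∃ n, y.2 < (z n).t0 then (z (Nat.find h)).φ y else 0,
    fun n => (z n).φ, fun n => (z n).t0, fun n => (z n).lam, fun n => (z n).sφ, ?_, hτ1,
    fun n => (z n).t0_nonneg, hex, hsupp, ?_,
    fun n => by linarith [(z n).lam_ge], htend, fun n => rfl, ?_⟩
  · intro n y hy
    have h : ∃ n, y.2 < (z n).t0 := ⟨n, hy⟩
    dsimp only
    rw [dif_pos h]
    exact (hagree _ _ (Nat.find_min' h hy) y (Nat.find_spec h)).symm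
  · intro k
    obtain ⟨J, hJ⟩ := eventually_atTop.1 (tendsto_atTop.1 hm k)
    have hB : ∀ i j, ∃ B, 0 ≤ B ∧ ∀ y : S, 0 ≤ y.2 → y.2 < 1 → |Sp i j (NN (z J).φ) y| ≤ B :=
      fun i j => exists_bound_of_zero_outside (sm_Sp i j (z J).sφ.NN).continuous fun y hy h =>
        Sp_zero_on isOpen_outside (NN_zero_on isOpen_outside fun y hy => hsupp J y hy.1 hy.2) i j y
          ⟨hy, h⟩
    choose B hB0 hB using hB
    refine ⟨(∑ i ∈ Finset.range (k + 1), ∑ j ∈ Finset.range (k + 1), B i j) + 2,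
      fun i j hij n y hy0 hy => ?_⟩
    have hBs : B i j ≤ ∑ i ∈ Finset.range (k + 1), ∑ j ∈ Finset.range (k + 1), B i j :=
      (Finset.single_le_sum (f := fun j => B i j) (fun j _ => hB0 i j)
        (Finset.mem_range.2 (by omega))).trans
        (Finset.single_le_sum (f := fun i => ∑ j ∈ Finset.range (k + 1), B i j)
          (fun i _ => Finset.sum_nonneg fun j _ => hB0 i j) (Finset.mem_range.2 (by omega)))
    have hy1 : y.2 < 1 := hy.trans (hτ1 n)
    have key : ∀ l, J ≤ l → |Sp i j (NN (z l).φ) y| ≤ B i j + 2 - 2 * (1 / 2) ^ l := by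
      intro l hl
      induction l, hl using Nat.le_induction with
      | base =>
        have : (1 / 2 : ℝ) ^ J ≤ 1 := pow_le_one₀ (by norm_num) (by norm_num)
        linarith [hB i j y hy0 hy1]
      | succ l hl ih =>
        have h1 := (H l).2.1 i j (hij.trans (hJ l hl)) y hy1
        have h2 : (z l).N⁻¹ ≤ (1 / 2) ^ (l + 1) := by
          rw [one_div, inv_pow, ← hlam]
          exact inv_anti₀ (by positivity) (hpow _)
        have h3 := abs_sub_abs_le_abs_sub (Sp i j (NN (z (l + 1)).φ) y) (Sp i j (NN (z l).φ) y)
        have h4 : (0:ℝ) ≤ (1 / 2) ^ l := by positivity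
        rw [pow_succ] at h2 ⊢
        linarith
    have heq : Sp i j (NN (z n).φ) y = Sp i j (NN (z (max n J)).φ) y :=
      (Sp_eqOn (isOpen_before _) (NN_eqOn (isOpen_before _)
        (hagree n (max n J) (le_max_left _ _))) i j y hy).symm
    have := key (max n J) (le_max_right _ _)
    have : (0:ℝ) ≤ (1 / 2) ^ (max n J) := by positivity
    rw [heq]; linarith
  · intro n t ht
    have h := hex t ht.2
    have hn : n < Nat.find h := by
      by_contra! hc
      exact absurd ((Nat.find_spec h).trans_le (hτmono hc)) (not_lt.2 ht.1)
    obtain ⟨l, hl⟩ : ∃ l, Nat.find h = l + 1 := ⟨Nat.find h - 1, by omega⟩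
    have h1 : (z l).t0 ≤ t := not_lt.1 (Nat.find_min h (by omega))
    refine ⟨l + 1, hl ▸ Nat.find_spec h, ?_⟩
    obtain ⟨x, hx⟩ := (H l).2.2 t ⟨h1, ht.2⟩
    refine ⟨x, le_trans ?_ hx⟩
    have := hmono (show n ≤ l by omega)
    have := (z n).lam_pos
    gcongr

end Limit

section Blowup

theorem sm_slice {f : S → ℝ} (hf : Sm f) (t : ℝ) : Sm fun x : ℝ × ℝ => f (x, t) :=
  hf.comp (contDiff_id.prodMk contDiff_const)

theorem mem_box_of_abs_le {x : ℝ × ℝ} (h1 : |x.1| ≤ 3 / 5) (h2 : |x.2| ≤ 3 / 5) :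
    x ∈ Set.Icc (-1 : ℝ) 1 ×ˢ Set.Icc (-1 : ℝ) 1 :=
  ⟨abs_le.1 (by linarith), abs_le.1 (by linarith)⟩

theorem hasCompactSupport_of_zero_outside {f : ℝ × ℝ → ℝ}
    (h : ∀ x, 3 / 5 < |x.1| ∨ 3 / 5 < |x.2| → f x = 0) : HasCompactSupport f := by
  refine HasCompactSupport.intro (isCompact_Icc.prod isCompact_Icc)
    (K := Set.Icc (-1 : ℝ) 1 ×ˢ Set.Icc (-1 : ℝ) 1) fun x hx => h x ?_
  by_contra! hc
  exact hx (mem_box_of_abs_le hc.1 hc.2)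

/-- Euclidean norm of the velocity gradient of a stream function. -/
noncomputable def gradNorm (φ : S → ℝ) (y : S) : ℝ :=
  √((dd e1 (dd e1 (dd e2 φ)) y) ^ 2 + (dd e2 (dd e1 (dd e2 φ)) y) ^ 2
      + (dd e1 (fun y => -dd e1 (dd e1 φ) y) y) ^ 2 + (dd e2 (fun y => -dd e1 (dd e1 φ) y) y) ^ 2)

theorem continuous_gradNorm {φ : S → ℝ} (hφ : Sm φ) : Continuous (gradNorm φ) := by
  have h1 := ((hφ.dd e2).dd e1)
  have h2 : Sm fun y => -dd e1 (dd e1 φ) y := ((hφ.dd e1).dd e1).neg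
  exact Real.continuous_sqrt.comp (((((h1.dd e1).continuous.pow 2).add
    ((h1.dd e2).continuous.pow 2)).add ((h2.dd e1).continuous.pow 2)).add
      ((h2.dd e2).continuous.pow 2))

theorem gradNorm_zero {φ : S → ℝ} {U : Set S} (hU : IsOpen U) (h : ∀ y ∈ U, φ y = 0) :
    ∀ y ∈ U, gradNorm φ y = 0 := by
  intro y hy
  have h2 : ∀ y ∈ U, -dd e1 (dd e1 φ) y = 0 := fun y hy => by
    rw [dd_zero_on hU _ (dd_zero_on hU _ h) y hy, neg_zero]
  have h1 := dd_zero_on hU e1 (dd_zero_on hU e2 h)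
  rw [gradNorm, dd_zero_on hU _ h1 y hy, dd_zero_on hU _ h1 y hy, dd_zero_on hU _ h2 y hy,
    dd_zero_on hU _ h2 y hy]
  simp

theorem le_gradNorm (φ : S → ℝ) (y : S) : |dd e2 (dd e1 (dd e2 φ)) y| ≤ gradNorm φ y :=
  Real.abs_le_sqrt <| by
    nlinarith [sq_nonneg (dd e1 (dd e1 (dd e2 φ)) y),
      sq_nonneg (dd e1 (fun y => -dd e1 (dd e1 φ) y) y),
      sq_nonneg (dd e2 (fun y => -dd e1 (dd e1 φ) y) y)]

/-- The velocity field of a stream function. -/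
noncomputable def vel (φ : S → ℝ) (y : S) : ℝ × ℝ := (dd e1 (dd e2 φ) y, -dd e1 (dd e1 φ) y)

theorem sm_vel {φ : S → ℝ} (hφ : Sm φ) : Sm (vel φ) :=
  ((hφ.dd e2).dd e1).prodMk ((hφ.dd e1).dd e1).neg

theorem vel_eqOn {f g : S → ℝ} {U : Set S} (hU : IsOpen U) (h : ∀ y ∈ U, f y = g y) :
    ∀ y ∈ U, vel f y = vel g y := fun y hy => by
  rw [vel, vel, dd_eqOn hU _ (dd_eqOn hU _ h) y hy, dd_eqOn hU _ (dd_eqOn hU _ h) y hy]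

theorem jacSup_nonneg (u : S → ℝ × ℝ) (t : ℝ) : 0 ≤ jacSup u t := by
  refine Real.sSup_nonneg ?_
  rintro _ ⟨x, rfl⟩
  exact Real.sqrt_nonneg _

theorem jacSup_vel {φ : S → ℝ} (hφ : Sm φ) {u : S → ℝ × ℝ} {t : ℝ}
    (hu : ∀ x, u (x, t) = vel φ (x, t)) :
    jacSup u t = sSup {y : ℝ | ∃ x : ℝ × ℝ, y = gradNorm φ (x, t)} := by
  have h1 := (hφ.dd e2).dd e1
  have h2 : Sm fun y => -dd e1 (dd e1 φ) y := ((hφ.dd e1).dd e1).neg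
  have e1' : (fun x => (u (x, t)).1) = fun x => dd e1 (dd e2 φ) (x, t) := by
    funext x; rw [hu]; rfl
  have e2' : (fun x => (u (x, t)).2) = fun x => (fun y => -dd e1 (dd e1 φ) y) (x, t) := by
    funext x; rw [hu]; rfl
  have p1 : ∀ g : S → ℝ, Sm g → pd1 (fun x => g (x, t)) = fun x => dd e1 g (x, t) :=
    fun g hg => dd_slice hg t (1, 0)
  have p2 : ∀ g : S → ℝ, Sm g → pd2 (fun x => g (x, t)) = fun x => dd e2 g (x, t) :=
    fun g hg => dd_slice hg t (0, 1)
  rw [jacSup, e1', e2', p1 _ h1, p2 _ h1, p1 _ h2, p2 _ h2]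
  rfl

/-- The box containing the supports. -/
def box : Set (ℝ × ℝ) := Set.Icc (-1 : ℝ) 1 ×ˢ Set.Icc (-1 : ℝ) 1

theorem isCompact_box : IsCompact box := isCompact_Icc.prod isCompact_Icc

theorem range_eq_image_box {φ : S → ℝ}
    (h0 : ∀ y : S, y.2 < 1 → 3 / 5 < |y.1.1| ∨ 3 / 5 < |y.1.2| → φ y = 0) {t : ℝ} (ht : t < 1) :
    {y : ℝ | ∃ x : ℝ × ℝ, y = gradNorm φ (x, t)} = (fun x => gradNorm φ (x, t)) '' box := by
  have hz := gradNorm_zero isOpen_outside fun y hy => h0 y hy.1 hy.2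
  ext c
  constructor
  · rintro ⟨x, rfl⟩
    by_cases hx : 3 / 5 < |x.1| ∨ 3 / 5 < |x.2|
    · refine ⟨(1, 1), ⟨by norm_num, by norm_num⟩, ?_⟩
      dsimp only
      rw [hz (x, t) ⟨ht, hx⟩, hz ((1, 1), t) ⟨ht, Or.inl (by norm_num)⟩]
    · push Not at hx
      exact ⟨x, mem_box_of_abs_le hx.1 hx.2, rfl⟩
  · rintro ⟨x, -, rfl⟩; exact ⟨x, rfl⟩

end Blowup

section Main

theorem uniqueDiffOn_spaceTime : UniqueDiffOn ℝ spaceTime :=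
  uniqueDiffOn_univ.prod (uniqueDiffOn_Ico 0 1)

theorem contDiffOn_spaceTime {F : Type} [NormedAddCommGroup F] [NormedSpace ℝ F] {f : S → F}
    (h : ∀ t < 1, ∃ (c : ℝ) (g : S → F), t < c ∧ Sm g ∧ ∀ y : S, y.2 < c → f y = g y) :
    ContDiffOn ℝ (⊤ : ℕ∞) f spaceTime := by
  intro y hy
  obtain ⟨c, g, hc, hg, he⟩ := h y.2 hy.2.2
  exact (hg.contDiffAt.congr_of_eventuallyEq
    (eventuallyEq_of_mem ((isOpen_before c).mem_nhds hc) he)).contDiffWithinAt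

theorem fderivWithin_spaceTime {F : Type} [NormedAddCommGroup F] [NormedSpace ℝ F] {f g : S → F}
    {c : ℝ} (hg : Sm g) (he : ∀ y : S, y.2 < c → f y = g y) {x : ℝ × ℝ} {t : ℝ}
    (ht : t ∈ Set.Ico (0 : ℝ) 1) (htc : t < c) :
    fderivWithin ℝ f spaceTime (x, t) = fderiv ℝ g (x, t) := by
  have h : f =ᶠ[nhds (x, t)] g := eventuallyEq_of_mem ((isOpen_before c).mem_nhds htc) he
  rw [← h.fderiv_eq]
  exact ((hg.diff (x, t)).congr_of_eventuallyEq h).fderivWithin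
    (uniqueDiffOn_spaceTime (x, t) ⟨trivial, ht⟩)

theorem tendsto_atTop_of_eventually_ge {f : ℝ → ℝ} {lam : ℕ → ℝ} (h1 : Tendsto lam atTop atTop)
    (h : ∀ n, ∃ c < 1, ∀ t ∈ Set.Ioo c 1, lam n ≤ f t) :
    Tendsto f (nhdsWithin (1 : ℝ) (Set.Iio 1)) atTop := by
  refine tendsto_atTop.2 fun A => ?_
  obtain ⟨n, hn⟩ := (tendsto_atTop.1 h1 A).exists
  obtain ⟨c, hc, H⟩ := h n
  filter_upwards [Ioo_mem_nhdsLT hc] with t ht using hn.trans (H t ht)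

theorem CkNorm_le {k : ℕ} {f : ℝ × ℝ → ℝ} {M : ℝ}
    (h : ∀ i j x, i + j ≤ k → |pdMix i j f x| ≤ M) : CkNorm k f ≤ M := by
  refine csSup_le ⟨_, 0, 0, 0, Nat.zero_le k, rfl⟩ ?_
  rintro _ ⟨i, j, x, hij, rfl⟩
  exact h i j x hij

theorem sq_add_sq_le_of_abs {x : ℝ × ℝ} (h : ¬(3 / 5 < |x.1| ∨ 3 / 5 < |x.2|)) :
    x.1 ^ 2 + x.2 ^ 2 ≤ 1 := by
  push Not at h
  have h1 := sq_le_sq' (abs_le.1 h.1).1 (abs_le.1 h.1).2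
  have h2 := sq_le_sq' (abs_le.1 h.2).1 (abs_le.1 h.2).2
  norm_num at h1 h2; linarith

end Main

/-- Blowup of the velocity gradient for IPM with a smooth source. -/
theorem ipm_velocity_gradient_blowup :
    ∃ (ρ₀ : ℝ × ℝ → ℝ) (ρ P F : (ℝ × ℝ) × ℝ → ℝ) (u : (ℝ × ℝ) × ℝ → ℝ × ℝ),
      -- `ρ₀ ∈ C_c^∞(ℝ²)`
      ContDiff ℝ (⊤ : ℕ∞) ρ₀ ∧ HasCompactSupport ρ₀ ∧
      -- each `F(·,t)` is `C^∞`, supported in the closed unit ball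
      (∀ t ∈ Set.Ico (0 : ℝ) 1, ContDiff ℝ (⊤ : ℕ∞) (fun x => F (x, t))) ∧
      (∀ t ∈ Set.Ico (0 : ℝ) 1, ∀ x : ℝ × ℝ, F (x, t) ≠ 0 → x.1 ^ 2 + x.2 ^ 2 ≤ 1) ∧
      -- uniform-in-time bound on every `C^k` norm of the source
      (∀ k : ℕ, ∃ M : ℝ, ∀ t ∈ Set.Ico (0 : ℝ) 1, CkNorm k (fun x => F (x, t)) ≤ M) ∧
      -- `ρ, u, P` are smooth on `ℝ² × [0,1)`
      ContDiffOn ℝ (⊤ : ℕ∞) ρ spaceTime ∧ ContDiffOn ℝ (⊤ : ℕ∞) u spaceTime ∧ ContDiffOn ℝ (⊤ : ℕ∞) P spaceTime ∧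
      -- initial datum
      (∀ x : ℝ × ℝ, ρ (x, 0) = ρ₀ x) ∧
      -- each `ρ(·,t)` is compactly supported and `u(·,t)` is square integrable
      (∀ t ∈ Set.Ico (0 : ℝ) 1, HasCompactSupport (fun x => ρ (x, t))) ∧
      (∀ t ∈ Set.Ico (0 : ℝ) 1, Integrable (fun x : ℝ × ℝ => ‖u (x, t)‖ ^ 2)) ∧
      -- the IPM system: transport equation, Darcy's law, incompressibility
      (∀ x : ℝ × ℝ, ∀ t ∈ Set.Ico (0 : ℝ) 1,
        fderivWithin ℝ ρ spaceTime (x, t) ((0, 0), 1)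
            + (u (x, t)).1 * fderivWithin ℝ ρ spaceTime (x, t) ((1, 0), 0)
            + (u (x, t)).2 * fderivWithin ℝ ρ spaceTime (x, t) ((0, 1), 0) = F (x, t) ∧
        (u (x, t)).1 = -fderivWithin ℝ P spaceTime (x, t) ((1, 0), 0) ∧
        (u (x, t)).2 = -fderivWithin ℝ P spaceTime (x, t) ((0, 1), 0) - ρ (x, t) ∧
        (fderivWithin ℝ u spaceTime (x, t) ((1, 0), 0)).1
            + (fderivWithin ℝ u spaceTime (x, t) ((0, 1), 0)).2 = 0) ∧
      -- blow-up of `sup_x |∇u(x,t)|` as `t → 1⁻`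
      Tendsto (fun t => jacSup u t) (nhdsWithin (1 : ℝ) (Set.Iio 1)) atTop ∧
      -- blow-up of `∫₀^t sup_x |∇u(x,s)| ds` as `t → 1⁻`
      Tendsto (fun t => ∫ s in Set.Ioc (0 : ℝ) t, jacSup u s)
        (nhdsWithin (1 : ℝ) (Set.Iio 1)) atTop := by
  obtain ⟨Φ, φ, τ, lam, sφ, hΦ, hτ1, hτ0, hex, hsupp, hbd, hlam, htend, hτ, hlow⟩ := exists_stream
  have hl : ∀ n (y : S), y.2 < τ n → lapl Φ y = lapl (φ n) y := fun n =>
    lapl_eqOn (isOpen_before (τ n)) (hΦ n)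
  have hN : ∀ n (y : S), y.2 < τ n → NN Φ y = NN (φ n) y := fun n =>
    NN_eqOn (isOpen_before (τ n)) (hΦ n)
  have hu : ∀ n (y : S), y.2 < τ n → vel Φ y = vel (φ n) y := fun n =>
    vel_eqOn (isOpen_before (τ n)) (hΦ n)
  have hP : ∀ n (y : S), y.2 < τ n → -dd e2 Φ y = -dd e2 (φ n) y := fun n y hy =>
    congrArg _ (dd_eqOn (isOpen_before (τ n)) e2 (hΦ n) y hy)
  have hout : ∀ y ∈ {y : S | y.2 < 1 ∧ (3 / 5 < |y.1.1| ∨ 3 / 5 < |y.1.2|)}, Φ y = 0 := by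
    rintro y ⟨hy, h⟩
    obtain ⟨n, hn⟩ := hex y.2 hy
    rw [hΦ n y hn, hsupp n y hy h]
  have hρc : ∀ t < 1, HasCompactSupport fun x : ℝ × ℝ => lapl Φ (x, t) := fun t ht =>
    hasCompactSupport_of_zero_outside fun x hx =>
      lapl_zero_on isOpen_outside hout (x, t) ⟨ht, hx⟩
  have hρs : ∀ t < 1, Sm fun x : ℝ × ℝ => lapl Φ (x, t) := fun t ht => by
    obtain ⟨n, hn⟩ := hex t ht
    simpa only [hl n (_, t) hn] using sm_slice (sφ n).lapl t
  have hjac : ∀ n, ∀ t < τ n, jacSup (vel Φ) t = sSup ((fun x => gradNorm (φ n) (x, t)) '' box) :=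
    fun n t ht => by
      rw [jacSup_vel (sφ n) (fun x => hu n (x, t) ht),
        range_eq_image_box (hsupp n) (ht.trans (hτ1 n))]
  have hge : ∀ n, ∀ t ∈ Set.Ico (τ n) 1, lam n ^ 10 / 2 ≤ jacSup (vel Φ) t := by
    intro n t ht
    obtain ⟨k, hk, x, hx⟩ := hlow n t ht
    refine (hx.trans (le_gradNorm (φ k) (x, t))).trans ?_
    have hb : BddAbove {y : ℝ | ∃ x : ℝ × ℝ, y = gradNorm (φ k) (x, t)} := by
      rw [range_eq_image_box (hsupp k) ht.2]
      exact isCompact_box.bddAbove_image ((continuous_gradNorm (sφ k)).comp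
        (by fun_prop : Continuous fun x : ℝ × ℝ => ((x, t) : S))).continuousOn
    rw [jacSup_vel (sφ k) (fun x => hu k (x, t) hk)]
    exact le_csSup hb ⟨x, rfl⟩
  have hint : ∀ t < 1, IntegrableOn (jacSup (vel Φ)) (Set.Ioc 0 t) := by
    intro t ht
    obtain ⟨n, hn⟩ := hex t ht
    have hc : Continuous fun s => sSup ((fun x => gradNorm (φ n) (x, s)) '' box) :=
      isCompact_box.continuous_sSup (f := fun s x => gradNorm (φ n) (x, s))
        ((continuous_gradNorm (sφ n)).comp (by fun_prop : Continuous fun p : ℝ × ℝ × ℝ =>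
          ((p.2, p.1) : S)))
    exact (hc.integrableOn_Ioc).congr_fun (fun s hs => (hjac n s (hs.2.trans_lt hn)).symm)
      measurableSet_Ioc
  have hone : ∀ n, lam n ≤ lam n ^ 10 / 2 := fun n => by
    have := pow_le_pow_right₀ (one_le_two.trans (hlam n)) (show 2 ≤ 10 by norm_num)
    nlinarith [hlam n]
  refine ⟨fun x => lapl Φ (x, 0), lapl Φ, fun y => -dd e2 Φ y, NN Φ, vel Φ, hρs 0 one_pos,
    hρc 0 one_pos, fun t ht => ?_, fun t ht x hx => ?_, fun k => ?_, ?_, ?_, ?_, fun x => rfl,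
    fun t ht => hρc t ht.2, fun t ht => ?_, fun x t ht => ?_, ?_, ?_⟩
  · obtain ⟨n, hn⟩ := hex t ht.2
    simpa only [hN n (_, t) hn] using sm_slice (sφ n).NN t
  · exact sq_add_sq_le_of_abs fun h => hx (NN_zero_on isOpen_outside hout (x, t) ⟨ht.2, h⟩)
  · obtain ⟨M, hM⟩ := hbd k
    refine ⟨M, fun t ht => CkNorm_le fun i j x hij => ?_⟩
    obtain ⟨n, hn⟩ := hex t ht.2
    simp only [hN n (_, t) hn]
    rw [pdMix_slice (sφ n).NN]
    exact hM i j hij n (x, t) ht.1 hn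
  · exact contDiffOn_spaceTime fun t ht => by
      obtain ⟨n, hn⟩ := hex t ht
      exact ⟨τ n, _, hn, (sφ n).lapl, hl n⟩
  · exact contDiffOn_spaceTime fun t ht => by
      obtain ⟨n, hn⟩ := hex t ht
      exact ⟨τ n, _, hn, sm_vel (sφ n), hu n⟩
  · exact contDiffOn_spaceTime fun t ht => by
      obtain ⟨n, hn⟩ := hex t ht
      exact ⟨τ n, _, hn, ((sφ n).dd e2).neg, hP n⟩
  · obtain ⟨n, hn⟩ := hex t ht.2
    simp only [hu n (_, t) hn]
    have hc : Continuous fun x : ℝ × ℝ => vel (φ n) (x, t) :=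
      (sm_vel (sφ n)).continuous.comp (by fun_prop : Continuous fun x : ℝ × ℝ => ((x, t) : S))
    refine Continuous.integrable_of_hasCompactSupport (by fun_prop)
      (hasCompactSupport_of_zero_outside fun x hx => ?_)
    have h0 : vel (φ n) (x, t) = 0 := by
      have hz : ∀ y ∈ {y : S | y.2 < 1 ∧ (3 / 5 < |y.1.1| ∨ 3 / 5 < |y.1.2|)}, φ n y = 0 :=
        fun y hy => hsupp n y hy.1 hy.2
      rw [vel, dd_zero_on isOpen_outside _ (dd_zero_on isOpen_outside _ hz) (x, t) ⟨ht.2, hx⟩,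
        dd_zero_on isOpen_outside _ (dd_zero_on isOpen_outside _ hz) (x, t) ⟨ht.2, hx⟩]
      simp
    simp [h0]
  · obtain ⟨n, hn⟩ := hex t ht.2
    rw [fderivWithin_spaceTime (sφ n).lapl (hl n) ht hn,
      fderivWithin_spaceTime (sm_vel (sφ n)) (hu n) ht hn,
      fderivWithin_spaceTime ((sφ n).dd e2).neg (hP n) ht hn, hu n _ hn, hl n _ hn, hN n _ hn]
    have hn2 : ∀ v : S, fderiv ℝ (fun y => -dd e2 (φ n) y) (x, t) v = -dd v (dd e2 (φ n)) (x, t) :=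
      fun v => congrFun (dd_neg v) _
    have hv : ∀ v : S, fderiv ℝ (vel (φ n)) (x, t) v =
        (dd v (dd e1 (dd e2 (φ n))) (x, t), -dd v (dd e1 (dd e1 (φ n))) (x, t)) := by
      intro v
      have h1 := (((sφ n).dd e2).dd e1).diff (x, t)
      have h2 := (((sφ n).dd e1).dd e1).diff (x, t)
      have := (h1.hasFDerivAt.prodMk h2.hasFDerivAt.neg).fderiv
      rw [show vel (φ n) = fun y => (dd e1 (dd e2 (φ n)) y, (-dd e1 (dd e1 (φ n))) y) from rfl, this]
      rfl
    refine ⟨?_, ?_, ?_, ?_⟩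
    · simp only [NN, vel, dd, e1, e2, eS]; ring
    · rw [hn2]; simp [vel, e1]
    · rw [hn2]; simp only [vel, lapl, e2]; ring
    · rw [hv, hv]
      have h := congrFun (dd_comm e1 e2 ((sφ n).dd e1)) (x, t)
      rw [dd_comm e2 e1 (sφ n)] at h
      exact add_neg_eq_zero.2 h
  · refine tendsto_atTop_of_eventually_ge htend fun n => ⟨τ n, hτ1 n, fun t ht => ?_⟩
    exact (hone n).trans (hge n t ⟨ht.1.le, ht.2⟩)
  · refine tendsto_atTop_of_eventually_ge htend fun n => ⟨1 - 2 * (lam n)⁻¹ ^ 9, ?_, fun t ht => ?_⟩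
    · have := pow_pos (inv_pos.2 (two_pos.trans_le (hlam n))) 9
      linarith
    · have hp : 0 < lam n := two_pos.trans_le (hlam n)
      have hp9 := pow_pos (inv_pos.2 hp) 9
      have hsub : Set.Ioc (τ n) t ⊆ Set.Ioc 0 t := Set.Ioc_subset_Ioc_left (hτ0 n)
      have h1 := setIntegral_ge_of_const_le_real (μ := volume) (s := Set.Ioc (τ n) t)
        (f := jacSup (vel Φ)) measurableSet_Ioc
        (by simp) (fun s hs => hge n s ⟨hs.1.le, hs.2.trans_lt ht.2⟩) ((hint t ht.2).mono_set hsub)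
      have h2 : ∫ s in Set.Ioc (τ n) t, jacSup (vel Φ) s ≤ ∫ s in Set.Ioc 0 t, jacSup (vel Φ) s :=
        setIntegral_mono_set (hint t ht.2) (Eventually.of_forall fun s => jacSup_nonneg _ s)
          hsub.eventuallyLE
      refine le_trans ?_ (h1.trans h2)
      have hle : 2 * (lam n)⁻¹ ^ 9 ≤ t - τ n := by rw [hτ]; linarith [ht.1]
      rw [Real.volume_real_Ioc_of_le (by linarith)]
      calc lam n = lam n ^ 10 / 2 * (2 * (lam n)⁻¹ ^ 9) := by field_simp
        _ ≤ _ := by gcongr
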